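/- Let K be a finite dimensional compact metric space. Then for every n ≥ 1: if K is of basic type then dim Kⁿ = n·dim K, and if K is of exceptional type then dim Kⁿ = n·dim K − n + 1. -/

import Mathlib

open Filter Set
open scoped ENNReal

namespace MeanDimPaper

variable {X : Type*} [TopologicalSpace X]

/-- `α` is an open cover of `X`. -/
def IsOpenCover (α : Set (Set X)) : Prop :=
  (∀ U ∈ α, IsOpen U) ∧ ⋃₀ α = Set.univ

/-- The order of a cover `α`: the maximum `n ≥ 0` such that there exist `n + 1`
pairwise distinct members of `α` with nonempty common intersection. -/
noncomputable def ord (α : Set (Set X)) : ℕ∞ :=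
  ⨆ n ∈ {n : ℕ | ∃ f : Fin (n + 1) → Set X,
      Function.Injective f ∧ (∀ i, f i ∈ α) ∧ (⋂ i, f i).Nonempty}, (n : ℕ∞)

/-- `β` refines `α`: every member of `β` is contained in some member of `α`. -/
def Refines (β α : Set (Set X)) : Prop := ∀ V ∈ β, ∃ U ∈ α, V ⊆ U

/-- `D(α)`: the minimum of `ord β` over open covers `β` refining `α`. -/
noncomputable def covD (α : Set (Set X)) : ℕ∞ :=
  ⨅ β ∈ {β : Set (Set X) | IsOpenCover β ∧ Refines β α}, ord β

/-- Topological (covering) dimension: the supremum of `D(α)` over open covers `α`. -/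
noncomputable def topDim (X : Type*) [TopologicalSpace X] : ℕ∞ :=
  ⨆ α ∈ {α : Set (Set X) | IsOpenCover α}, covD α

/-- Diameter of a set with respect to a distance function `d`. -/
noncomputable def diamD (d : X → X → ℝ) (U : Set X) : ℝ :=
  sSup {r | ∃ x ∈ U, ∃ y ∈ U, r = d x y}

/-- Mesh of a cover: the supremum of the diameters of its members. -/
noncomputable def mesh (d : X → X → ℝ) (α : Set (Set X)) : ℝ :=
  sSup (diamD d '' α)

/-- `widim_ε(X, d)`: the minimum of `D(α)` over open covers `α` with `mesh(α, d) < ε`. -/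
noncomputable def widim (ε : ℝ) (d : X → X → ℝ) : ℕ∞ :=
  ⨅ α ∈ {α : Set (Set X) | IsOpenCover α ∧ mesh d α < ε}, covD α

/-- `d` is a metric on `X` compatible with the topology of `X`. -/
structure IsCompatMetric {X : Type*} [TopologicalSpace X] (d : X → X → ℝ) : Prop where
  refl : ∀ x, d x x = 0
  eq_of : ∀ x y, d x y = 0 → x = y
  symm : ∀ x y, d x y = d y x
  triangle : ∀ x y z, d x z ≤ d x y + d y z
  isOpen_iff : ∀ U : Set X, IsOpen U ↔ ∀ x ∈ U, ∃ ε > 0, ∀ y, d x y < ε → y ∈ U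

/-- The dynamical distance `d_n(x, y) = max_{0 ≤ i < n} d(Tⁱ x, Tⁱ y)`. -/
noncomputable def dynDist (d : X → X → ℝ) (T : X → X) (n : ℕ) (x y : X) : ℝ :=
  sSup {r | ∃ i < n, r = d (T^[i] x) (T^[i] y)}

/-- Mean dimension `mdim(X, T)` computed with the metric `d`:
`lim_{ε → 0} lim_{n → ∞} widim_ε(X, d_n) / n`.  The inner limit exists (by
subadditivity of `n ↦ widim_ε(X, d_n)`) so it coincides with the liminf, and the inner
quantity is monotone as `ε` decreases, so the limit as `ε → 0` is the supremum over
`ε > 0`. -/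
noncomputable def mdim (T : X → X) (d : X → X → ℝ) : ℝ≥0∞ :=
  ⨆ (ε : ℝ) (_ : 0 < ε),
    Filter.liminf (fun n : ℕ => (widim ε (dynDist d T n) : ℝ≥0∞) / (n : ℝ≥0∞)) Filter.atTop

/-- The full shift `σ` on the alphabet `K`: `σ((xₙ)ₙ) = (xₙ₊₁)ₙ`. -/
def shift (K : Type*) : (ℤ → K) → ℤ → K := fun x n => x (n + 1)

end MeanDimPaper

open Filter Set
open scoped ENNReal

namespace TD
open Finsupp

/-! ### Generic facts on finitely supported chains -/
section generic
variable {R : Type*} [CommRing R] {C D E M : Type*} [AddCommGroup M] [Module R M]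

theorem lext {f g : (C →₀ R) →ₗ[R] M} (h : ∀ c, f (single c 1) = g (single c 1)) : f = g := by
  apply Finsupp.lhom_ext'
  intro a
  apply LinearMap.ext_ring
  simpa using h a

theorem mem_of_supp {f : (C →₀ R) →ₗ[R] M} {S : Set C} {N : Submodule R M}
    (h : ∀ c ∈ S, f (single c 1) ∈ N) {u : C →₀ R} (hu : u ∈ supported R R S) : f u ∈ N := by
  rw [Finsupp.supported_eq_span_single] at hu
  have : Submodule.span R ((fun i => single i (1 : R)) '' S) ≤ N.comap f := by
    rw [Submodule.span_le]
    rintro _ ⟨c, hc, rfl⟩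
    exact h c hc
  exact this hu

theorem eq_of_supp {f g : (C →₀ R) →ₗ[R] M} {S : Set C}
    (h : ∀ c ∈ S, f (single c 1) = g (single c 1)) {u : C →₀ R} (hu : u ∈ supported R R S) :
    f u = g u := by
  have := mem_of_supp (f := f - g) (N := ⊥) (fun c hc => by simp [h c hc]) hu
  simpa [sub_eq_zero] using this

theorem zero_of_supp {f : (C →₀ R) →ₗ[R] M} {S : Set C}
    (h : ∀ c ∈ S, f (single c 1) = 0) {u : C →₀ R} (hu : u ∈ supported R R S) :
    f u = 0 := eq_of_supp (g := 0) (by simpa using h) hu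

theorem exists_rec (len : C → ℕ) (b : C → (C →₀ R))
    (hb : ∀ c, b c ∈ supported R R {c' | len c' < len c}) (G : C → M → M) :
    ∃ s : (C →₀ R) →ₗ[R] M, ∀ c, s (single c 1) = G c (s (b c)) := by
  classical
  have wf : WellFounded (fun c c' : C => len c < len c') := (measure len).wf
  let s0 : C → M := wf.fix (fun c ih =>
    G c ((b c).sum fun c' r => if h : len c' < len c then r • ih c' h else 0))
  have hs0 : ∀ c, s0 c = G c ((b c).sum fun c' r => if len c' < len c then r • s0 c' else 0) := by
    intro c
    have := wf.fix_eq (fun c ih =>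
      G c ((b c).sum fun c' r => if h : len c' < len c then r • ih c' h else 0)) c
    simpa [s0] using this
  refine ⟨Finsupp.linearCombination R s0, fun c => ?_⟩
  rw [Finsupp.linearCombination_single, one_smul, hs0]
  congr 1
  rw [Finsupp.linearCombination_apply]
  refine Finsupp.sum_congr fun c' hc' => ?_
  have : len c' < len c := by
    have := (mem_supported R _).1 (hb c) hc'
    exact this
  simp [this]

/-- `f` sends each cell to a chain supported on related cells. -/
def RM (r : C → D → Prop) (f : (C →₀ R) →ₗ[R] (D →₀ R)) : Prop :=
  ∀ c, f (single c 1) ∈ supported R R {k | r c k}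

theorem sup_mono {S T : Set C} (h : S ⊆ T) {u : C →₀ R} (hu : u ∈ supported R R S) :
    u ∈ supported R R T := supported_mono h hu

theorem sg_mem {S : Set C} {c : C} (h : c ∈ S) : (single c 1 : C →₀ R) ∈ supported R R S :=
  single_mem_supported R _ h

theorem RM.mono {r r' : C → D → Prop} {f : (C →₀ R) →ₗ[R] (D →₀ R)} (hf : RM r f)
    (h : ∀ c k, r c k → r' c k) : RM r' f := fun c => sup_mono (h c) (hf c)

theorem RM.app {r : C → D → Prop} {f : (C →₀ R) →ₗ[R] (D →₀ R)} (hf : RM r f)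
    {S : Set C} {T : Set D} (h : ∀ c ∈ S, ∀ k, r c k → k ∈ T) {u} (hu : u ∈ supported R R S) :
    f u ∈ supported R R T :=
  mem_of_supp (fun c hc => sup_mono (h c hc) (hf c)) hu

theorem RM.comp {r : C → D → Prop} {r' : D → E → Prop} {r'' : C → E → Prop}
    {f : (C →₀ R) →ₗ[R] (D →₀ R)}
    {g : (D →₀ R) →ₗ[R] (E →₀ R)} (hf : RM r f) (hg : RM r' g)
    (h : ∀ c d e, r c d → r' d e → r'' c e) : RM r'' (g ∘ₗ f) :=
  fun c => hg.app (fun d hd e he => h c d e hd he) (hf c)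

theorem RM.add {r : C → D → Prop} {f g : (C →₀ R) →ₗ[R] (D →₀ R)} (hf : RM r f) (hg : RM r g) :
    RM r (f + g) := fun c => Submodule.add_mem _ (hf c) (hg c)

theorem RM.sub {r : C → D → Prop} {f g : (C →₀ R) →ₗ[R] (D →₀ R)} (hf : RM r f) (hg : RM r g) :
    RM r (f - g) := fun c => Submodule.sub_mem _ (hf c) (hg c)

theorem RM.id {r : C → C → Prop} (h : ∀ c, r c c) :
    RM r (LinearMap.id : (C →₀ R) →ₗ[R] (C →₀ R)) := fun c => sg_mem (h c)

end generic

/-! ### The complex of lists -/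
abbrev Ch (R : Type*) [CommRing R] (X : Type*) := List X →₀ R

section cx
variable {R : Type*} [CommRing R] {X Y : Type*}

noncomputable def cns (x : X) : Ch R X →ₗ[R] Ch R X := lmapDomain R R (List.cons x)

@[simp] theorem cns_single (x : X) (l : List X) (r : R) :
    cns x (single l r) = single (x :: l) r := by simp [cns]

noncomputable def bd : List X → Ch R X
  | [] => 0
  | x :: l => single l 1 - cns x (bd l)

noncomputable def dl : Ch R X →ₗ[R] Ch R X := linearCombination R bd

@[simp] theorem dl_single (l : List X) : dl (single l (1 : R)) = bd l := by simp [dl]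
@[simp] theorem bd_nil : bd ([] : List X) = (0 : Ch R X) := rfl
theorem bd_cons (x : X) (l : List X) : bd (x :: l) = (single l 1 - cns x (bd l) : Ch R X) := rfl

theorem dl_cns (x : X) (c : Ch R X) : dl (cns x c) = c - cns x (dl c) := by
  have : (dl ∘ₗ cns x : Ch R X →ₗ[R] Ch R X) = LinearMap.id - cns x ∘ₗ dl := by
    apply lext; intro l; simp [bd_cons]
  simpa using LinearMap.congr_fun this c

theorem dl_bd (l : List X) : dl (bd l : Ch R X) = 0 := by
  induction l with
  | nil => simp
  | cons x l ih => rw [bd_cons, map_sub, dl_cns, ih]; simp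

@[simp] theorem dl_dl (c : Ch R X) : dl (dl c) = 0 := by
  have : (dl ∘ₗ dl : Ch R X →ₗ[R] Ch R X) = 0 := by
    apply lext; intro l; simp [dl_bd]
  simpa using LinearMap.congr_fun this c

def Fc (l k : List X) : Prop := k.length + 1 = l.length ∧ k.Sublist l

theorem bd_mem (l : List X) : (bd l : Ch R X) ∈ supported R R {k | Fc l k} := by
  induction l with
  | nil => simp
  | cons x l ih =>
    rw [bd_cons]
    refine Submodule.sub_mem _ (sg_mem ⟨rfl, by simp⟩) ?_
    refine mem_of_supp (f := cns x) ?_ ih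
    rintro k ⟨h1, h2⟩
    rw [cns_single]
    exact sg_mem ⟨by simp [h1], by simpa using h2⟩

theorem dl_RM : RM Fc (dl : Ch R X →ₗ[R] Ch R X) := fun l => by simpa using bd_mem l

noncomputable def mp (φ : X → Y) : Ch R X →ₗ[R] Ch R Y := lmapDomain R R (List.map φ)

@[simp] theorem mp_single (φ : X → Y) (l : List X) (r : R) :
    mp φ (single l r) = single (l.map φ) r := by simp [mp]

theorem mp_cns (φ : X → Y) (x : X) (c : Ch R X) : mp φ (cns x c) = cns (φ x) (mp φ c) := by
  have : (mp φ ∘ₗ cns x : Ch R X →ₗ[R] Ch R Y) = cns (φ x) ∘ₗ mp φ := by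
    apply lext; intro l; simp
  simpa using LinearMap.congr_fun this c

theorem bd_map (φ : X → Y) (l : List X) : (bd (l.map φ) : Ch R Y) = mp φ (bd l) := by
  induction l with
  | nil => simp
  | cons x l ih => rw [List.map_cons, bd_cons, bd_cons, ih, map_sub, mp_cns]; simp

theorem dl_mp (φ : X → Y) (c : Ch R X) : dl (mp φ c) = mp φ (dl c) := by
  have : (dl ∘ₗ mp φ : Ch R X →ₗ[R] Ch R Y) = mp φ ∘ₗ dl := by
    apply lext; intro l; simp [bd_map]
  simpa using LinearMap.congr_fun this c

/-- recursion on lists -/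
theorem list_rec {M : Type*} [AddCommGroup M] [Module R M] (G : List X → M → M) :
    ∃ s : Ch R X →ₗ[R] M, ∀ l, s (single l 1) = G l (s (bd l)) :=
  exists_rec List.length bd (fun l => sup_mono (by rintro k ⟨h, _⟩; simp only [mem_ofPred_eq]; omega)
    (bd_mem l)) G

/-- induction principle for linear identities on lists -/
theorem lin_ind {M : Type*} [AddCommGroup M] [Module R M] {f g : Ch R X →ₗ[R] M}
    (h : ∀ l : List X, f (bd l) = g (bd l) → f (single l 1) = g (single l 1)) : f = g := by
  have key : ∀ n : ℕ, ∀ l : List X, l.length = n → f (single l 1) = g (single l 1) := by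
    intro n
    induction n using Nat.strong_induction_on with
    | _ n ih =>
      intro l hl
      apply h
      refine eq_of_supp ?_ (bd_mem l)
      rintro k ⟨hk, -⟩
      exact ih k.length (by omega) k rfl
  exact lext fun l => key _ l rfl

theorem mem_ind {M : Type*} [AddCommGroup M] [Module R M] {f : Ch R X →ₗ[R] M}
    {N : List X → Submodule R M} (hN : ∀ l k, Fc l k → N k ≤ N l)
    (h : ∀ l : List X, f (bd l) ∈ N l → f (single l 1) ∈ N l) (l : List X) :
    f (single l 1) ∈ N l := by
  have key : ∀ n : ℕ, ∀ l : List X, l.length = n → f (single l 1) ∈ N l := by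
    intro n
    induction n using Nat.strong_induction_on with
    | _ n ih =>
      intro l hl
      apply h
      refine mem_of_supp ?_ (bd_mem l)
      rintro k hk
      exact hN l k hk (ih k.length (by have := hk.1; omega) k rfl)
  exact key _ l rfl

/-- controlled maps: raise length by `d` and points controlled by the predicate `P`. -/
def PM (P : List X → Y → Prop) (d : ℕ) (f : Ch R X →ₗ[R] Ch R Y) : Prop :=
  RM (fun l k => k.length = l.length + d ∧ ∀ y ∈ k, P l y) f

theorem PM.bd {P : List X → Y → Prop} {d : ℕ} {f : Ch R X →ₗ[R] Ch R Y} (hf : PM P d f)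
    (hP : ∀ l k y, k.Sublist l → P k y → P l y) (l : List X) :
    f (bd l) ∈ supported R R {k | k.length + 1 = l.length + d ∧ ∀ y ∈ k, P l y} := by
  refine RM.app hf ?_ (bd_mem l)
  rintro k ⟨hk1, hk2⟩ m ⟨hm1, hm2⟩
  exact ⟨by omega, fun y hy => hP l k y hk2 (hm2 y hy)⟩

theorem cns_mem {S T : Set (List X)} {x : X} (h : ∀ k ∈ S, x :: k ∈ T) {u : Ch R X}
    (hu : u ∈ supported R R S) : cns x u ∈ supported R R T := by
  refine mem_of_supp ?_ hu
  intro k hk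
  rw [cns_single]
  exact sg_mem (h k hk)

/-- cone homotopy. -/
theorem cone_homotopy (F G : Ch R X →ₗ[R] Ch R Y) (hF : ∀ c, dl (F c) = F (dl c))
    (hG : ∀ c, dl (G c) = G (dl c)) (h0 : F (single [] 1) = G (single [] 1))
    (v : List X → Y) (P : List X → Y → Prop) (hP : ∀ l k y, k.Sublist l → P k y → P l y)
    (hv : ∀ l, l ≠ [] → P l (v l)) (hFP : PM P 0 F) (hGP : PM P 0 G) :
    ∃ h : Ch R X →ₗ[R] Ch R Y, (∀ c, dl (h c) + h (dl c) = G c - F c) ∧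
      h (single [] 1) = 0 ∧ PM P 1 h := by
  classical
  obtain ⟨h, hh⟩ := list_rec (R := R) (X := X) (fun l u =>
    if l = [] then (0 : Ch R Y) else cns (v l) (G (single l 1) - F (single l 1) - u))
  have hnil : h (single [] 1) = 0 := by rw [hh]; simp
  refine ⟨h, ?_, hnil, ?_⟩
  · have : dl ∘ₗ h + h ∘ₗ dl = G - F := by
      apply lin_ind
      intro l hl
      by_cases h1 : l = []
      · subst h1; simp [hnil, h0]
      · simp only [LinearMap.add_apply, LinearMap.comp_apply, LinearMap.sub_apply, dl_bd, map_zero,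
          add_zero] at hl
        simp only [LinearMap.add_apply, LinearMap.comp_apply, LinearMap.sub_apply, dl_single]
        rw [hh l, if_neg h1, dl_cns]
        simp only [map_sub, hG, hF, hl, dl_single]
        abel
    intro c
    simpa using LinearMap.congr_fun this c
  · have key : ∀ n : ℕ, ∀ l : List X, l.length = n →
        h (single l 1) ∈ supported R R {k | k.length = l.length + 1 ∧ ∀ y ∈ k, P l y} := by
      intro n
      induction n using Nat.strong_induction_on with
      | _ n ih =>
        intro l hl
        rw [hh l]
        split_ifs with h1
        · exact Submodule.zero_mem _
        · refine cns_mem (S := {k | k.length = l.length ∧ ∀ y ∈ k, P l y}) ?_ ?_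
          · rintro k ⟨hk, hk'⟩
            refine ⟨by simp [hk], ?_⟩
            intro y hy
            rcases List.mem_cons.1 hy with rfl | hy
            · exact hv l h1
            · exact hk' y hy
          · refine Submodule.sub_mem _ (Submodule.sub_mem _ (hGP l) (hFP l)) ?_
            refine mem_of_supp ?_ (bd_mem l)
            rintro k ⟨hk1, hk2⟩
            refine sup_mono ?_ (ih k.length (by omega) k rfl)
            rintro m ⟨hm1, hm2⟩
            exact ⟨by omega, fun y hy => hP l k y hk2 (hm2 y hy)⟩
    exact fun l => key _ l rfl

/-- change of coefficients -/
theorem base_change {A B C D : Type*} [CommRing A] [CommRing B] (φ : A →+* B)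
    (s : (C →₀ A) →ₗ[A] (D →₀ A)) :
    ∃ s' : (C →₀ B) →ₗ[B] (D →₀ B), ∀ u : C →₀ A,
      s' (u.mapRange φ (map_zero φ)) = (s u).mapRange φ (map_zero φ) := by
  refine ⟨linearCombination B fun c => (s (single c 1)).mapRange φ (map_zero φ), fun u => ?_⟩
  induction u using Finsupp.induction_linear with
  | zero => simp
  | add f g hf hg =>
    rw [Finsupp.mapRange_add (hf' := map_add φ), map_add, hf, hg, map_add,
      Finsupp.mapRange_add (hf' := map_add φ)]
  | single c a =>
    rw [Finsupp.mapRange_single, linearCombination_single]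
    have : single c a = a • (single c 1 : C →₀ A) := by simp
    rw [this, map_smul]
    ext d
    simp

theorem mapRange_supp {A B C : Type*} [CommRing A] [CommRing B] (φ : A →+* B) {S : Set C}
    {u : C →₀ A} (hu : u ∈ supported A A S) :
    u.mapRange φ (map_zero φ) ∈ supported B B S := by
  rw [mem_supported] at hu ⊢
  exact (Finset.coe_subset.2 (Finsupp.support_mapRange)).trans hu

theorem bd_base {A B : Type*} [CommRing A] [CommRing B] (φ : A →+* B) (l : List X) :
    (bd l : Ch A X).mapRange φ (map_zero φ) = (bd l : Ch B X) := by
  induction l with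
  | nil => simp
  | cons x l ih =>
    rw [bd_cons, bd_cons, Finsupp.mapRange_sub (hf' := map_sub φ), ← ih]
    congr 1
    · simp
    · simp only [cns, lmapDomain_apply]
      rw [← Finsupp.mapDomain_mapRange (hadd := map_add φ)]

theorem dl_base {A B : Type*} [CommRing A] [CommRing B] (φ : A →+* B) (u : Ch A X) :
    (dl u).mapRange φ (map_zero φ) = dl (u.mapRange φ (map_zero φ)) := by
  induction u using Finsupp.induction_linear with
  | zero => simp
  | add f g hf hg =>
    rw [Finsupp.mapRange_add (hf' := map_add φ), map_add, 
      Finsupp.mapRange_add (hf' := map_add φ), hf, hg, map_add]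
  | single c a =>
    rw [Finsupp.mapRange_single]
    have : single c a = a • (single c 1 : Ch A X) := by simp
    rw [this, map_smul, dl_single]
    have : single c (φ a) = φ a • (single c 1 : Ch B X) := by simp
    rw [this, map_smul, dl_single, ← bd_base φ]
    ext d
    simp

end cx
end TD

open Filter Set
open scoped ENNReal

set_option linter.unusedSectionVars false
set_option linter.unusedVariables false

namespace TD
open Finsupp

section hd
variable {R : Type*} [CommRing R] {X Y : Type*} [MetricSpace X] [MetricSpace Y]

def nr (ε : ℝ) (l : List X) (y : X) : Prop := ∃ x ∈ l, dist x y ≤ ε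
def small (δ : ℝ) (l : List X) : Prop := ∀ x ∈ l, ∀ y ∈ l, dist x y ≤ δ

theorem nr.mono {ε ε' : ℝ} (h : ε ≤ ε') {l k : List X} (hk : k ⊆ l) {y : X} (hy : nr ε k y) :
    nr ε' l y := by
  obtain ⟨x, hx, h1⟩ := hy
  exact ⟨x, hk hx, h1.trans h⟩

theorem nr.trans {ε ε' : ℝ} {l k : List X} (hk : ∀ y ∈ k, nr ε l y) {y : X} (hy : nr ε' k y) :
    nr (ε + ε') l y := by
  obtain ⟨x, hx, h1⟩ := hy
  obtain ⟨w, hw, h2⟩ := hk x hx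
  exact ⟨w, hw, (dist_triangle _ x _).trans (add_le_add h2 h1)⟩

theorem nr_self {ε : ℝ} (hε : 0 ≤ ε) {l : List X} {x : X} (hx : x ∈ l) : nr ε l x :=
  ⟨x, hx, by simpa using hε⟩

theorem small.mono {δ δ' : ℝ} (h : δ ≤ δ') {l k : List X} (hk : k ⊆ l) (hl : small δ l) :
    small δ' k := fun x hx y hy => (hl x (hk hx) y (hk hy)).trans h

theorem small.near {δ ε : ℝ} {l k : List X} (hl : small δ l) (hk : ∀ y ∈ k, nr ε l y) :
    small (δ + 2 * ε) k := by
  intro x hx y hy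
  obtain ⟨a, ha, h1⟩ := hk x hx
  obtain ⟨b, hb, h2⟩ := hk y hy
  have := hl a ha b hb
  have h3 := dist_triangle x a y
  have h4 := dist_triangle a b y
  rw [dist_comm x a] at h3
  linarith

/-- homological dimension at most `e` -/
def HD (R : Type*) [CommRing R] (X : Type*) [MetricSpace X] (e : ℕ) : Prop :=
  ∀ ε > 0, ∃ δ > 0, ∃ s : Ch R X →ₗ[R] Ch R X, PM (nr ε) 1 s ∧
    ∀ l, small δ l → e + 2 ≤ l.length → dl (s (single l 1)) + s (bd l) = single l 1

theorem HD.of_small {e : ℕ} (h : ∀ ε > 0, ∃ δ > 0, ∃ s : Ch R X →ₗ[R] Ch R X,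
    (∀ l, small δ l → s (single l 1) ∈ supported R R
      {k | k.length = l.length + 1 ∧ ∀ y ∈ k, nr ε l y}) ∧
    ∀ l, small δ l → e + 2 ≤ l.length → dl (s (single l 1)) + s (bd l) = single l 1) :
    HD R X e := by
  classical
  intro ε hε
  obtain ⟨δ, hδ, s, hs, hs'⟩ := h ε hε
  refine ⟨δ, hδ, linearCombination R fun l => if small δ l then s (single l 1) else 0, ?_, ?_⟩
  · intro l
    simp only [linearCombination_single, one_smul]
    split_ifs with h1
    · exact hs l h1
    · exact Submodule.zero_mem _
  · intro l hl hl'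
    rw [linearCombination_single, one_smul, if_pos hl]
    refine Eq.trans ?_ (hs' l hl hl')
    congr 1
    refine eq_of_supp ?_ (bd_mem l)
    rintro k ⟨-, hk⟩
    simp [hl.mono le_rfl hk.subset]

theorem HD.mono {e e' : ℕ} (h : e ≤ e') (he : HD R X e) : HD R X e' := by
  intro ε hε
  obtain ⟨δ, hδ, s, hs, hs'⟩ := he ε hε
  exact ⟨δ, hδ, s, hs, fun l h1 h2 => hs' l h1 (by omega)⟩

theorem HD.base {A B : Type*} [CommRing A] [CommRing B] (φ : A →+* B) {e : ℕ} (h : HD A X e) :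
    HD B X e := by
  intro ε hε
  obtain ⟨δ, hδ, s, hs, hs'⟩ := h ε hε
  obtain ⟨s', hs1⟩ := base_change φ s
  have hsg : ∀ l : List X, s' (single l 1) = (s (single l 1)).mapRange φ (map_zero φ) := by
    intro l
    have := hs1 (single l 1)
    simpa using this
  refine ⟨δ, hδ, s', ?_, ?_⟩
  · intro l
    rw [hsg]
    exact mapRange_supp φ (hs l)
  · intro l h1 h2
    rw [hsg, ← dl_base, ← bd_base φ, hs1, ← Finsupp.mapRange_add (hf' := map_add φ), hs' l h1 h2]
    simp

def Inn (A : Set X) (η : ℝ) (x : X) : Prop := ∀ y, dist x y ≤ η → y ∈ A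

/-- the cochain `z` of degree `j`, relative to `A`, dies at `η`. -/
def Dies (A : Set X) (η : ℝ) (j : ℕ) (z : Ch R X →ₗ[R] R) : Prop :=
  ∃ δ > 0, ∃ b : Ch R X →ₗ[R] R,
    (∀ l, small δ l → l.length = j + 1 → z (single l 1) = b (bd l)) ∧
    ∀ l, small δ l → l.length = j → (∀ x ∈ l, Inn A η x) → b (single l 1) = 0

/-- `z` is a cocycle of degree `j` relative to `A` at scale `ε` -/
def Cyc (A : Set X) (ε : ℝ) (j : ℕ) (z : Ch R X →ₗ[R] R) : Prop :=
    (∀ l, small ε l → l.length = j + 2 → z (bd l) = 0) ∧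
    ∀ l, small ε l → l.length = j + 1 → (∀ x ∈ l, x ∈ A) → z (single l 1) = 0

def PV (R : Type*) [CommRing R] (X : Type*) [MetricSpace X] (j : ℕ) : Prop :=
  ∀ (A : Set X), ∀ η > 0, ∀ ε > 0, ∀ z : Ch R X →ₗ[R] R, Cyc A ε j z → Dies A η j z

theorem HD.pv {e j : ℕ} (h : HD R X e) (hj : e + 1 ≤ j) : PV R X j := by
  intro A η hη ε hε z ⟨hz1, hz2⟩
  obtain ⟨δ, hδ, s, hs, hs'⟩ := h (min (ε / 4) η) (by positivity)
  have m1 := min_le_left (ε / 4) η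
  have m2 := min_le_right (ε / 4) η
  refine ⟨min δ (ε / 2), by positivity, z ∘ₗ s, ?_, ?_⟩
  · intro l hl hlen
    have e1 := hs' l (hl.mono (min_le_left _ _) (List.Subset.refl _)) (by omega)
    have : z (dl (s (single l 1))) = 0 := by
      refine zero_of_supp (f := z ∘ₗ dl) ?_ (hs l)
      rintro k ⟨hk1, hk2⟩
      simp only [LinearMap.comp_apply, dl_single]
      refine hz1 k ((hl.near hk2).mono ?_ (List.Subset.refl _)) (by omega)
      have := min_le_right δ (ε / 2)
      linarith
    rw [← e1, map_add, this]
    simp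
  · intro l hl hlen hA
    rw [LinearMap.comp_apply]
    refine zero_of_supp (f := z) ?_ (hs l)
    rintro k ⟨hk1, hk2⟩
    refine hz2 k ((hl.near hk2).mono ?_ (List.Subset.refl _)) (by omega) ?_
    · have := min_le_right δ (ε / 2)
      linarith
    · intro y hy
      obtain ⟨x, hx, hxy⟩ := hk2 y hy
      exact hA x hx y (hxy.trans m2)

theorem PM.comp_nr {a b : ℝ} {i j : ℕ} {f g : Ch R X →ₗ[R] Ch R X} (hf : PM (nr a) i f)
    (hg : PM (nr b) j g) : PM (nr (a + b)) (i + j) (g ∘ₗ f) := by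
  refine RM.comp hf hg ?_
  rintro l k m ⟨h1, h2⟩ ⟨h3, h4⟩
  exact ⟨by omega, fun y hy => nr.trans h2 (h4 y hy)⟩

theorem PM.mono_nr {a b : ℝ} (h : a ≤ b) {i : ℕ} {f : Ch R X →ₗ[R] Ch R X} (hf : PM (nr a) i f) :
    PM (nr b) i f :=
  RM.mono hf fun l k hk => ⟨hk.1, fun y hy => (hk.2 y hy).mono h (List.Subset.refl _)⟩

theorem nr_sub {a : ℝ} (l k : List X) (y : X) (h : k.Sublist l) (hy : nr a k y) : nr a l y :=
  hy.mono le_rfl h.subset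

/-- the chain map `1 - ∂s - s∂` is controlled. -/
theorem PM.defect {a : ℝ} (ha : 0 ≤ a) {s : Ch R X →ₗ[R] Ch R X} (hs : PM (nr a) 1 s) :
    PM (nr a) 0 (LinearMap.id - dl ∘ₗ s - s ∘ₗ dl) := by
  intro l
  simp only [LinearMap.sub_apply, LinearMap.comp_apply, dl_single, LinearMap.id_apply]
  refine Submodule.sub_mem _ (Submodule.sub_mem _ ?_ ?_) ?_
  · exact sg_mem ⟨by simp, fun y hy => nr_self ha hy⟩
  · refine RM.app dl_RM ?_ (hs l)
    rintro k ⟨hk1, hk2⟩ m ⟨hm1, hm2⟩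
    exact ⟨by omega, fun y hy => hk2 y (hm2.subset hy)⟩
  · refine sup_mono ?_ (hs.bd (fun l k y => nr_sub l k y) l)
    rintro k ⟨hk1, hk2⟩
    exact ⟨by omega, hk2⟩

theorem defect_chain (s : Ch R X →ₗ[R] Ch R X) (c : Ch R X) :
    dl ((LinearMap.id - dl ∘ₗ s - s ∘ₗ dl : Ch R X →ₗ[R] Ch R X) c) =
    (LinearMap.id - dl ∘ₗ s - s ∘ₗ dl : Ch R X →ₗ[R] Ch R X) (dl c) := by
  simp

theorem exists_net [CompactSpace X] {ε : ℝ} (hε : 0 < ε) :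
    ∃ ρ : X → X, (range ρ).Finite ∧ ∀ x, dist x (ρ x) ≤ ε := by
  obtain ⟨t, -, ht, hcov⟩ := finite_cover_balls_of_compact (isCompact_univ (X := X)) hε
  have : ∀ x, ∃ y ∈ t, dist x y ≤ ε := by
    intro x
    have := hcov (mem_univ x)
    simp only [mem_iUnion, Metric.mem_ball] at this
    obtain ⟨y, hy, h⟩ := this
    exact ⟨y, hy, h.le⟩
  choose ρ h1 h2 using this
  exact ⟨ρ, ht.subset (by rintro _ ⟨x, rfl⟩; exact h1 x), h2⟩

theorem mp_PM {ρ : X → X} {ε : ℝ} (h : ∀ x, dist x (ρ x) ≤ ε) :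
    PM (nr ε) 0 (mp ρ : Ch R X →ₗ[R] Ch R X) := by
  intro l
  rw [mp_single]
  refine sg_mem ⟨by simp, ?_⟩
  intro y hy
  obtain ⟨x, hx, rfl⟩ := List.mem_map.1 hy
  exact ⟨x, hx, h x⟩

theorem net_homotopy {ρ : X → X} {ε : ℝ} (hε : 0 ≤ ε) (h : ∀ x, dist x (ρ x) ≤ ε) :
    ∃ s : Ch R X →ₗ[R] Ch R X, (∀ c, dl (s c) + s (dl c) = c - mp ρ c) ∧ PM (nr ε) 1 s := by
  classical
  by_cases hX : Nonempty X
  · obtain ⟨x0⟩ := hX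
    obtain ⟨s, h1, -, h2⟩ := cone_homotopy (mp ρ : Ch R X →ₗ[R] Ch R X) LinearMap.id
      (fun c => dl_mp ρ c) (fun c => rfl) (by simp) (fun l => l.headD x0) (nr ε)
      (fun l k y hk => nr_sub l k y hk) (by
        intro l hl
        cases l with
        | nil => simp at hl
        | cons x l => exact nr_self hε (by simp))
      (mp_PM h) (RM.id fun l => ⟨by simp, fun y hy => nr_self hε hy⟩)
    exact ⟨s, fun c => by simpa using h1 c, h2⟩
  · refine ⟨0, ?_, fun l => Submodule.zero_mem _⟩
    have : (mp ρ : Ch R X →ₗ[R] Ch R X) = LinearMap.id := by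
      apply lext
      intro l
      cases l with
      | nil => simp
      | cons x l => exact (hX ⟨x⟩).elim
    intro c
    simp [this]

theorem finite_lists {S : Set X} (hS : S.Finite) (n : ℕ) :
    {l : List X | l.length = n ∧ ∀ x ∈ l, x ∈ S}.Finite := by
  have := List.finite_length_eq hS.toFinset n
  refine (this.image (List.map Subtype.val)).subset ?_
  rintro l ⟨h1, h2⟩
  refine ⟨l.attach.map fun x => ⟨x.1, by simpa using h2 x.1 x.2⟩, by simpa using h1, ?_⟩
  simp [List.map_map, Function.comp_def]

theorem exists_pos_le {α : Type*} {S : Set α} (hS : S.Finite) (d : α → ℝ)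
    (hd : ∀ a ∈ S, 0 < d a) : ∃ δ > 0, ∀ a ∈ S, δ ≤ d a := by
  induction S, hS using Set.Finite.induction_on with
  | empty => exact ⟨1, one_pos, by simp⟩
  | insert _ _ ih =>
    obtain ⟨δ, h1, h2⟩ := ih (fun a ha => hd a (mem_insert_of_mem _ ha))
    refine ⟨min δ (d _), lt_min h1 (hd _ (mem_insert _ _)), ?_⟩
    rintro a (rfl | ha)
    · exact min_le_right _ _
    · exact (min_le_left _ _).trans (h2 a ha)

theorem HD.descend [CompactSpace X] {e : ℕ} (h : HD R X (e + 1)) (hp : PV R X (e + 1)) :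
    HD R X e := by
  classical
  apply HD.of_small
  intro ε hε
  set ε1 := ε / 10 with hε1
  have hε1' : 0 < ε1 := by positivity
  obtain ⟨δ1, hδ1, s1, hs1, hs1'⟩ := h ε1 hε1'
  obtain ⟨ρ, hρ, hρd⟩ := exists_net (X := X) hε1'
  obtain ⟨h0, hh0, hh0'⟩ := net_homotopy (R := R) hε1'.le hρd
  set f : Ch R X →ₗ[R] Ch R X := mp ρ ∘ₗ (LinearMap.id - dl ∘ₗ s1 - s1 ∘ₗ dl) with hf
  set s2 : Ch R X →ₗ[R] Ch R X := h0 + mp ρ ∘ₗ s1 with hs2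
  have hs2P : PM (nr (2 * ε1)) 1 s2 := by
    refine RM.add (hh0'.mono_nr (by linarith)) ?_
    have := hs1.comp_nr (mp_PM (R := R) hρd)
    exact this.mono_nr (by linarith)
  have hs2d : ∀ c, dl (s2 c) + s2 (dl c) = c - f c := by
    intro c
    have := hh0 c
    simp only [hs2, hf, LinearMap.add_apply, LinearMap.comp_apply, map_add, LinearMap.sub_apply,
      map_sub, LinearMap.id_apply, dl_mp]
    rw [add_add_add_comm, this]; abel
  have hfP : PM (nr (2 * ε1)) 0 f := by
    have := (hs1.defect hε1'.le).comp_nr (mp_PM (R := R) hρd)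
    exact this.mono_nr (by linarith)
  have hfd : ∀ c, dl (f c) = f (dl c) := by
    intro c
    rw [hf, LinearMap.comp_apply, dl_mp, defect_chain]; rfl
  have hf0 : ∀ l, small δ1 l → e + 3 ≤ l.length → f (single l 1) = 0 := by
    intro l hl hlen
    have := hs1' l hl (by omega)
    simp only [hf, LinearMap.comp_apply, LinearMap.sub_apply, LinearMap.id_apply, dl_single]
    rw [sub_sub, this]; simp
  have hfρ : ∀ c, f c ∈ supported R R {k | ∀ x ∈ k, x ∈ range ρ} := by
    intro c
    have : RM (fun (l k : List X) => k = l.map ρ) (mp ρ : Ch R X →ₗ[R] Ch R X) := by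
      intro l; rw [mp_single]; exact sg_mem rfl
    refine RM.app this (S := univ) ?_ (by simp)
    rintro l - k rfl x hx
    obtain ⟨y, -, rfl⟩ := List.mem_map.1 hx
    exact ⟨y, rfl⟩
  -- finitely many simplices
  set S0 : Set (List X) := {l | (l.length = e + 2 ∧ ∀ x ∈ l, x ∈ range ρ) ∧ small (5 * ε1) l}
    with hS0
  have hfin : S0.Finite := (finite_lists hρ (e + 2)).subset (fun l hl => hl.1)
  have hb : ∀ σ ∈ S0, Dies (R := R) {x : X | ∀ y ∈ σ, 2 * ε1 < dist x y} ε1 (e + 1)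
      (lapply σ ∘ₗ f) := by
    intro σ hσ
    refine hp _ ε1 hε1' δ1 hδ1 _ ⟨?_, ?_⟩
    · intro l hl hlen
      rw [LinearMap.comp_apply, ← dl_single, ← hfd, hf0 l hl (by omega)]
      simp
    · intro l hl hlen hA
      rw [LinearMap.comp_apply, lapply_apply]
      by_contra hne
      have := (mem_supported R _).1 (hfP l) (Finsupp.mem_support_iff.2 hne)
      obtain ⟨-, h2⟩ := this
      obtain ⟨y, hy⟩ : ∃ y, y ∈ σ := by
        cases hσ' : σ with
        | nil => have := hσ.1.1; simp [hσ'] at this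
        | cons y _ => exact ⟨y, by simp⟩
      obtain ⟨x, hx, hxy⟩ := h2 y hy
      exact absurd (hA x hx y hy) (not_lt.2 hxy)
  choose! d hd b hb1 hb2 using hb
  obtain ⟨δ0, hδ0, hδ0'⟩ := exists_pos_le hfin d hd
  set t : Ch R X →ₗ[R] Ch R X := linearCombination R fun l =>
    if l.length = e + 1 then ∑ σ ∈ hfin.toFinset, b σ (single l 1) • single σ 1 else 0 with ht
  have ht0 : ∀ l : List X, l.length ≠ e + 1 → t (single l 1) = 0 := by
    intro l hl
    rw [ht, linearCombination_single, if_neg hl, smul_zero]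
  have ht1 : ∀ l : List X, l.length = e + 1 →
      t (single l 1) = ∑ σ ∈ hfin.toFinset, b σ (single l 1) • single σ 1 := by
    intro l hl
    rw [ht, linearCombination_single, if_pos hl, one_smul]
  refine ⟨min δ0 (min δ1 ε1), by positivity, s2 + t, ?_, ?_⟩
  · intro l hl
    refine Submodule.add_mem _ (hs2P.mono_nr (by linarith) l) ?_
    by_cases hlen : l.length = e + 1
    · rw [ht1 l hlen]
      refine Submodule.sum_mem _ fun σ hσ => ?_
      rw [Finite.mem_toFinset] at hσ
      by_cases h0 : b σ (single l 1) = 0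
      · rw [h0, zero_smul]; exact Submodule.zero_mem _
      · refine Submodule.smul_mem _ _ (sg_mem ⟨by rw [hσ.1.1, hlen], ?_⟩)
        have : ¬ ∀ x ∈ l, Inn {x : X | ∀ y ∈ σ, 2 * ε1 < dist x y} ε1 x := by
          intro hA
          exact h0 (hb2 σ hσ l (hl.mono ((min_le_left _ _).trans (hδ0' σ hσ))
            (List.Subset.refl _)) hlen hA)
        simp only [Inn, mem_ofPred_eq, not_forall, not_lt] at this
        obtain ⟨x, hx, x', hxx', y, hy, hxy⟩ := this
        intro y' hy'
        refine ⟨x, hx, ?_⟩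
        have := hσ.2 y hy y' hy'
        have h3 := dist_triangle x x' y'
        have h4 := dist_triangle x' y y'
        linarith
    · rw [ht0 l hlen]; exact Submodule.zero_mem _
  · intro l hl hlen
    have hl1 : small δ1 l := hl.mono ((min_le_right _ _).trans (min_le_left _ _))
      (List.Subset.refl _)
    have e1 := hs2d (single l 1)
    rw [dl_single] at e1
    simp only [LinearMap.add_apply, map_add]
    rw [ht0 l (by omega), map_zero, add_zero, ← add_assoc, e1]
    have : f (single l 1) = t (bd l) := by
      by_cases hlen' : l.length = e + 2
      · have e2 : t (bd l) = ∑ σ ∈ hfin.toFinset, b σ (bd l) • (single σ 1 : Ch R X) := by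
          have := eq_of_supp (f := t)
            (g := ∑ σ ∈ hfin.toFinset, (b σ).smulRight (single σ 1 : Ch R X))
            (fun k hk => by
              rw [ht1 k (by have := hk.1; omega)]
              simp [LinearMap.sum_apply]) (bd_mem l)
          rw [this]
          simp [LinearMap.sum_apply]
        rw [e2]
        have e3 : ∀ σ ∈ hfin.toFinset, b σ (bd l) • (single σ 1 : Ch R X) =
            single σ (f (single l 1) σ) := by
          intro σ hσ
          rw [Finite.mem_toFinset] at hσ
          rw [← hb1 σ hσ l (hl.mono ((min_le_left _ _).trans (hδ0' σ hσ))
            (List.Subset.refl _)) hlen']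
          simp
        rw [Finset.sum_congr rfl e3]
        have hsub : (f (single l 1)).support ⊆ hfin.toFinset := by
          intro σ hσ
          rw [Finite.mem_toFinset]
          have h1 := (mem_supported R _).1 (hfP l) hσ
          have h2 := (mem_supported R _).1 (hfρ (single l 1)) hσ
          refine ⟨⟨by have := h1.1; omega, h2⟩, (hl.near h1.2).mono ?_ (List.Subset.refl _)⟩
          have : min δ0 (min δ1 ε1) ≤ ε1 := (min_le_right _ _).trans (min_le_right _ _)
          linarith
        conv_lhs => rw [← Finsupp.sum_single (f (single l 1))]
        exact Finsupp.sum_of_support_subset _ hsub _ (by simp)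
      · rw [hf0 l hl1 (by omega)]
        symm
        refine zero_of_supp ?_ (bd_mem l)
        rintro k ⟨hk, -⟩
        exact ht0 k (by omega)
    rw [this]; abel

end hd
end TD

open Filter Set
open scoped ENNReal
set_option linter.unusedSectionVars false
set_option linter.unusedVariables false

namespace TD
open Finsupp

section tensor
variable {R : Type*} [CommRing R] {C D C' D' C'' D'' : Type*}

noncomputable def tm : (C →₀ R) →ₗ[R] (D →₀ R) →ₗ[R] (C × D →₀ R) :=
  linearCombination R fun c => lmapDomain R R (Prod.mk c)

@[simp] theorem tm_single (c : C) (d : D) (r r' : R) :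
    tm (single c r) (single d r') = single (c, d) (r * r') := by
  simp [tm]

noncomputable def tmap (f : (C →₀ R) →ₗ[R] (C' →₀ R)) (g : (D →₀ R) →ₗ[R] (D' →₀ R)) :
    (C × D →₀ R) →ₗ[R] (C' × D' →₀ R) :=
  linearCombination R fun p => tm (f (single p.1 1)) (g (single p.2 1))

@[simp] theorem tmap_single (f : (C →₀ R) →ₗ[R] (C' →₀ R)) (g : (D →₀ R) →ₗ[R] (D' →₀ R))
    (p : C × D) : tmap f g (single p 1) = tm (f (single p.1 1)) (g (single p.2 1)) := by
  simp [tmap]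

theorem bext {M : Type*} [AddCommGroup M] [Module R M] {f g : (C →₀ R) →ₗ[R] (D →₀ R) →ₗ[R] M}
    (h : ∀ c d, f (single c 1) (single d 1) = g (single c 1) (single d 1)) : f = g :=
  lext fun c => lext fun d => h c d

@[simp] theorem tmap_tm (f : (C →₀ R) →ₗ[R] (C' →₀ R)) (g : (D →₀ R) →ₗ[R] (D' →₀ R))
    (u : C →₀ R) (v : D →₀ R) : tmap f g (tm u v) = tm (f u) (g v) := by
  have : (tm (C := C) (D := D) (R := R)).compr₂ (tmap f g) = (tm).compl₁₂ f g := by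
    apply bext
    intro c d
    simp
  exact LinearMap.congr_fun (LinearMap.congr_fun this u) v

theorem tmap_tmap (f : (C →₀ R) →ₗ[R] (C' →₀ R)) (g : (D →₀ R) →ₗ[R] (D' →₀ R))
    (f' : (C' →₀ R) →ₗ[R] (C'' →₀ R)) (g' : (D' →₀ R) →ₗ[R] (D'' →₀ R)) (u : C × D →₀ R) :
    tmap f' g' (tmap f g u) = tmap (f' ∘ₗ f) (g' ∘ₗ g) u := by
  have : (tmap f' g') ∘ₗ (tmap f g) = tmap (f' ∘ₗ f) (g' ∘ₗ g) := by
    apply lext; intro p; simp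
  exact LinearMap.congr_fun this u

theorem tmap_add_left (f f' : (C →₀ R) →ₗ[R] (C' →₀ R)) (g : (D →₀ R) →ₗ[R] (D' →₀ R)) :
    tmap (f + f') g = tmap f g + tmap f' g := by
  apply lext; intro p; simp
theorem tmap_add_right (f : (C →₀ R) →ₗ[R] (C' →₀ R)) (g g' : (D →₀ R) →ₗ[R] (D' →₀ R)) :
    tmap f (g + g') = tmap f g + tmap f g' := by
  apply lext; intro p; simp
theorem tmap_neg_left (f : (C →₀ R) →ₗ[R] (C' →₀ R)) (g : (D →₀ R) →ₗ[R] (D' →₀ R)) :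
    tmap (-f) g = - tmap f g := by
  apply lext; intro p; simp
theorem tmap_neg_right (f : (C →₀ R) →ₗ[R] (C' →₀ R)) (g : (D →₀ R) →ₗ[R] (D' →₀ R)) :
    tmap f (-g) = - tmap f g := by
  apply lext; intro p; simp

theorem tm_mem {S : Set C} {T : Set D} {U : Set (C × D)} (h : ∀ c ∈ S, ∀ d ∈ T, (c, d) ∈ U)
    {u : C →₀ R} (hu : u ∈ supported R R S)
    {v : D →₀ R} (hv : v ∈ supported R R T) : tm u v ∈ supported R R U := by
  have := mem_of_supp (f := tm.flip v) (N := supported R R U) (S := S) ?_ hu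
  · simpa using this
  intro c hc
  rw [LinearMap.flip_apply]
  refine mem_of_supp ?_ hv
  intro d hd
  rw [tm_single, one_mul]
  exact sg_mem (h c hc d hd)

theorem tmap_RM {r : C → C' → Prop} {r' : D → D' → Prop} {f : (C →₀ R) →ₗ[R] (C' →₀ R)}
    {g : (D →₀ R) →ₗ[R] (D' →₀ R)} (hf : RM r f) (hg : RM r' g) {q : C × D → C' × D' → Prop}
    (h : ∀ p p', r p.1 p'.1 → r' p.2 p'.2 → q p p') : RM q (tmap f g) := by
  intro p
  rw [tmap_single]
  exact tm_mem (fun c hc d hd => h p (c, d) hc hd) (hf p.1) (hg p.2)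

theorem gen_ind {M : Type*} [AddCommGroup M] [Module R M] (len : C → ℕ) (Pr : C → Prop)
    (b : C → (C →₀ R)) (hb : ∀ c, Pr c → b c ∈ supported R R {c' | Pr c' ∧ len c' < len c})
    {f g : (C →₀ R) →ₗ[R] M}
    (h : ∀ c, Pr c → f (b c) = g (b c) → f (single c 1) = g (single c 1)) :
    ∀ c, Pr c → f (single c 1) = g (single c 1) := by
  have key : ∀ n : ℕ, ∀ c, Pr c → len c = n → f (single c 1) = g (single c 1) := by
    intro n
    induction n using Nat.strong_induction_on with
    | _ n ih =>
      intro c hP hc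
      apply h c hP
      refine eq_of_supp ?_ (hb c hP)
      rintro k ⟨hk1, hk2⟩
      exact ih (len k) (by omega) k hk1 rfl
  exact fun c hc => key _ c hc rfl

theorem gen_mem {M : Type*} [AddCommGroup M] [Module R M] (len : C → ℕ)
    (b : C → (C →₀ R)) (hb : ∀ c, b c ∈ supported R R {c' | len c' < len c})
    {f : (C →₀ R) →ₗ[R] M} {N : C → Submodule R M}
    (h : ∀ c, (∀ k ∈ (b c).support, f (single k 1) ∈ N k) → f (single c 1) ∈ N c) :
    ∀ c, f (single c 1) ∈ N c := by
  have key : ∀ n : ℕ, ∀ c, len c = n → f (single c 1) ∈ N c := by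
    intro n
    induction n using Nat.strong_induction_on with
    | _ n ih =>
      intro c hc
      apply h c
      intro k hk
      have := (mem_supported R _).1 (hb c) hk
      exact ih (len k) (by simp only [mem_ofPred_eq] at this; omega) k rfl
  exact fun c => key _ c rfl
end tensor

section ez
variable {R : Type*} [CommRing R] {X Y : Type*}

open Classical in
noncomputable def dt : Ch R X →ₗ[R] Ch R X :=
  linearCombination R fun l => if l.length ≤ 1 then 0 else bd l

theorem dt_le (l : List X) (h : l.length ≤ 1) : dt (single l (1 : R)) = 0 := by
  simp [dt, h]
theorem dt_gt (l : List X) (h : 2 ≤ l.length) : dt (single l (1 : R)) = bd l := by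
  have : ¬ l.length ≤ 1 := by omega
  simp [dt, this]

theorem dt_mem (l : List X) : dt (single l (1 : R)) ∈ supported R R {k | Fc l k ∧ k ≠ []} := by
  by_cases h : l.length ≤ 1
  · rw [dt_le l h]; exact Submodule.zero_mem _
  · rw [dt_gt l (by omega)]
    refine sup_mono ?_ (bd_mem l)
    rintro k hk
    refine ⟨hk, ?_⟩
    rintro rfl
    have := hk.1
    simp at this; omega

theorem dt_dt (c : Ch R X) : dt (dt c) = 0 := by
  have : (dt ∘ₗ dt : Ch R X →ₗ[R] Ch R X) = 0 := by
    apply lext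
    intro l
    rw [LinearMap.comp_apply, LinearMap.zero_apply]
    rcases Nat.lt_or_ge l.length 3 with h | h
    · refine zero_of_supp ?_ (dt_mem l)
      rintro k ⟨hk, -⟩
      exact dt_le k (by have := hk.1; omega)
    · rw [dt_gt l (by omega), ← dl_bd l]
      refine eq_of_supp ?_ (bd_mem l)
      intro k hk
      rw [dt_gt k (by have := hk.1; omega), dl_single]
  simpa using LinearMap.congr_fun this c

noncomputable def io : Ch R X →ₗ[R] Ch R X :=
  linearCombination R fun l => (-1 : R) ^ (l.length + 1) • single l 1

theorem io_single (l : List X) : io (single l (1 : R)) = (-1 : R) ^ (l.length + 1) • single l 1 := by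
  simp [io]

theorem dt_io (c : Ch R X) : dt (io c) = - io (dt c) := by
  have : (dt ∘ₗ io : Ch R X →ₗ[R] Ch R X) = -(io ∘ₗ dt : Ch R X →ₗ[R] Ch R X) := by
    apply lext
    intro l
    rw [LinearMap.comp_apply, LinearMap.neg_apply, io_single, map_smul]
    have := eq_of_supp (f := io) (g := (-1 : R) ^ (l.length) • LinearMap.id)
      (fun k hk => by rw [io_single]; rw [hk.1.1]; simp) (dt_mem (R := R) l)
    rw [LinearMap.comp_apply, this]
    simp [pow_succ]
  simpa using LinearMap.congr_fun this c

theorem io_io (c : Ch R X) : io (io c) = c := by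
  have : (io ∘ₗ io : Ch R X →ₗ[R] Ch R X) = LinearMap.id := by
    apply lext
    intro l
    simp only [LinearMap.comp_apply, io_single, map_smul, smul_smul, ← mul_pow, LinearMap.id_apply]
    simp
  simpa using LinearMap.congr_fun this c

abbrev Ch2 (R : Type*) [CommRing R] (X Y : Type*) := List X × List Y →₀ R

noncomputable def DD : Ch2 R X Y →ₗ[R] Ch2 R X Y := tmap dt LinearMap.id + tmap io dt

theorem DD_tm (u : Ch R X) (v : Ch R Y) : DD (tm u v) = tm (dt u) v + tm (io u) (dt v) := by
  simp [DD]

theorem DD_DD (c : Ch2 R X Y) : DD (DD c) = 0 := by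
  have : (DD ∘ₗ DD : Ch2 R X Y →ₗ[R] Ch2 R X Y) = 0 := by
    apply lext
    rintro ⟨a, b⟩
    have : (single (a, b) 1 : Ch2 R X Y) = tm (single a 1) (single b 1) := by simp
    rw [this]
    simp only [LinearMap.comp_apply, DD_tm, map_add, dt_dt, dt_io]
    simp
  simpa using LinearMap.congr_fun this c

def ne2 (p : List X × List Y) : Prop := p.1 ≠ [] ∧ p.2 ≠ []
def ln (p : List X × List Y) : ℕ := p.1.length + p.2.length

def Fc2 (p q : List X × List Y) : Prop := ln q + 1 = ln p ∧ q.1.Sublist p.1 ∧ q.2.Sublist p.2 ∧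
  (p.1 = [] ↔ q.1 = []) ∧ (p.2 = [] ↔ q.2 = [])

theorem DD_RM : RM Fc2 (DD : Ch2 R X Y →ₗ[R] Ch2 R X Y) := by
  refine RM.add ?_ ?_
  · refine tmap_RM (r := fun l k => Fc l k ∧ k ≠ []) (r' := fun l k => k = l) dt_mem
      (RM.id fun _ => rfl) ?_
    rintro ⟨a, b⟩ ⟨a', b'⟩ ⟨⟨h1, h2⟩, h3⟩ rfl
    refine ⟨by simp only [ln]; simp only at h1; omega, h2, List.Sublist.refl _, ?_, Iff.rfl⟩
    simp only [h3, iff_false]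
    rintro rfl
    simp at h1
  · refine tmap_RM (r := fun l k => k = l) (r' := fun l k => Fc l k ∧ k ≠ []) ?_ dt_mem ?_
    · intro l; rw [io_single]; exact Submodule.smul_mem _ _ (sg_mem rfl)
    rintro ⟨a, b⟩ ⟨a', b'⟩ rfl ⟨⟨h1, h2⟩, h3⟩
    refine ⟨by simp only [ln]; simp only at h1; omega, List.Sublist.refl _, h2, Iff.rfl, ?_⟩
    simp only [h3, iff_false]
    rintro rfl
    simp at h1

/-- augmentation of the unaugmented complex -/
noncomputable def ep : Ch R X →ₗ[R] R := linearCombination R fun l => if l.length = 1 then 1 else 0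

theorem ep_single (l : List X) : ep (single l (1 : R)) = if l.length = 1 then 1 else 0 := by
  simp [ep]

theorem ep_dt (c : Ch R X) : ep (dt c) = 0 := by
  have : (ep ∘ₗ dt : Ch R X →ₗ[R] R) = 0 := by
    apply lext
    intro l
    rw [LinearMap.comp_apply, LinearMap.zero_apply]
    by_cases h : l.length = 2
    · obtain ⟨a, b, rfl⟩ := List.length_eq_two.1 h
      rw [dt_gt _ (by simp)]
      simp [bd_cons, ep_single]
    · refine zero_of_supp ?_ (dt_mem l)
      rintro k ⟨hk, -⟩
      rw [ep_single, if_neg (by have := hk.1; omega)]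
  simpa using LinearMap.congr_fun this c

theorem ep_io (c : Ch R X) : ep (io c) = ep c := by
  have : (ep ∘ₗ io : Ch R X →ₗ[R] R) = ep := by
    apply lext
    intro l
    rw [LinearMap.comp_apply, io_single, map_smul, ep_single]
    split_ifs with h
    · simp [h]
    · simp
  simpa using LinearMap.congr_fun this c

noncomputable def ag : Ch2 R X Y →ₗ[R] R :=
  linearCombination R fun p => if p.1.length = 1 ∧ p.2.length = 1 then 1 else 0

theorem ag_single (p : List X × List Y) : ag (single p (1 : R)) =
    if p.1.length = 1 ∧ p.2.length = 1 then 1 else 0 := by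
  simp [ag]

theorem ag_tm (u : Ch R X) (v : Ch R Y) : ag (tm u v) = ep u * ep v := by
  have : (tm (C := List X) (D := List Y) (R := R)).compr₂ ag =
      (LinearMap.mul R R).compl₁₂ ep ep := by
    apply bext
    intro c d
    simp [ag_single, ep_single]
    split_ifs <;> simp_all
  exact LinearMap.congr_fun (LinearMap.congr_fun this u) v

theorem ag_DD (c : Ch2 R X Y) : ag (DD c) = 0 := by
  have : (ag ∘ₗ DD : Ch2 R X Y →ₗ[R] R) = 0 := by
    apply lext
    rintro ⟨a, b⟩
    have : (single (a, b) 1 : Ch2 R X Y) = tm (single a 1) (single b 1) := by simp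
    rw [this]
    simp only [LinearMap.comp_apply, DD_tm, map_add, ag_tm, ep_dt]
    simp
  simpa using LinearMap.congr_fun this c

theorem ag_zero {u : Ch2 R X Y} {n : ℕ} (hn : n ≠ 2) (hu : u ∈ supported R R {p | ln p = n}) :
    ag u = 0 := by
  refine zero_of_supp ?_ hu
  rintro p hp
  rw [ag_single, if_neg]
  rintro ⟨h1, h2⟩
  simp only [ln, mem_ofPred_eq] at hp
  omega

theorem DD_lt (p : List X × List Y) :
    DD (single p (1 : R)) ∈ supported R R {q | ln q < ln p} :=
  sup_mono (fun q hq => by have := hq.1; simp only [mem_ofPred_eq]; omega) (DD_RM p)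

theorem exists_EZ : ∃ EZ : Ch2 R X Y →ₗ[R] Ch R (X × Y),
    (∀ c, dl (EZ c) = EZ (DD c) + ag c • single [] 1) ∧
    (∀ x y, EZ (single ([x], [y]) 1) = single [(x, y)] 1) ∧
    RM (fun p k => k.length + 1 = ln p ∧ ∀ z ∈ k, z.1 ∈ p.1 ∧ z.2 ∈ p.2) EZ := by
  classical
  obtain ⟨EZ, hE⟩ := exists_rec (R := R) (M := Ch R (X × Y)) ln (fun p : List X × List Y =>
    DD (single p 1)) DD_lt (fun p u => match p with
      | (x :: a, y :: b) => cns (x, y) (u + ag (single (x :: a, y :: b) (1 : R)) • single [] 1)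
      | _ => 0)
  have h0 : ∀ p, ¬ ne2 p → EZ (single p 1) = 0 := by
    rintro ⟨a, b⟩ hp
    rw [hE]
    cases a with
    | nil => simp
    | cons x a =>
      cases b with
      | nil => simp
      | cons y b => simp [ne2] at hp
  refine ⟨EZ, ?_, ?_, ?_⟩
  · have : dl ∘ₗ EZ = EZ ∘ₗ DD + (LinearMap.toSpanSingleton R (Ch R (X × Y)) (single [] 1)) ∘ₗ ag := by
      apply lext
      intro p
      refine gen_ind (R := R) ln (fun _ => True) (fun p : List X × List Y => DD (single p 1))
        (fun c _ => sup_mono (fun q (hq : ln q < ln c) => (⟨trivial, hq⟩ : True ∧ ln q < ln c)) (DD_lt c)) ?_ p trivial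
      rintro ⟨a, b⟩ - hp
      simp only [LinearMap.comp_apply, LinearMap.add_apply, DD_DD, map_zero, ag_DD, add_zero] at hp
      by_cases hne : ne2 (a, b)
      · obtain ⟨h1, h2⟩ := hne
        cases a with
        | nil => simp at h1
        | cons x a =>
          cases b with
          | nil => simp at h2
          | cons y b =>
            simp only [LinearMap.comp_apply, LinearMap.add_apply]
            rw [hE]
            simp only []
            rw [dl_cns, map_add, hp, map_smul, dl_single]
            simp
      · have : EZ (DD (single (a, b) 1)) = 0 := by
          refine zero_of_supp ?_ (DD_RM (R := R) (a, b))
          rintro ⟨a', b'⟩ ⟨-, -, -, h4, h5⟩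
          apply h0
          simpa [ne2, ← h4, ← h5] using hne
        simp only [LinearMap.comp_apply, LinearMap.add_apply]
        rw [h0 _ hne, this, ag_single, if_neg]
        · simp
        · rintro ⟨h1, h2⟩
          apply hne
          constructor <;> (rintro h; simp_all)
    intro c
    simpa using LinearMap.congr_fun this c
  · intro x y
    rw [hE]
    simp only []
    have : DD (single ([x], [y]) (1 : R)) = 0 := by
      simp [DD, dt_le]
    rw [this, ag_single]
    simp
  · refine gen_mem ln (fun p : List X × List Y => DD (single p (1 : R))) DD_lt (N := fun p =>
      supported R R {k : List (X × Y) | k.length + 1 = ln p ∧ ∀ z ∈ k, z.1 ∈ p.1 ∧ z.2 ∈ p.2}) ?_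
    rintro ⟨a, b⟩ ih
    have hih : EZ (DD (single (a, b) 1)) ∈ supported R R
        {k : List (X × Y) | k.length + 2 = ln (a, b) ∧ ∀ z ∈ k, z.1 ∈ a ∧ z.2 ∈ b} := by
      refine mem_of_supp (S := ((DD (single (a, b) (1 : R))).support : Set _)) ?_
        ((mem_supported R _).2 (subset_refl _))
      intro q hq
      refine sup_mono ?_ (ih q hq)
      rintro k ⟨hk1, hk2⟩
      have hF := (mem_supported R _).1 (DD_RM (R := R) (a, b)) hq
      obtain ⟨h1, h2, h3, -⟩ := hF
      exact ⟨by omega, fun z hz => ⟨h2.subset (hk2 z hz).1, h3.subset (hk2 z hz).2⟩⟩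
    cases a with
    | nil => rw [h0 _ (by simp [ne2])]; exact Submodule.zero_mem _
    | cons x a =>
      cases b with
      | nil => rw [h0 _ (by simp [ne2])]; exact Submodule.zero_mem _
      | cons y b =>
        rw [hE]
        simp only []
        refine cns_mem (S := {k : List (X × Y) | k.length + 2 = ln (x :: a, y :: b) ∧
            ∀ z ∈ k, z.1 ∈ x :: a ∧ z.2 ∈ y :: b}) ?_ (Submodule.add_mem _ hih ?_)
        · rintro k ⟨hk1, hk2⟩
          refine ⟨by simp only [List.length_cons]; omega, ?_⟩
          intro z hz
          rcases List.mem_cons.1 hz with rfl | hz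
          · simp
          · exact hk2 z hz
        · rw [ag_single]
          split_ifs with h
          · rw [one_smul]
            refine sg_mem ⟨?_, by simp⟩
            simp only [ln] at h ⊢
            simp only [h.1, h.2]; rfl
          · rw [zero_smul]; exact Submodule.zero_mem _

end ez
end TD

open Filter Set
open scoped ENNReal
set_option linter.unusedSectionVars false
set_option linter.unusedVariables false

namespace TD
open Finsupp

section aw
variable {R : Type*} [CommRing R] {X Y : Type*}

theorem sg2 (a : List X) (b : List Y) :
    (single (a, b) 1 : Ch2 R X Y) = tm (single a 1) (single b 1) := by simp

theorem dt_cns (x : X) {c : Ch R X} (hc : c ∈ supported R R {k : List X | k ≠ []}) :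
    dt (cns x c) = c - cns x (dt c) - ep c • single [x] 1 := by
  refine eq_of_supp (f := dt ∘ₗ cns x) (g := LinearMap.id - cns x ∘ₗ dt -
    (LinearMap.toSpanSingleton R (Ch R X) (single [x] 1)) ∘ₗ ep) ?_ hc
  intro l hl
  simp only [LinearMap.comp_apply, LinearMap.sub_apply, cns_single, LinearMap.id_apply]
  have h1 : 1 ≤ l.length := List.length_pos_iff.2 hl
  rw [dt_gt _ (by simp; omega), bd_cons, ep_single]
  by_cases h : l.length = 1
  · obtain ⟨y, rfl⟩ := List.length_eq_one_iff.1 h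
    simp [dt_le, bd_cons]
  · rw [dt_gt l (by omega)]
    simp [h]

theorem io_cns (x : X) (c : Ch R X) : io (cns x c) = - cns x (io c) := by
  have : (io ∘ₗ cns x : Ch R X →ₗ[R] Ch R X) = -(cns x ∘ₗ io : Ch R X →ₗ[R] Ch R X) := by
    apply lext
    intro l
    simp only [LinearMap.comp_apply, LinearMap.neg_apply, cns_single, io_single, map_smul]
    simp [pow_succ]
  simpa using LinearMap.congr_fun this c

/-- slice: `ep ⊗ 1` -/
noncomputable def sl : Ch2 R X Y →ₗ[R] Ch R Y :=
  linearCombination R fun p => if p.1.length = 1 then single p.2 1 else 0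

theorem sl_tm (u : Ch R X) (v : Ch R Y) : sl (tm u v) = ep u • v := by
  have : (tm (C := List X) (D := List Y) (R := R)).compr₂ sl =
      (LinearMap.lsmul R (Ch R Y)).compl₁₂ ep LinearMap.id := by
    apply bext
    intro c d
    simp only [LinearMap.compr₂_apply, tm_single, LinearMap.compl₁₂_apply, ep_single]
    simp [sl]
  exact LinearMap.congr_fun (LinearMap.congr_fun this u) v

theorem DD_cns (x : X) {c : Ch2 R X Y} (hc : c ∈ supported R R {p | ne2 p}) :
    DD (tmap (cns x) LinearMap.id c) =
      c - tmap (cns x) LinearMap.id (DD c) - tm (single [x] 1) (sl c) := by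
  refine eq_of_supp (f := DD ∘ₗ tmap (cns x) LinearMap.id) (g := LinearMap.id -
    tmap (cns x) LinearMap.id ∘ₗ DD - tm (single [x] 1) ∘ₗ sl) ?_ hc
  rintro ⟨a, b⟩ ⟨ha, hb⟩
  simp only [LinearMap.comp_apply, LinearMap.sub_apply, LinearMap.id_apply]
  rw [sg2, tmap_tm, DD_tm, DD_tm, dt_cns x (sg_mem ha), io_cns, map_add, tmap_tm, tmap_tm, sl_tm]
  simp only [map_sub, LinearMap.sub_apply, map_neg, LinearMap.neg_apply, map_smul,
    LinearMap.smul_apply, LinearMap.id_apply]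
  abel

noncomputable def AW0 : List (X × Y) → Ch2 R X Y
  | [] => 0
  | z :: l => tm (single [z.1] 1) (single (z.2 :: l.map Prod.snd) 1) +
      tmap (cns z.1) LinearMap.id (AW0 l)

noncomputable def AW : Ch R (X × Y) →ₗ[R] Ch2 R X Y := linearCombination R AW0

@[simp] theorem AW_single (l : List (X × Y)) : AW (single l (1 : R)) = AW0 l := by simp [AW]

theorem AW_cns (z : X × Y) (c : Ch R (X × Y)) : AW (cns z c) =
    tm (single [z.1] 1) (cns z.2 (mp Prod.snd c)) + tmap (cns z.1) LinearMap.id (AW c) := by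
  have : AW ∘ₗ cns z = tm (single [z.1] (1 : R)) ∘ₗ cns z.2 ∘ₗ mp Prod.snd +
      tmap (cns z.1) LinearMap.id ∘ₗ AW := by
    apply lext
    intro l
    simp only [LinearMap.comp_apply, cns_single, AW_single, LinearMap.add_apply, mp_single]
    rfl
  exact LinearMap.congr_fun this c

theorem AW_RM : RM (fun (l : List (X × Y)) p => ln p = l.length + 1 ∧ ne2 p ∧
    (∀ x ∈ p.1, x ∈ l.map Prod.fst) ∧ (∀ x ∈ p.2, x ∈ l.map Prod.snd))
    (AW : Ch R (X × Y) →ₗ[R] Ch2 R X Y) := by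
  intro l
  rw [AW_single]
  induction l with
  | nil => exact Submodule.zero_mem _
  | cons z l ih =>
    rw [AW0]
    refine Submodule.add_mem _ ?_ ?_
    · rw [tm_single, one_mul]
      refine sg_mem ⟨by simp [ln]; omega, ⟨by simp, by simp⟩, by simp, ?_⟩
      intro x hx
      simpa using hx
    · refine mem_of_supp ?_ ih
      rintro ⟨a, b⟩ ⟨h1, h2, h3, h4⟩
      rw [tmap_single, cns_single]
      simp only [LinearMap.id_apply, tm_single, one_mul]
      refine sg_mem ⟨?_, ⟨by simp, h2.2⟩, ?_, ?_⟩
      · simp only [ln, List.length_cons] at h1 ⊢; omega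
      · intro x hx
        rcases List.mem_cons.1 hx with rfl | hx
        · simp
        · simp only [List.map_cons, List.mem_cons]; exact Or.inr (h3 x hx)
      · intro x hx
        simp only [List.map_cons, List.mem_cons]; exact Or.inr (h4 x hx)

theorem AW_ne (c : Ch R (X × Y)) : AW c ∈ supported R R {p | ne2 p} :=
  RM.app AW_RM (S := univ) (fun l _ k hk => hk.2.1) (by simp)

theorem ep_cns (x : X) {c : Ch R X} (hc : c ∈ supported R R {k : List X | k ≠ []}) :
    ep (cns x c) = 0 := by
  refine zero_of_supp (f := ep ∘ₗ cns x) ?_ hc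
  intro k hk
  rw [LinearMap.comp_apply, cns_single, ep_single, if_neg]
  simpa using hk

theorem sl_cns (x : X) {c : Ch2 R X Y} (hc : c ∈ supported R R {p | ne2 p}) :
    sl (tmap (cns x) LinearMap.id c) = 0 := by
  refine zero_of_supp (f := sl ∘ₗ tmap (cns x) LinearMap.id) ?_ hc
  rintro ⟨a, b⟩ ⟨ha, hb⟩
  rw [LinearMap.comp_apply, sg2, tmap_tm, sl_tm, ep_cns x (sg_mem ha), zero_smul]

theorem sl_AW (l : List (X × Y)) (hl : l ≠ []) : sl (AW0 l) = (single (l.map Prod.snd) 1 : Ch R Y) := by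
  cases l with
  | nil => simp at hl
  | cons z l =>
    rw [AW0, map_add, sl_tm, sl_cns]
    · simp [ep_single]
    · rw [← AW_single]; exact AW_ne _

theorem DD_AW (c : Ch R (X × Y)) : DD (AW c) = AW (dl c) := by
  have : DD ∘ₗ AW = AW ∘ₗ (dl : Ch R (X × Y) →ₗ[R] _) := by
    apply lext
    intro l
    simp only [LinearMap.comp_apply, AW_single, dl_single]
    induction l with
    | nil => simp [AW0]
    | cons z l ih =>
      have hne : (AW0 l : Ch2 R X Y) ∈ supported R R {p | ne2 p} := by
        rw [← AW_single]; exact AW_ne _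
      rw [AW0, map_add, DD_cns _ hne, ih, DD_tm, dt_le [z.1] (by simp), bd_cons, map_sub,
        AW_cns, AW_single, io_single]
      by_cases hl : l = []
      · subst hl
        simp [AW0, dt_le]
      · rw [sl_AW l hl, dt_gt _ (by have := List.length_pos_iff.2 hl; simp; omega), bd_cons,
          bd_map]
        simp
        abel
  exact LinearMap.congr_fun this c

theorem ag_AW (l : List (X × Y)) : ag (AW0 l) = (if l.length = 1 then 1 else 0 : R) := by
  cases l with
  | nil => simp [AW0]
  | cons z l =>
    have h2 : ag (tmap (cns z.1) LinearMap.id (AW0 l : Ch2 R X Y)) = 0 := by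
      refine zero_of_supp (f := (ag : Ch2 R X Y →ₗ[R] R) ∘ₗ tmap (cns z.1) LinearMap.id)
        (S := {p | ne2 p}) (u := AW0 l) ?_ (by rw [← AW_single]; exact AW_ne _)
      rintro ⟨a, b⟩ ⟨ha, hb⟩
      rw [LinearMap.comp_apply, sg2, tmap_tm, ag_tm, ep_cns _ (sg_mem ha), zero_mul]
    rw [AW0, map_add, h2, ag_tm, ep_single, ep_single]
    simp

end aw

section hd2
variable {R : Type*} [CommRing R] {X Y : Type*} [MetricSpace X] [MetricSpace Y]

def r2 (ε : ℝ) (d : ℕ) (p q : List X × List Y) : Prop :=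
  ln q = ln p + d ∧ (p.1 ≠ [] → q.1 ≠ []) ∧ (p.2 ≠ [] → q.2 ≠ []) ∧
    (∀ x ∈ q.1, nr ε p.1 x) ∧ (∀ x ∈ q.2, nr ε p.2 x)

def HD2 (R : Type*) [CommRing R] (X Y : Type*) [MetricSpace X] [MetricSpace Y] (e : ℕ) : Prop :=
  ∀ ε > 0, ∃ δ > 0, ∃ s : Ch2 R X Y →ₗ[R] Ch2 R X Y, RM (r2 ε 1) s ∧
    ∀ p, ne2 p → small δ p.1 → small δ p.2 → e + 3 ≤ ln p →
      DD (s (single p 1)) + s (DD (single p 1)) = single p 1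

theorem HD2.hd {e : ℕ} (h : HD2 R X Y e) : HD R (X × Y) e := by
  classical
  apply HD.of_small
  intro ε hε
  obtain ⟨δ, hδ, s, hs, hs'⟩ := h (ε / 2) (by positivity)
  obtain ⟨EZ, hEd, hE1, hER⟩ := exists_EZ (R := R) (X := X) (Y := Y)
  set P : List (X × Y) → X × Y → Prop := fun l z => (∃ w ∈ l, w.1 = z.1) ∧ (∃ w ∈ l, w.2 = z.2)
    with hP
  set F : Ch R (X × Y) →ₗ[R] Ch R (X × Y) := EZ ∘ₗ AW +
    (LinearMap.toSpanSingleton R (Ch R (X × Y)) (single [] 1)) ∘ₗ lapply [] with hF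
  have hFd : ∀ c, dl (F c) = F (dl c) := by
    have : dl ∘ₗ F = F ∘ₗ dl := by
      apply lext
      intro l
      have hDA : DD (AW0 l : Ch2 R X Y) = AW (bd l) := by
        rw [← AW_single, DD_AW, dl_single]
      simp only [hF, LinearMap.comp_apply, LinearMap.add_apply, map_add, hEd, AW_single, hDA,
        ag_AW, dl_single, LinearMap.toSpanSingleton_apply, map_smul, bd_nil, smul_zero, add_zero]
      congr 2
      cases l with
      | nil => simp
      | cons z l =>
        rw [bd_cons]
        have : (cns z (bd l) : Ch R (X × Y)) [] = 0 := by
          by_contra hne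
          have h1 : (cns z (bd l) : Ch R (X × Y)) ∈ supported R R {k | k ≠ []} :=
            cns_mem (S := univ) (by simp) (by simp)
          exact (mem_supported R _).1 h1 (Finsupp.mem_support_iff.2 hne) rfl
        by_cases hl : l = []
        · simp [hl]
        · simp [hl, this]
    exact fun c => LinearMap.congr_fun this c
  have hEA : RM (fun (l k : List (X × Y)) => k.length = l.length ∧ ∀ z ∈ k, P l z)
      (EZ ∘ₗ AW) := by
    refine RM.comp AW_RM hER ?_
    rintro l p k ⟨h1, h2, h3, h4⟩ ⟨h5, h6⟩
    refine ⟨by omega, fun z hz => ⟨?_, ?_⟩⟩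
    · simpa using h3 _ (h6 z hz).1
    · simpa using h4 _ (h6 z hz).2
  have hFP : PM P 0 F := by
    refine RM.add (hEA.mono fun l k hk => hk) ?_
    intro l
    rw [LinearMap.comp_apply]
    by_cases hl : l = []
    · subst hl
      simp only [lapply_apply, single_eq_same, LinearMap.toSpanSingleton_apply, one_smul]
      exact sg_mem ⟨rfl, by simp⟩
    · simp [hl]
  by_cases hXY : Nonempty (X × Y)
  swap
  · refine ⟨1, one_pos, 0, fun l _ => Submodule.zero_mem _, ?_⟩
    intro l _ hl
    cases l with
    | nil => simp at hl
    | cons z _ => exact (hXY ⟨z⟩).elim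
  obtain ⟨z0⟩ := hXY
  obtain ⟨h1, hh1, -, hh2⟩ := cone_homotopy F LinearMap.id hFd (fun _ => rfl)
    (by simp [hF, AW0]) (fun l => l.headD z0) P (by
      rintro l k y hk ⟨⟨w, hw, h1⟩, ⟨w', hw', h2⟩⟩
      exact ⟨⟨w, hk.subset hw, h1⟩, ⟨w', hk.subset hw', h2⟩⟩) (by
      intro l hl
      cases l with
      | nil => simp at hl
      | cons z l => exact ⟨⟨z, by simp, rfl⟩, ⟨z, by simp, rfl⟩⟩) hFP
      (RM.id fun l => ⟨rfl, fun z hz => ⟨⟨z, hz, rfl⟩, ⟨z, hz, rfl⟩⟩⟩)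
  refine ⟨min δ (ε / 2), by positivity, EZ ∘ₗ s ∘ₗ AW + h1, ?_, ?_⟩
  · intro l hl
    have hδ2 : min δ (ε / 2) ≤ ε / 2 := min_le_right _ _
    have near : ∀ z : X × Y, (∃ w ∈ l, dist w.1 z.1 ≤ ε / 2) → (∃ w ∈ l, dist w.2 z.2 ≤ ε / 2) →
        nr ε l z := by
      rintro z ⟨w, hw, h1⟩ ⟨w', hw', h2⟩
      refine ⟨w, hw, ?_⟩
      rw [Prod.dist_eq]
      refine max_le (by linarith) ?_
      have h3 := hl w hw w' hw'
      rw [Prod.dist_eq] at h3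
      have h4 := (le_max_right _ _).trans h3
      have h5 := dist_triangle w.2 w'.2 z.2
      linarith
    refine Submodule.add_mem _ ?_ ?_
    · refine sup_mono ?_ (RM.comp (r'' := fun (l k : List (X × Y)) => k.length = l.length + 1 ∧
        ∀ z ∈ k, (∃ w ∈ l, dist w.1 z.1 ≤ ε / 2) ∧ (∃ w ∈ l, dist w.2 z.2 ≤ ε / 2))
        (RM.comp (r'' := fun (l : List (X × Y)) q => ln q = l.length + 2 ∧
        (∀ x ∈ q.1, (∃ w ∈ l, dist w.1 x ≤ ε / 2)) ∧ (∀ y ∈ q.2, (∃ w ∈ l, dist w.2 y ≤ ε / 2)))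
          AW_RM hs ?_) hER ?_ l)
      · rintro k ⟨hk1, hk2⟩
        exact ⟨hk1, fun z hz => near z (hk2 z hz).1 (hk2 z hz).2⟩
      · rintro l p q ⟨a1, a2, a3, a4⟩ ⟨b1, b2, b3, b4, b5⟩
        refine ⟨by omega, ?_, ?_⟩
        · intro x hx
          obtain ⟨y, hy, hxy⟩ := b4 x hx
          have := a3 y hy
          obtain ⟨w, hw, rfl⟩ := List.mem_map.1 this
          exact ⟨w, hw, hxy⟩
        · intro x hx
          obtain ⟨y, hy, hxy⟩ := b5 x hx
          have := a4 y hy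
          obtain ⟨w, hw, rfl⟩ := List.mem_map.1 this
          exact ⟨w, hw, hxy⟩
      · rintro l q k ⟨a1, a2, a3⟩ ⟨b1, b2⟩
        exact ⟨by omega, fun z hz => ⟨a2 _ (b2 z hz).1, a3 _ (b2 z hz).2⟩⟩
    · refine sup_mono ?_ (hh2 l)
      rintro k ⟨hk1, hk2⟩
      refine ⟨hk1, fun z hz => ?_⟩
      obtain ⟨⟨w, hw, h1⟩, ⟨w', hw', h2⟩⟩ := hk2 z hz
      refine near z ⟨w, hw, ?_⟩ ⟨w', hw', ?_⟩
      · rw [h1, dist_self]; positivity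
      · rw [h2, dist_self]; positivity
  · intro l hl hlen
    have e1 := hh1 (single l 1)
    rw [dl_single] at e1
    have e2 : DD (s (AW (single l 1))) + s (AW (bd l)) = AW (single l 1) := by
      rw [← dl_single, ← DD_AW]
      refine eq_of_supp (f := DD ∘ₗ s + s ∘ₗ DD) (g := LinearMap.id) ?_ (AW_RM (R := R) l)
      rintro p ⟨h1, h2, h3, h4⟩
      simp only [LinearMap.add_apply, LinearMap.comp_apply, LinearMap.id_apply]
      refine hs' p h2 ?_ ?_ (by omega)
      · intro x hx y hy
        obtain ⟨w, hw, rfl⟩ := List.mem_map.1 (h3 x hx)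
        obtain ⟨w', hw', rfl⟩ := List.mem_map.1 (h3 y hy)
        have := hl w hw w' hw'
        rw [Prod.dist_eq] at this
        exact ((le_max_left _ _).trans this).trans (min_le_left _ _)
      · intro x hx y hy
        obtain ⟨w, hw, rfl⟩ := List.mem_map.1 (h4 x hx)
        obtain ⟨w', hw', rfl⟩ := List.mem_map.1 (h4 y hy)
        have := hl w hw w' hw'
        rw [Prod.dist_eq] at this
        exact ((le_max_right _ _).trans this).trans (min_le_left _ _)
    have e3 : ag (s (AW (single l 1))) = 0 := by
      refine ag_zero (n := l.length + 2) (by omega) ?_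
      refine RM.app hs ?_ (AW_RM (R := R) l)
      rintro p ⟨h1, h2, h3, h4⟩ q ⟨h5, -⟩
      simp only [mem_ofPred_eq]; omega
    have hl0 : l ≠ [] := by rintro rfl; simp at hlen
    simp only [LinearMap.add_apply, LinearMap.comp_apply, map_add, hEd, e3, zero_smul, add_zero]
    rw [add_add_add_comm, e1, ← map_add, e2]
    simp [hF, hl0]

end hd2
end TD

open Filter Set
open scoped ENNReal
set_option linter.unusedSectionVars false
set_option linter.unusedVariables false

namespace TD
open Finsupp

section
variable {R : Type*} [CommRing R] {X Y : Type*}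

noncomputable def kk (x : X) (y : Y) : Ch2 R X Y →ₗ[R] Ch2 R X Y :=
  tmap (cns x) LinearMap.id + tm (single [x] 1) ∘ₗ cns y ∘ₗ sl

theorem sl_ne {u : Ch2 R X Y} (hu : u ∈ supported R R {p | ne2 p}) :
    sl u ∈ supported R R {k : List Y | k ≠ []} := by
  refine mem_of_supp ?_ hu
  rintro ⟨a, b⟩ ⟨ha, hb⟩
  rw [sg2, sl_tm]
  exact Submodule.smul_mem _ _ (sg_mem hb)

theorem sl_DD (u : Ch2 R X Y) : sl (DD u) = dt (sl u) := by
  have : sl ∘ₗ DD = dt ∘ₗ (sl : Ch2 R X Y →ₗ[R] Ch R Y) := by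
    apply lext
    rintro ⟨a, b⟩
    simp only [LinearMap.comp_apply]
    rw [sg2, DD_tm, map_add, sl_tm, sl_tm, sl_tm, ep_dt, ep_io, map_smul]
    simp
  exact LinearMap.congr_fun this u

theorem ep_sl (u : Ch2 R X Y) : ep (sl u) = ag u := by
  have : ep ∘ₗ sl = (ag : Ch2 R X Y →ₗ[R] R) := by
    apply lext
    rintro ⟨a, b⟩
    simp only [LinearMap.comp_apply]
    rw [sg2, sl_tm, ag_tm, map_smul, smul_eq_mul]
  exact LinearMap.congr_fun this u

theorem DD_kk (x : X) (y : Y) {u : Ch2 R X Y} (hu : u ∈ supported R R {p | ne2 p}) :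
    DD (kk x y u) = u - kk x y (DD u) - ag u • single ([x], [y]) 1 := by
  simp only [kk, LinearMap.add_apply, LinearMap.comp_apply, map_add]
  rw [DD_cns x hu, DD_tm, dt_le [x] (by simp), io_single, dt_cns y (sl_ne hu), sl_DD, ep_sl, sg2]
  simp
  abel

theorem exists_h2 (EZ : Ch2 R X Y →ₗ[R] Ch R (X × Y))
    (hEd : ∀ c, dl (EZ c) = EZ (DD c) + ag c • single [] 1)
    (hE1 : ∀ x y, EZ (single ([x], [y]) 1) = single [(x, y)] 1)
    (hER : RM (fun p k => k.length + 1 = ln p ∧ ∀ z ∈ k, z.1 ∈ p.1 ∧ z.2 ∈ p.2) EZ) :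
    ∃ h : Ch2 R X Y →ₗ[R] Ch2 R X Y, (∀ p, ne2 p →
      DD (h (single p 1)) + h (DD (single p 1)) = single p 1 - AW (EZ (single p 1))) ∧
      RM (fun p q => ln q = ln p + 1 ∧ ne2 q ∧ (∀ x ∈ q.1, x ∈ p.1) ∧ (∀ x ∈ q.2, x ∈ p.2)) h := by
  classical
  obtain ⟨h, hh⟩ := exists_rec (R := R) (M := Ch2 R X Y) ln (fun p : List X × List Y =>
    DD (single p 1)) DD_lt (fun p u => match p with
      | (x :: a, y :: b) => kk x y (single (x :: a, y :: b) 1 -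
          AW (EZ (single (x :: a, y :: b) 1)) - u)
      | _ => 0)
  have h0 : ∀ p, ¬ ne2 p → h (single p 1) = 0 := by
    rintro ⟨a, b⟩ hp
    rw [hh]
    cases a with
    | nil => simp
    | cons x a =>
      cases b with
      | nil => simp
      | cons y b => simp [ne2] at hp
  have hAE : RM (fun p q => ln q = ln p ∧ ne2 q ∧ (∀ x ∈ q.1, x ∈ p.1) ∧ (∀ x ∈ q.2, x ∈ p.2))
      (AW ∘ₗ EZ) := by
    refine RM.comp hER AW_RM ?_
    rintro p k q ⟨a1, a2⟩ ⟨b1, b2, b3, b4⟩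
    refine ⟨by omega, b2, fun x hx => ?_, fun x hx => ?_⟩
    · obtain ⟨z, hz, rfl⟩ := List.mem_map.1 (b3 x hx)
      exact (a2 z hz).1
    · obtain ⟨z, hz, rfl⟩ := List.mem_map.1 (b4 x hx)
      exact (a2 z hz).2
  have hR : RM (fun p q => ln q = ln p + 1 ∧ ne2 q ∧ (∀ x ∈ q.1, x ∈ p.1) ∧
      (∀ x ∈ q.2, x ∈ p.2)) h := by
    refine gen_mem ln (fun p : List X × List Y => DD (single p (1 : R))) DD_lt (N := fun p =>
      supported R R {q | ln q = ln p + 1 ∧ ne2 q ∧ (∀ x ∈ q.1, x ∈ p.1) ∧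
      (∀ x ∈ q.2, x ∈ p.2)}) ?_
    rintro ⟨a, b⟩ ih
    have hih : h (DD (single (a, b) 1)) ∈ supported R R
        {q | ln q = ln (a, b) ∧ ne2 q ∧ (∀ x ∈ q.1, x ∈ a) ∧ (∀ x ∈ q.2, x ∈ b)} := by
      refine mem_of_supp (S := ((DD (single (a, b) (1 : R))).support : Set _)) ?_
        ((mem_supported R _).2 (subset_refl _))
      intro q hq
      refine sup_mono ?_ (ih q hq)
      rintro k ⟨hk1, hk2, hk3, hk4⟩
      have hF := (mem_supported R _).1 (DD_RM (R := R) (a, b)) hq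
      obtain ⟨h1, h2, h3, -⟩ := hF
      exact ⟨by omega, hk2, fun z hz => h2.subset (hk3 z hz), fun z hz => h3.subset (hk4 z hz)⟩
    cases a with
    | nil => rw [h0 _ (by simp [ne2])]; exact Submodule.zero_mem _
    | cons x a =>
      cases b with
      | nil => rw [h0 _ (by simp [ne2])]; exact Submodule.zero_mem _
      | cons y b =>
        rw [hh]
        simp only []
        have hsg : (single (x :: a, y :: b) (1 : R) : Ch2 R X Y) ∈ supported R R
            {q | ln q = ln (x :: a, y :: b) ∧ ne2 q ∧
              (∀ z ∈ q.1, z ∈ x :: a) ∧ (∀ z ∈ q.2, z ∈ y :: b)} :=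
          sg_mem ⟨rfl, ⟨by simp, by simp⟩, fun _ h => h, fun _ h => h⟩
        refine mem_of_supp (f := kk x y) (S := {q | ln q = ln (x :: a, y :: b) ∧ ne2 q ∧
          (∀ z ∈ q.1, z ∈ x :: a) ∧ (∀ z ∈ q.2, z ∈ y :: b)}) ?_ (Submodule.sub_mem _
          (Submodule.sub_mem _ hsg (hAE _)) hih)
        rintro ⟨a', b'⟩ ⟨c1, c2, c3, c4⟩
        simp only [kk, LinearMap.add_apply, LinearMap.comp_apply]
        refine Submodule.add_mem _ ?_ ?_
        · rw [tmap_single]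
          simp only [cns_single, LinearMap.id_apply, tm_single, one_mul]
          refine sg_mem ⟨?_, ⟨by simp, c2.2⟩, ?_, c4⟩
          · simp only [ln, List.length_cons] at c1 ⊢; omega
          · intro z hz
            rcases List.mem_cons.1 hz with rfl | hz
            · simp
            · exact c3 z hz
        · rw [sg2, sl_tm, map_smul, map_smul, ep_single]
          split_ifs with hl
          · refine Submodule.smul_mem _ _ ?_
            rw [cns_single, tm_single, one_mul]
            refine sg_mem ⟨?_, ⟨by simp, by simp⟩, by simp, ?_⟩
            · simp only [ln, List.length_cons] at c1 hl ⊢; simp; omega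
            · intro z hz
              rcases List.mem_cons.1 hz with rfl | hz
              · simp
              · exact c4 z hz
          · rw [zero_smul]; exact Submodule.zero_mem _
  refine ⟨h, ?_, hR⟩
  have : ∀ p, ne2 p → (DD ∘ₗ h + h ∘ₗ DD : Ch2 R X Y →ₗ[R] Ch2 R X Y) (single p 1) =
      (LinearMap.id - AW ∘ₗ EZ : Ch2 R X Y →ₗ[R] Ch2 R X Y) (single p 1) := by
    refine gen_ind (R := R) ln ne2 (fun p : List X × List Y => DD (single p 1)) ?_ ?_
    · intro p hp
      refine sup_mono ?_ (DD_RM p)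
      rintro q ⟨h1, h2, h3, h4, h5⟩
      exact ⟨⟨fun h => hp.1 (h4.2 h), fun h => hp.2 (h5.2 h)⟩, by omega⟩
    · rintro ⟨a, b⟩ hne hp
      obtain ⟨h1, h2⟩ := id hne
      cases a with
      | nil => simp at h1
      | cons x a =>
        cases b with
        | nil => simp at h2
        | cons y b =>
          set p : List X × List Y := (x :: a, y :: b) with hpdef
          simp only [LinearMap.comp_apply, LinearMap.add_apply, DD_DD, map_zero, add_zero,
            LinearMap.sub_apply, LinearMap.id_apply] at hp ⊢
          have hhp : h (single p 1) = kk x y (single p 1 - AW (EZ (single p 1)) -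
            h (DD (single p 1))) := by rw [hh]
          set w := single p 1 - AW (EZ (single p 1)) - h (DD (single p 1)) with hw
          have hwn : w ∈ supported R R {q | ne2 q} := by
            refine Submodule.sub_mem _ (Submodule.sub_mem _ (sg_mem hne) (AW_ne _)) ?_
            exact RM.app hR (S := univ) (fun _ _ q hq => hq.2.1) (by simp)
          have hDw : DD w = 0 := by
            rw [hw, map_sub, map_sub, hp, DD_AW, hEd]
            have hA0 : AW (single [] (1 : R) : Ch R (X × Y)) = 0 := by rw [AW_single]; simp [AW0]
            rw [map_add, map_smul, hA0]; simp
          have hag : ag w • (single ([x], [y]) 1 : Ch2 R X Y) = 0 := by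
            by_cases hl : ln p = 2
            · have ha : a = [] := by
                rw [← List.length_eq_zero_iff]; simp only [hpdef, ln, List.length_cons] at hl; omega
              have hb : b = [] := by
                rw [← List.length_eq_zero_iff]; simp only [hpdef, ln, List.length_cons] at hl; omega
              subst ha; subst hb
              have hD : DD (single p (1 : R)) = 0 := by
                rw [hpdef]; simp [DD, dt_le]
              have : w = 0 := by
                rw [hw, hD, hpdef, hE1, AW_single]
                simp [AW0]
              rw [this]; simp
            · rw [ag_zero (n := ln p) hl, zero_smul]
              refine Submodule.sub_mem _ (Submodule.sub_mem _ (sg_mem rfl) ?_) ?_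
              · exact sup_mono (fun q hq => hq.1) (hAE p)
              · refine RM.app hR ?_ (DD_RM p)
                rintro q hq q' hq'
                have h1 := hq.1
                have h2 := hq'.1
                simp only [mem_ofPred_eq]; omega
          rw [hhp, DD_kk x y hwn, hDw, hag]
          simp [hw]
  intro p hp
  simpa using this p hp

end

section
variable {R : Type*} [CommRing R] {X Y : Type*} [MetricSpace X] [MetricSpace Y]

theorem HD.hd2 {e : ℕ} (h : HD R (X × Y) e) : HD2 R X Y e := by
  intro ε hε
  obtain ⟨δ, hδ, s, hs, hs'⟩ := h ε hε
  obtain ⟨EZ, hEd, hE1, hER⟩ := exists_EZ (R := R) (X := X) (Y := Y)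
  obtain ⟨h2, hh, hhR⟩ := exists_h2 EZ hEd hE1 hER
  refine ⟨δ, hδ, AW ∘ₗ s ∘ₗ EZ + h2, ?_, ?_⟩
  · refine RM.add ?_ ?_
    · refine RM.comp (r := fun (p : List X × List Y) (k : List (X × Y)) => k.length = ln p ∧
        ∀ z ∈ k, nr ε p.1 z.1 ∧ nr ε p.2 z.2) (RM.comp hER hs ?_) AW_RM ?_
      · rintro p k k' ⟨a1, a2⟩ ⟨b1, b2⟩
        refine ⟨by omega, fun z hz => ?_⟩
        obtain ⟨w, hw, hwz⟩ := b2 z hz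
        rw [Prod.dist_eq] at hwz
        exact ⟨⟨w.1, (a2 w hw).1, (le_max_left _ _).trans hwz⟩,
          ⟨w.2, (a2 w hw).2, (le_max_right _ _).trans hwz⟩⟩
      · rintro p k q ⟨a1, a2⟩ ⟨b1, b2, b3, b4⟩
        refine ⟨by omega, fun _ => b2.1, fun _ => b2.2, fun x hx => ?_, fun x hx => ?_⟩
        · obtain ⟨z, hz, rfl⟩ := List.mem_map.1 (b3 x hx)
          exact (a2 z hz).1
        · obtain ⟨z, hz, rfl⟩ := List.mem_map.1 (b4 x hx)
          exact (a2 z hz).2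
    · refine RM.mono hhR ?_
      rintro p q ⟨b1, b2, b3, b4⟩
      exact ⟨b1, fun _ => b2.1, fun _ => b2.2, fun x hx => nr_self hε.le (b3 x hx),
        fun x hx => nr_self hε.le (b4 x hx)⟩
  · intro p hp hs1 hs2 hlen
    have e1 := hh p hp
    have e2 : dl (s (EZ (single p 1))) + s (dl (EZ (single p 1))) = EZ (single p 1) := by
      refine eq_of_supp (f := dl ∘ₗ s + s ∘ₗ dl) (g := LinearMap.id) ?_ (hER p)
      rintro k ⟨a1, a2⟩
      simp only [LinearMap.add_apply, LinearMap.comp_apply, LinearMap.id_apply, dl_single]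
      refine hs' k ?_ (by omega)
      intro z hz w hw
      rw [Prod.dist_eq]
      exact max_le (hs1 _ (a2 z hz).1 _ (a2 w hw).1) (hs2 _ (a2 z hz).2 _ (a2 w hw).2)
    have e3 : ag (single p (1 : R)) = 0 := ag_zero (n := ln p) (by omega) (sg_mem rfl)
    rw [hEd, e3, zero_smul, add_zero] at e2
    simp only [LinearMap.add_apply, LinearMap.comp_apply, map_add, DD_AW]
    rw [add_add_add_comm, e1, ← map_add, e2]
    abel

theorem dt_aux {Z : Type*} [MetricSpace Z] {ε : ℝ} (s : Ch R Z →ₗ[R] Ch R Z) (hs : PM (nr ε) 1 s)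
    (l : List Z) (hl : l ≠ []) : dt (s (single l 1)) + s (dt (single l 1)) =
      dl (s (single l 1)) + s (bd l) := by
  have h0 : s (single [] 1) = 0 := by
    have h1 := hs []
    have : ∀ k ∈ (s (single [] 1)).support, False := by
      intro k hk
      obtain ⟨h2, h3⟩ := (mem_supported R _).1 h1 hk
      cases k with
      | nil => simp at h2
      | cons x k =>
        obtain ⟨y, hy, _⟩ := h3 x (by simp)
        simp at hy
    rw [← Finsupp.support_eq_empty]
    exact Finset.eq_empty_of_forall_notMem this
  have hl1 := List.length_pos_iff.2 hl
  congr 1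
  · refine eq_of_supp ?_ (hs l)
    rintro k ⟨hk1, -⟩
    rw [dt_gt k (by omega), dl_single]
  · by_cases h1 : l.length = 1
    · obtain ⟨x, rfl⟩ := List.length_eq_one_iff.1 h1
      simp [dt_le, bd_cons, h0]
    · rw [dt_gt l (by omega)]

theorem s_io {Z : Type*} [MetricSpace Z] {ε : ℝ} (s : Ch R Z →ₗ[R] Ch R Z) (hs : PM (nr ε) 1 s) :
    io ∘ₗ s = - (s ∘ₗ io : Ch R Z →ₗ[R] Ch R Z) := by
  apply lext
  intro l
  rw [LinearMap.comp_apply, LinearMap.neg_apply, LinearMap.comp_apply, io_single, map_smul]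
  have := eq_of_supp (f := io) (g := (-1 : R) ^ (l.length) • LinearMap.id)
    (fun k hk => by rw [io_single]; rw [hk.1]; simp [pow_succ]) (hs l)
  rw [this]
  simp [pow_succ]

theorem dt_PM {Z : Type*} [MetricSpace Z] {ε : ℝ} (s : Ch R Z →ₗ[R] Ch R Z) (hs : PM (nr ε) 1 s) (hε : 0 < ε) :
    PM (nr ε) 0 (LinearMap.id - dt ∘ₗ s - s ∘ₗ dt) := by
  intro l
  simp only [LinearMap.sub_apply, LinearMap.comp_apply, LinearMap.id_apply]
  refine Submodule.sub_mem _ (Submodule.sub_mem _ ?_ ?_) ?_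
  · exact sg_mem ⟨by simp, fun y hy => nr_self hε.le hy⟩
  · refine RM.app (r := fun l k => Fc l k ∧ k ≠ []) dt_mem ?_ (hs l)
    rintro k ⟨hk1, hk2⟩ m ⟨⟨hm1, hm2⟩, -⟩
    exact ⟨by omega, fun y hy => hk2 y (hm2.subset hy)⟩
  · refine RM.app hs ?_ (dt_mem l)
    rintro k ⟨⟨hk1, hk2⟩, -⟩ m ⟨hm1, hm2⟩
    exact ⟨by omega, fun y hy => nr_sub _ _ y hk2 (hm2 y hy)⟩

theorem dt_fz {Z : Type*} [MetricSpace Z] {ε : ℝ} (s : Ch R Z →ₗ[R] Ch R Z) (hs : PM (nr ε) 1 s)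
    (l : List Z) (hl : l ≠ []) (h : dl (s (single l 1)) + s (bd l) = single l 1) :
    (LinearMap.id - dt ∘ₗ s - s ∘ₗ dt : Ch R Z →ₗ[R] Ch R Z) (single l 1) = 0 := by
  have := dt_aux s hs l hl
  rw [h] at this
  simp only [LinearMap.sub_apply, LinearMap.comp_apply, LinearMap.id_apply]
  rw [sub_sub, this, sub_self]

theorem HD.prod_upper {a b : ℕ} (hX : HD R X a) (hY : HD R Y b) : HD R (X × Y) (a + b) := by
  apply HD2.hd
  intro ε hε
  obtain ⟨δ1, hδ1, s1, hs1, hs1'⟩ := hX ε hε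
  obtain ⟨δ2, hδ2, s2, hs2, hs2'⟩ := hY ε hε
  set f : Ch R X →ₗ[R] Ch R X := LinearMap.id - dt ∘ₗ s1 - s1 ∘ₗ dt with hf
  set g : Ch R Y →ₗ[R] Ch R Y := LinearMap.id - dt ∘ₗ s2 - s2 ∘ₗ dt with hg
  have hfP := dt_PM s1 hs1 hε
  rw [← hf] at hfP
  have hfdt : dt ∘ₗ f = f ∘ₗ dt := by
    apply LinearMap.ext; intro c
    simp [hf, dt_dt]
  have s1io := s_io s1 hs1
  have dtio : (dt ∘ₗ io : Ch R X →ₗ[R] Ch R X) = -(io ∘ₗ dt : Ch R X →ₗ[R] Ch R X) := by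
    apply LinearMap.ext; intro c; simp [dt_io]
  have ioio : (io ∘ₗ io : Ch R X →ₗ[R] Ch R X) = LinearMap.id := by
    apply LinearMap.ext; intro c; simp [io_io]
  have fio : io ∘ₗ f = f ∘ₗ io := by
    apply LinearMap.ext; intro c
    have h1 : ∀ c, io (s1 c) = - s1 (io c) := fun c => LinearMap.congr_fun s1io c
    have h2 : ∀ c, io (dt c) = - dt (io c : Ch R X) := fun c => by rw [dt_io, neg_neg]
    simp [hf, h1, h2]
  have key : ∀ u : Ch2 R X Y, DD ((tmap s1 LinearMap.id + tmap (f ∘ₗ io) s2 : Ch2 R X Y →ₗ[R] Ch2 R X Y) u) +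
      (tmap s1 LinearMap.id + tmap (f ∘ₗ io) s2 : Ch2 R X Y →ₗ[R] Ch2 R X Y) (DD u) = u - tmap f g u := by
    have : DD ∘ₗ (tmap s1 LinearMap.id + tmap (f ∘ₗ io) s2 : Ch2 R X Y →ₗ[R] Ch2 R X Y) +
      (tmap s1 LinearMap.id + tmap (f ∘ₗ io) s2 : Ch2 R X Y →ₗ[R] Ch2 R X Y) ∘ₗ DD = LinearMap.id - tmap f g := by
      apply lext
      rintro ⟨a, b⟩
      simp only [LinearMap.comp_apply, LinearMap.add_apply, LinearMap.sub_apply,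
        LinearMap.id_apply]
      rw [sg2]
      simp only [tmap_tm, map_add, DD_tm, LinearMap.comp_apply, LinearMap.id_apply]
      have h1 : ∀ c, io (s1 c) = - s1 (io c) := fun c => LinearMap.congr_fun s1io c
      have h2 : ∀ c, dt (f (io c)) = - f (io (dt c)) := fun c => by
        have := LinearMap.congr_fun hfdt (io c)
        simp only [LinearMap.comp_apply] at this
        rw [this, dt_io, map_neg]
      have h3 : ∀ c, io (f (io c)) = f c := fun c => by
        have := LinearMap.congr_fun fio (io c)
        simp only [LinearMap.comp_apply] at this
        rw [this, io_io]
      rw [h1, h2, h3, io_io]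
      have hgs : dt (s2 (single b 1)) = single b 1 - g (single b 1) - s2 (dt (single b 1)) := by
        simp only [hg, LinearMap.sub_apply, LinearMap.comp_apply, LinearMap.id_apply]; abel
      have hfs : f (single a 1) = single a 1 - dt (s1 (single a 1)) - s1 (dt (single a 1)) := by
        simp only [hf, LinearMap.sub_apply, LinearMap.comp_apply, LinearMap.id_apply]
      rw [hgs]
      simp only [map_neg, LinearMap.neg_apply, map_sub]
      rw [hfs]
      simp only [map_sub, LinearMap.sub_apply]
      abel
    exact fun u => LinearMap.congr_fun this u
  refine ⟨min δ1 δ2, by positivity, tmap s1 LinearMap.id + tmap (f ∘ₗ io) s2, ?_, ?_⟩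
  · refine RM.add ?_ ?_
    · refine tmap_RM (r' := fun l k => k = l) hs1 (RM.id fun _ => rfl) ?_
      rintro ⟨a, b⟩ ⟨a', b'⟩ ⟨h1, h2⟩ rfl
      refine ⟨by simp only [ln] at *; omega, fun _ => ?_, fun h => h, h2,
        fun y hy => nr_self hε.le hy⟩
      rintro rfl
      simp at h1
    · have hfio : PM (nr ε) 0 (f ∘ₗ io) := by
        intro l
        rw [LinearMap.comp_apply, io_single, map_smul]
        exact Submodule.smul_mem _ _ (hfP l)
      refine tmap_RM hfio hs2 ?_
      rintro ⟨a, b⟩ ⟨a', b'⟩ ⟨h1, h2⟩ ⟨h3, h4⟩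
      refine ⟨by simp only [ln] at *; omega, fun h => ?_, fun _ => ?_, h2, h4⟩
      · rintro rfl
        simp at h1
        exact h (List.length_eq_zero_iff.1 h1.symm)
      · rintro rfl
        simp at h3
  · rintro ⟨l, k⟩ ⟨hl, hk⟩ hs3 hs4 hlen
    rw [key, sg2, tmap_tm]
    simp only [ln] at hlen
    by_cases h1 : a + 2 ≤ l.length
    · rw [dt_fz s1 hs1 l hl (hs1' l (hs3.mono (min_le_left _ _) (List.Subset.refl _)) h1)]
      simp
    · rw [dt_fz s2 hs2 k hk (hs2' k (hs4.mono (min_le_right _ _) (List.Subset.refl _)) (by omega))]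
      simp

end
end TD

open Filter Set
open scoped ENNReal
set_option linter.unusedSectionVars false
set_option linter.unusedVariables false

namespace TD
open Finsupp

section
variable {R : Type*} [CommRing R] {X Y : Type*} [MetricSpace X] [MetricSpace Y]

theorem supp_inter {C : Type*} {S T : Set C} {u : C →₀ R} (h1 : u ∈ supported R R S)
    (h2 : u ∈ supported R R T) : u ∈ supported R R (S ∩ T) := by
  rw [mem_supported] at *
  exact subset_inter h1 h2

/-- evaluation lemma on products -/
theorem HD2.eval {e : ℕ} (h : HD2 R X Y e) (T : Ch2 R X Y →ₗ[R] R) {ε η : ℝ} (hε : 0 < ε)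
    (hη : 0 < η)
    (hT : ∀ p, ne2 p → small ε p.1 → small ε p.2 → ln p = e + 4 → T (DD (single p 1)) = 0) :
    ∃ δ > 0, ∃ φ : Ch2 R X Y →ₗ[R] R,
      (∀ p, ne2 p → small δ p.1 → small δ p.2 → ln p = e + 3 →
        T (single p 1) = φ (DD (single p 1))) ∧
      ∀ q, small δ q.1 → small δ q.2 → (∀ p, r2 η 1 q p → small ε p.1 → small ε p.2 →
        T (single p 1) = 0) → φ (single q 1) = 0 := by
  obtain ⟨δ, hδ, s, hs, hs'⟩ := h (min (ε / 4) η) (by positivity)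
  have m1 := min_le_left (ε / 4) η
  have m2 := min_le_right (ε / 4) η
  have m3 := min_le_right δ (ε / 2)
  refine ⟨min δ (ε / 2), by positivity, T ∘ₗ s, ?_, ?_⟩
  · intro p hp h1 h2 h3
    have e1 := hs' p hp (h1.mono (min_le_left _ _) (List.Subset.refl _))
      (h2.mono (min_le_left _ _) (List.Subset.refl _)) (by omega)
    have : T (DD (s (single p 1))) = 0 := by
      refine zero_of_supp (f := T ∘ₗ DD) ?_ (hs p)
      rintro q ⟨q1, q2, q3, q4, q5⟩
      refine hT q ⟨q2 hp.1, q3 hp.2⟩ ((h1.near q4).mono ?_ (List.Subset.refl _))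
        ((h2.near q5).mono ?_ (List.Subset.refl _)) (by omega) <;> linarith
    conv_lhs => rw [← e1, map_add, this, zero_add]
    rfl
  · intro q h1 h2 hq
    refine zero_of_supp (f := T) ?_ (hs q)
    rintro p ⟨q1, q2, q3, q4, q5⟩
    refine hq p ⟨q1, q2, q3, fun x hx => (q4 x hx).mono m2 (List.Subset.refl _),
        fun x hx => (q5 x hx).mono m2 (List.Subset.refl _)⟩
        ((h1.near q4).mono ?_ (List.Subset.refl _))
        ((h2.near q5).mono ?_ (List.Subset.refl _)) <;> linarith

open Classical in
noncomputable def tz (z : Ch R X →ₗ[R] R) (z' : Ch R Y →ₗ[R] R) (i j : ℕ) : Ch2 R X Y →ₗ[R] R :=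
  linearCombination R fun p => if p.1.length = i ∧ p.2.length = j then
    z (single p.1 1) * z' (single p.2 1) else 0

theorem tz_eq (z : Ch R X →ₗ[R] R) (z' : Ch R Y →ₗ[R] R) (i j : ℕ) {u : Ch R X} {v : Ch R Y}
    (hu : u ∈ supported R R {l | l.length = i}) (hv : v ∈ supported R R {l | l.length = j}) :
    tz z z' i j (tm u v) = z u * z' v := by
  refine eq_of_supp (f := (tz z z' i j) ∘ₗ (tm.flip v)) (g := (z' v) • z) ?_ hu |>.trans ?_
  · intro l hl
    simp only [LinearMap.comp_apply, LinearMap.flip_apply, LinearMap.smul_apply, smul_eq_mul]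
    refine eq_of_supp (f := (tz z z' i j) ∘ₗ (tm (single l 1))) (g := (z (single l 1)) • z') ?_ hv
      |>.trans ?_
    · intro k hk
      have hl : l.length = i := hl
      have hk : k.length = j := hk
      simp [tz, hl, hk]
    · simp [mul_comm]
  · simp [mul_comm]

theorem tz_ne (z : Ch R X →ₗ[R] R) (z' : Ch R Y →ₗ[R] R) (i j : ℕ) {i' j' : ℕ}
    {u : Ch R X} {v : Ch R Y}
    (hu : u ∈ supported R R {l | l.length = i'}) (hv : v ∈ supported R R {l | l.length = j'})
    (hne : ¬ (i' = i ∧ j' = j)) :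
    tz z z' i j (tm u v) = 0 := by
  refine zero_of_supp (f := tz z z' i j) (S := {p | p.1.length = i' ∧ p.2.length = j'}) ?_
    (tm_mem (fun c hc d hd => show c.length = i' ∧ d.length = j' from ⟨hc, hd⟩) hu hv)
  rintro p ⟨rfl, rfl⟩
  rw [tz, linearCombination_single, if_neg hne, smul_zero]

theorem tz_single (z : Ch R X →ₗ[R] R) (z' : Ch R Y →ₗ[R] R) (i j : ℕ) (p : List X × List Y)
    (h : p.1.length = i → p.2.length = j → z (single p.1 1) = 0 ∨ z' (single p.2 1) = 0) :
    tz z z' i j (single p 1) = 0 := by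
  rw [tz, linearCombination_single]
  split_ifs with h1
  · rcases h h1.1 h1.2 with h | h <;> simp [h]
  · simp

theorem dt_eq_bd {l : List X} (h : 2 ≤ l.length) : dt (single l (1 : R)) = bd l := dt_gt l h

theorem bd_len (l : List X) {n : ℕ} (h : l.length = n + 1) :
    (bd l : Ch R X) ∈ supported R R {k | k.length = n} :=
  sup_mono (fun k hk => by have := hk.1; simp only [mem_ofPred_eq]; omega) (bd_mem l)

theorem dt_len (l : List X) {n : ℕ} (h : l.length = n + 1) :
    (dt (single l 1) : Ch R X) ∈ supported R R {k | k.length = n} :=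
  sup_mono (fun k hk => by have := hk.1.1; simp only [mem_ofPred_eq]; omega) (dt_mem l)

theorem small_mem {δ : ℝ} {l k : List X} (h : Fc l k) (hl : small δ l) : small δ k :=
  hl.mono le_rfl h.2.subset

/-- support of the differential of a chain -/
theorem dt_supp {S T : Set (List X)} (h : ∀ l ∈ S, ∀ k, Fc l k → k ≠ [] → k ∈ T) {u : Ch R X}
    (hu : u ∈ supported R R S) : dt u ∈ supported R R T :=
  RM.app (r := fun l k => Fc l k ∧ k ≠ []) dt_mem (fun l hl k hk => h l hl k hk.1 hk.2) hu

theorem io_eq {u : Ch R X} {n : ℕ} (hu : u ∈ supported R R {l | l.length = n}) :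
    io u = (-1 : R) ^ (n + 1) • u := by
  refine eq_of_supp (f := io) (g := (-1 : R) ^ (n + 1) • LinearMap.id) ?_ hu
  intro l hl
  have hl : l.length = n := hl
  rw [io_single, hl]; simp

theorem dt_eq_dl {u : Ch R X} {n : ℕ} (hn : 2 ≤ n) (hu : u ∈ supported R R {l | l.length = n}) :
    dt u = dl u := by
  refine eq_of_supp (f := dt) (g := dl) ?_ hu
  intro l hl
  have hl : l.length = n := hl
  rw [dl_single, dt_gt l (by omega)]

end

section field
variable {F : Type*} [Field F] {X Y : Type*} [MetricSpace X] [MetricSpace Y]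

theorem dual_fac {V U : Type*} [AddCommGroup V] [AddCommGroup U] [Module F V] [Module F U]
    (f : V →ₗ[F] U) (z : V →ₗ[F] F) (W : Submodule F V) (V0 : Submodule F U)
    (h : ∀ w ∈ W, f w ∈ V0 → z w = 0) :
    ∃ g : U →ₗ[F] F, (∀ w ∈ W, z w = g (f w)) ∧ ∀ v ∈ V0, g v = 0 := by
  set f' : W →ₗ[F] (U ⧸ V0) := V0.mkQ ∘ₗ f ∘ₗ W.subtype with hf
  have hz : (z ∘ₗ W.subtype) ∈ (LinearMap.ker f').dualAnnihilator := by
    rw [Submodule.mem_dualAnnihilator]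
    intro w hw
    refine h w w.2 ?_
    have : f' w = 0 := hw
    simpa [hf] using this
  have hz2 : (z ∘ₗ W.subtype) ∈ LinearMap.range f'.dualMap := by
    convert hz using 1
    convert LinearMap.range_dualMap_eq_dualAnnihilator_ker f'
  obtain ⟨g, hg⟩ := hz2
  refine ⟨g ∘ₗ V0.mkQ, fun w hw => ?_, fun v hv => ?_⟩
  · have := LinearMap.congr_fun hg ⟨w, hw⟩
    exact this.symm
  · have : V0.mkQ v = 0 := by
      rw [Submodule.mkQ_apply, Submodule.Quotient.mk_eq_zero]
      exact hv
    rw [LinearMap.comp_apply, this, map_zero]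

theorem exists_dual {A : Set X} {η : ℝ} {j : ℕ} {z : Ch F X →ₗ[F] F} (h : ¬ Dies A η j z)
    {δ : ℝ} (hδ : 0 < δ) : ∃ w ∈ supported F F {l : List X | small δ l ∧ l.length = j + 1},
      dl w ∈ supported F F {l : List X | ∀ x ∈ l, Inn A η x} ∧ z w = 1 := by
  by_contra hcon
  apply h
  obtain ⟨g, h1, h2⟩ := dual_fac dl z (supported F F {l : List X | small δ l ∧ l.length = j + 1})
    (supported F F {l : List X | ∀ x ∈ l, Inn A η x}) (fun w hw hw' => by
      by_contra hne
      refine hcon ⟨(z w)⁻¹ • w, Submodule.smul_mem _ _ hw, ?_, ?_⟩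
      · rw [map_smul]; exact Submodule.smul_mem _ _ hw'
      · rw [map_smul, smul_eq_mul]
        exact inv_mul_cancel₀ hne)
  refine ⟨δ, hδ, g, ?_, ?_⟩
  · intro l hl1 hl2
    rw [h1 _ (sg_mem (show small δ l ∧ _ from ⟨hl1, hl2⟩)), dl_single]
  · intro l _ _ h3
    exact h2 _ (sg_mem h3)

theorem HD.field_lower [CompactSpace X] [CompactSpace Y] {a b : ℕ} (hX : HD F X (a + 1))
    (hX' : ¬ HD F X a) (hY : HD F Y (b + 1)) (hY' : ¬ HD F Y b) : ¬ HD F (X × Y) (a + b + 1) := by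
  intro hXY
  have nX : ¬ PV F X (a + 1) := fun h => hX' (hX.descend h)
  have nY : ¬ PV F Y (b + 1) := fun h => hY' (hY.descend h)
  unfold PV at nX nY
  push Not at nX nY
  obtain ⟨A, η, hη, ε, hε, z, ⟨hz1, hz2⟩, hz3⟩ := nX
  obtain ⟨A', η', hη', ε', hε', z', ⟨hz1', hz2'⟩, hz3'⟩ := nY
  obtain ⟨δ, hδ, φ, h1, h2⟩ := hXY.hd2.eval (tz z z' (a + 2) (b + 2)) (ε := min ε ε')
    (η := min η η') (by positivity) (by positivity) (by
      rintro ⟨l, k⟩ ⟨hl, hk⟩ s1 s2 hln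
      simp only [ln] at hln s1 s2 hl hk
      rw [sg2, DD_tm, io_single, map_add, map_smul, LinearMap.smul_apply, map_smul]
      have sl : (single l 1 : Ch F X) ∈ supported F F {k | k.length = l.length} := sg_mem rfl
      have sk : (single k 1 : Ch F Y) ∈ supported F F {l | l.length = k.length} := sg_mem rfl
      have hl1 := List.length_pos_iff.2 hl
      have hk1 := List.length_pos_iff.2 hk
      have t1 : tz z z' (a + 2) (b + 2) (tm (dt (single l 1)) (single k 1)) = 0 := by
        by_cases hc : l.length = a + 3
        · rw [tz_eq _ _ _ _ (dt_len l hc) (sup_mono (fun m hm => by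
            simp only [mem_ofPred_eq] at *; omega) sk), dt_gt l (by omega), hz1 l (s1.mono
              (min_le_left _ _) (List.Subset.refl _)) (by omega), zero_mul]
        · exact tz_ne _ _ _ _ (dt_len (n := l.length - 1) l (by omega)) sk (by omega)
      have t2 : tz z z' (a + 2) (b + 2) (tm (single l 1) (dt (single k 1))) = 0 := by
        by_cases hc : k.length = b + 3
        · rw [tz_eq _ _ _ _ (sup_mono (fun m hm => by
            simp only [mem_ofPred_eq] at *; omega) sl) (dt_len k hc), dt_gt k (by omega),
            hz1' k (s2.mono
              (min_le_right _ _) (List.Subset.refl _)) (by omega), mul_zero]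
        · exact tz_ne _ _ _ _ sl (dt_len (n := k.length - 1) k (by omega)) (by omega)
      rw [t1, t2]; simp)
  obtain ⟨w, hw1, hw2, hw3⟩ := exists_dual hz3 hδ
  obtain ⟨w', hw1', hw2', hw3'⟩ := exists_dual hz3' hδ
  have e1 : tz z z' (a + 2) (b + 2) (tm w w') = 1 := by
    rw [tz_eq _ _ _ _ (sup_mono (fun l hl => hl.2) hw1) (sup_mono (fun l hl => hl.2) hw1'),
      hw3, hw3', one_mul]
  have e2 : tz z z' (a + 2) (b + 2) (tm w w') = φ (DD (tm w w')) := by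
    refine eq_of_supp (g := φ ∘ₗ DD) (S := {p | ne2 p ∧ small δ p.1 ∧ small δ p.2 ∧ ln p =
      (a + b + 1) + 3}) ?_ (tm_mem ?_ hw1 hw1')
    · rintro p ⟨p1, p2, p3, p4⟩
      exact h1 p p1 p2 p3 p4
    · rintro l ⟨l1, l2⟩ k ⟨k1, k2⟩
      refine ⟨⟨?_, ?_⟩, l1, k1, by simp only [ln]; omega⟩
      · rintro rfl; simp at l2
      · rintro rfl; simp at k2
  have d1 := dt_eq_dl (by omega) (sup_mono (fun l hl => hl.2) hw1)
  have d2 := dt_eq_dl (by omega) (sup_mono (fun l hl => hl.2) hw1')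
  have f1 : dt w ∈ supported F F ({l | small δ l ∧ l.length = a + 1} ∩ {l | ∀ x ∈ l, Inn A η x}) := by
    refine supp_inter (dt_supp ?_ hw1) (by rw [d1]; exact hw2)
    rintro l ⟨l1, l2⟩ k hk -
    exact ⟨small_mem hk l1, by have := hk.1; omega⟩
  have f2 : dt w' ∈ supported F F ({l | small δ l ∧ l.length = b + 1} ∩
      {l | ∀ x ∈ l, Inn A' η' x}) := by
    refine supp_inter (dt_supp ?_ hw1') (by rw [d2]; exact hw2')
    rintro l ⟨l1, l2⟩ k hk -
    exact ⟨small_mem hk l1, by have := hk.1; omega⟩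
  have e3 : φ (DD (tm w w')) = 0 := by
    rw [DD_tm, map_add, io_eq (sup_mono (fun l hl => hl.2) hw1), map_smul, LinearMap.smul_apply,
      map_smul]
    have g1 : φ (tm (dt w) w') = 0 := by
      refine zero_of_supp (f := φ) (S := {p | small δ p.1 ∧ small δ p.2 ∧ ∀ x ∈ p.1, Inn A η x})
        ?_ (tm_mem ?_ f1 hw1')
      · rintro q ⟨q1, q2, q3⟩
        refine h2 q q1 q2 fun p ⟨_, _, _, p4, _⟩ p5 p6 => ?_
        refine tz_single _ _ _ _ _ fun s1 s2 => Or.inl ?_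
        refine hz2 _ (p5.mono (min_le_left _ _) (List.Subset.refl _)) (by omega) fun x hx => ?_
        obtain ⟨y, hy, hxy⟩ := p4 x hx
        exact q3 y hy x (hxy.trans (min_le_left _ _))
      · rintro l ⟨⟨l1, l2⟩, l3⟩ k ⟨k1, k2⟩
        exact ⟨l1, k1, l3⟩
    have g2 : φ (tm w (dt w')) = 0 := by
      refine zero_of_supp (f := φ) (S := {p | small δ p.1 ∧ small δ p.2 ∧ ∀ x ∈ p.2, Inn A' η' x})
        ?_ (tm_mem ?_ hw1 f2)
      · rintro q ⟨q1, q2, q3⟩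
        refine h2 q q1 q2 fun p ⟨_, _, _, _, p4⟩ p5 p6 => ?_
        refine tz_single _ _ _ _ _ fun s1 s2 => Or.inr ?_
        refine hz2' _ (p6.mono (min_le_right _ _) (List.Subset.refl _)) (by omega) fun x hx => ?_
        obtain ⟨y, hy, hxy⟩ := p4 x hx
        exact q3 y hy x (hxy.trans (min_le_right _ _))
      · rintro l ⟨l1, l2⟩ k ⟨⟨k1, k2⟩, k3⟩
        exact ⟨l1, k1, k3⟩
    rw [g1, g2]; simp
  rw [e2, e3] at e1
  exact zero_ne_one e1

end field
end TD

open Filter Set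
open scoped ENNReal
set_option linter.unusedSectionVars false
set_option linter.unusedVariables false

namespace TD
open Finsupp

section
variable {R : Type*} [CommRing R] {X Y : Type*} [MetricSpace X] [MetricSpace Y]

theorem Dies.mono {A A' : Set X} {η η' : ℝ} {j : ℕ} {z : Ch R X →ₗ[R] R}
    (h : ∀ x, Inn A' η' x → Inn A η x) (hz : Dies A η j z) : Dies A' η' j z := by
  obtain ⟨δ, hδ, b, h1, h2⟩ := hz
  exact ⟨δ, hδ, b, h1, fun l a1 a2 a3 => h2 l a1 a2 fun x hx => h x (a3 x hx)⟩

theorem Dies.mono_eta {A : Set X} {η η' : ℝ} {j : ℕ} {z : Ch R X →ₗ[R] R}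
    (h : η ≤ η') (hz : Dies A η j z) : Dies A η' j z :=
  hz.mono fun x hx y hy => hx y (hy.trans h)

theorem Dies.smul {A : Set X} {η : ℝ} {j : ℕ} {z : Ch R X →ₗ[R] R} (r : R)
    (hz : Dies A η j z) : Dies A η j (r • z) := by
  obtain ⟨δ, hδ, b, h1, h2⟩ := hz
  refine ⟨δ, hδ, r • b, fun l a1 a2 => ?_, fun l a1 a2 a3 => ?_⟩
  · rw [LinearMap.smul_apply, h1 l a1 a2, LinearMap.smul_apply]
  · rw [LinearMap.smul_apply, h2 l a1 a2 a3, smul_zero]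

theorem Dies.add {A : Set X} {η : ℝ} {j : ℕ} {z z' : Ch R X →ₗ[R] R}
    (hz : Dies A η j z) (hz' : Dies A η j z') : Dies A η j (z + z') := by
  obtain ⟨δ, hδ, b, h1, h2⟩ := hz
  obtain ⟨δ', hδ', b', h1', h2'⟩ := hz'
  refine ⟨min δ δ', by positivity, b + b', fun l a1 a2 => ?_, fun l a1 a2 a3 => ?_⟩
  · rw [LinearMap.add_apply, LinearMap.add_apply,
      h1 l (a1.mono (min_le_left _ _) (List.Subset.refl _)) a2,
      h1' l (a1.mono (min_le_right _ _) (List.Subset.refl _)) a2]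
  · rw [LinearMap.add_apply,
      h2 l (a1.mono (min_le_left _ _) (List.Subset.refl _)) a2 a3,
      h2' l (a1.mono (min_le_right _ _) (List.Subset.refl _)) a2 a3, add_zero]

theorem Cyc.smul {A : Set X} {ε : ℝ} {j : ℕ} {z : Ch R X →ₗ[R] R} (r : R)
    (hz : Cyc A ε j z) : Cyc A ε j (r • z) := by
  obtain ⟨h1, h2⟩ := hz
  refine ⟨fun l a1 a2 => ?_, fun l a1 a2 a3 => ?_⟩
  · rw [LinearMap.smul_apply, h1 l a1 a2, smul_zero]
  · rw [LinearMap.smul_apply, h2 l a1 a2 a3, smul_zero]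

/-- reduction to a finite net -/
theorem dies_of_net (X : Type*) [MetricSpace X] [CompactSpace X] {ε η η' δ : ℝ} (hε : 0 < ε)
    (hη : η' < η) (hδ : 0 < δ) (hδε : δ ≤ ε) :
    ∃ S : Set X, S.Finite ∧ ∀ (R : Type*) [CommRing R] (A : Set X) (j : ℕ) (z : Ch R X →ₗ[R] R),
      Cyc A ε j z → (∃ φ : Ch R X →ₗ[R] R,
        (∀ l, small δ l → (∀ x ∈ l, x ∈ S) → l.length = j + 1 → z (single l 1) = φ (bd l)) ∧
        (∀ l, small δ l → (∀ x ∈ l, x ∈ S) → l.length = j → (∀ x ∈ l, Inn A η' x) →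
          φ (single l 1) = 0)) → 0 < η' → Dies A η j z := by
  set ε1 := min (δ / 4) (η - η') with hε1
  have e0 : 0 < ε1 := lt_min (by positivity) (by linarith)
  have e1 : ε1 ≤ δ / 4 := min_le_left _ _
  have e2 : ε1 ≤ η - η' := min_le_right _ _
  obtain ⟨ρ, hρ, hρd⟩ := exists_net (X := X) e0
  refine ⟨range ρ, hρ, ?_⟩
  rintro R _ A j z ⟨hz1, hz2⟩ ⟨φ, hφ1, hφ2⟩ hη'
  obtain ⟨s, hs, hsP⟩ := net_homotopy (R := R) e0.le hρd
  have hmap : ∀ l : List X, small (δ / 2) l → small δ (l.map ρ) := by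
    intro l hl
    refine (hl.near (ε := ε1) (k := l.map ρ) ?_).mono (by linarith) (List.Subset.refl _)
    intro y hy
    obtain ⟨x, hx, rfl⟩ := List.mem_map.1 hy
    exact ⟨x, hx, hρd x⟩
  have hin : ∀ l : List X, ∀ x ∈ l.map ρ, x ∈ range ρ := by
    intro l x hx
    obtain ⟨y, hy, rfl⟩ := List.mem_map.1 hx
    exact ⟨y, rfl⟩
  refine ⟨δ / 2, by positivity, φ ∘ₗ mp ρ + z ∘ₗ s, ?_, ?_⟩
  · intro l hl hlen
    have h1 := hs (single l 1)
    rw [dl_single, mp_single] at h1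
    have h2 : z (dl (s (single l 1))) = 0 := by
      refine zero_of_supp (f := z ∘ₗ dl) ?_ (hsP l)
      rintro k ⟨hk1, hk2⟩
      rw [LinearMap.comp_apply, dl_single]
      exact hz1 k ((hl.near hk2).mono (by linarith) (List.Subset.refl _)) (by omega)
    have h3 : (single l 1 : Ch R X) = dl (s (single l 1)) + s (bd l) + single (l.map ρ) 1 := by
      rw [h1]; abel
    rw [h3, map_add, map_add, h2, hφ1 _ (hmap l hl) (hin l) (by simpa using hlen), bd_map]
    simp only [LinearMap.add_apply, LinearMap.comp_apply]
    ring
  · intro l hl hlen hI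
    simp only [LinearMap.add_apply, LinearMap.comp_apply, mp_single]
    rw [hφ2 _ (hmap l hl) (hin l) (by simpa using hlen), zero_add]
    · refine zero_of_supp (f := z) ?_ (hsP l)
      rintro k ⟨hk1, hk2⟩
      refine hz2 k ((hl.near hk2).mono (by linarith) (List.Subset.refl _)) (by omega) ?_
      intro y hy
      obtain ⟨x, hx, hxy⟩ := hk2 y hy
      exact hI x hx y (by linarith)
    · intro y hy w hw
      obtain ⟨x, hx, rfl⟩ := List.mem_map.1 hy
      refine hI x hx w ?_
      have := dist_triangle x (ρ x) w
      have := hρd x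
      linarith

noncomputable def bz {B : Type*} [CommRing B] (φ : R →+* B) (z : Ch R X →ₗ[R] R) : Ch B X →ₗ[B] B :=
  linearCombination B fun l => φ (z (single l 1))

theorem bz_map {B : Type*} [CommRing B] (φ : R →+* B) (z : Ch R X →ₗ[R] R) (u : Ch R X) :
    bz φ z (u.mapRange φ (map_zero φ)) = φ (z u) := by
  induction u using Finsupp.induction_linear with
  | zero => simp
  | add f g hf hg => rw [Finsupp.mapRange_add (hf' := map_add φ), map_add, hf, hg, map_add, map_add]
  | single l r =>
    rw [mapRange_single, bz, linearCombination_single, smul_eq_mul, ← map_mul]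
    congr 1
    rw [← smul_eq_mul, ← map_smul]; simp

theorem bz_bd {B : Type*} [CommRing B] (φ : R →+* B) (z : Ch R X →ₗ[R] R) (l : List X) :
    bz φ z (bd l) = φ (z (bd l)) := by
  rw [← bd_base φ, bz_map]

theorem bz_single {B : Type*} [CommRing B] (φ : R →+* B) (z : Ch R X →ₗ[R] R) (l : List X) :
    bz φ z (single l 1) = φ (z (single l 1)) := by
  rw [bz, linearCombination_single, one_smul]

theorem Cyc.base {B : Type*} [CommRing B] (φ : R →+* B) {A : Set X} {ε : ℝ} {j : ℕ}
    {z : Ch R X →ₗ[R] R} (hz : Cyc A ε j z) : Cyc A ε j (bz φ z) := by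
  obtain ⟨h1, h2⟩ := hz
  refine ⟨fun l a1 a2 => ?_, fun l a1 a2 a3 => ?_⟩
  · rw [bz_bd, h1 l a1 a2, map_zero]
  · rw [bz_single, h2 l a1 a2 a3, map_zero]

theorem exists_mul_dies {L : Type*} [CommRing L] [Algebra R L] (M : Submonoid R)
    [IsLocalization M L] (hM : M ≤ nonZeroDivisors R) [CompactSpace X] {A : Set X} {η ε : ℝ}
    (hη : 0 < η) (hε : 0 < ε) {j : ℕ} {z : Ch R X →ₗ[R] R} (hz : Cyc A ε j z)
    (hL : PV L X j) : ∃ N ∈ M, Dies A η j (N • z) := by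
  classical
  obtain ⟨δ1, hδ1, b, hb1, hb2⟩ := hL A (η / 2) (by positivity) ε hε _ (hz.base (algebraMap R L))
  obtain ⟨S, hS, hnet⟩ := dies_of_net X (η := η) (η' := η / 2) (δ := min δ1 ε) hε (by linarith)
    (by positivity) (min_le_right _ _)
  have hfin := finite_lists hS j
  have := hfin.to_subtype
  obtain ⟨N, hN⟩ := IsLocalization.exist_integer_multiples_of_finite M
    (fun l : {l : List X | l.length = j ∧ ∀ x ∈ l, x ∈ S} => b (single l.1 1))
  choose g hg using hN
  have hinj := IsLocalization.injective L hM
  refine ⟨N, N.2, hnet R A j _ (hz.smul _) ⟨linearCombination R fun l =>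
    if h : l.length = j ∧ ∀ x ∈ l, x ∈ S then g ⟨l, h⟩ else 0, ?_, ?_⟩ (by positivity)⟩
  · intro l h1 h2 h3
    apply hinj
    have e1 := hb1 l (h1.mono (min_le_left _ _) (List.Subset.refl _)) h3
    rw [bz_single] at e1
    rw [LinearMap.smul_apply, smul_eq_mul, map_mul, e1, ← bz_bd]
    have : (algebraMap R L N) * b (bd l) = ((algebraMap R L N) • b) (bd l) := rfl
    rw [this]
    refine eq_of_supp ?_ (bd_mem l)
    rintro k ⟨k1, k2⟩
    have hk : k.length = j ∧ ∀ x ∈ k, x ∈ S := ⟨by omega, fun x hx => h2 x (k2.subset hx)⟩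
    rw [bz_single, linearCombination_single, dif_pos hk, one_smul, hg, LinearMap.smul_apply,
      smul_eq_mul, Algebra.smul_def]
  · intro l h1 h2 h3 h4
    apply hinj
    rw [linearCombination_single, dif_pos ⟨h3, h2⟩, one_smul, hg,
      hb2 l (h1.mono (min_le_left _ _) (List.Subset.refl _)) h3 h4]
    simp

end

section int
variable {X : Type*} [MetricSpace X]

theorem prime_step {p : ℕ} (hp : p.Prime) {k : ℕ} (hF : HD (ZMod p) X k) {A : Set X} {η1 η2 ε : ℝ}
    (hη : η1 < η2) (hη1 : 0 < η1) (hε : 0 < ε) {z : Ch ℤ X →ₗ[ℤ] ℤ}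
    (h : Dies A η1 (k + 2) ((p : ℤ) • z)) :
    Dies A η2 (k + 2) z := by
  classical
  obtain ⟨δ, hδ, c, hc1, hc2⟩ := h
  have hcyc : Cyc {x | Inn A η1 x} δ (k + 1) (bz (Int.castRingHom (ZMod p)) c) := by
    refine ⟨fun l a1 a2 => ?_, fun l a1 a2 a3 => ?_⟩
    · rw [bz_bd, ← hc1 l a1 (by omega)]
      simp
    · rw [bz_single, hc2 l a1 a2 a3, map_zero]
  obtain ⟨δ', hδ', b', hb1, hb2⟩ := hF.pv (le_refl _) _ (η2 - η1) (by linarith) δ hδ _ hcyc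
  have : NeZero p := ⟨hp.ne_zero⟩
  set b : Ch ℤ X →ₗ[ℤ] ℤ := linearCombination ℤ fun l => ((b' (single l 1)).val : ℤ) with hb
  have hbb : bz (Int.castRingHom (ZMod p)) b = b' := by
    apply lext; intro l
    rw [bz_single]; simp [hb]
  have hdiv : ∀ l, small (min δ δ') l → l.length = k + 2 →
      (p : ℤ) ∣ c (single l 1) - b (bd l) := by
    intro l h1 h2
    rw [← ZMod.intCast_zmod_eq_zero_iff_dvd]
    have e1 := hb1 l (h1.mono (min_le_right _ _) (List.Subset.refl _)) h2
    rw [bz_single, ← hbb, bz_bd] at e1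
    simp only [eq_intCast] at e1
    push_cast
    rw [e1, sub_self]
  set e : Ch ℤ X →ₗ[ℤ] ℤ := linearCombination ℤ fun l => (c (single l 1) - b (bd l)) / p with he
  have hpe : ∀ l, small (min δ δ') l → l.length = k + 2 →
      (p : ℤ) * e (single l 1) = c (single l 1) - b (bd l) := by
    intro l h1 h2
    rw [he, linearCombination_single, one_smul]
    exact Int.mul_ediv_cancel' (hdiv l h1 h2)
  have hp0 : (p : ℤ) ≠ 0 := by exact_mod_cast hp.ne_zero
  refine ⟨min δ δ', by positivity, e, ?_, ?_⟩
  · intro l h1 h2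
    apply mul_left_cancel₀ hp0
    have e1 := hc1 l (h1.mono (min_le_left _ _) (List.Subset.refl _)) h2
    rw [LinearMap.smul_apply, smul_eq_mul] at e1
    rw [e1]
    have e2 : ((p : ℤ) • e) (bd l) = (c - b ∘ₗ dl) (bd l) := by
      refine eq_of_supp ?_ (bd_mem l)
      rintro m ⟨m1, m2⟩
      rw [LinearMap.smul_apply, smul_eq_mul, hpe m (h1.mono le_rfl m2.subset) (by omega)]
      simp
    rw [LinearMap.smul_apply, smul_eq_mul] at e2
    rw [e2]
    simp [dl_bd]
  · intro l h1 h2 h3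
    apply mul_left_cancel₀ hp0
    rw [hpe l h1 h2, hc2 l (h1.mono (min_le_left _ _) (List.Subset.refl _)) h2
      (fun x hx y hy => h3 x hx y (hy.trans hη.le))]
    have : b (bd l) = 0 := by
      refine zero_of_supp ?_ (bd_mem l)
      rintro m ⟨m1, m2⟩
      rw [hb, linearCombination_single, one_smul, hb2 m (h1.mono (min_le_right _ _) m2.subset)
        (by omega)]
      · simp
      · intro x hx y hy w hw
        refine h3 x (m2.subset hx) w ?_
        have := dist_triangle x y w
        linarith
    rw [this]; simp

theorem pv_int [CompactSpace X] {k : ℕ} (hQ : HD ℚ X (k + 1))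
    (hF : ∀ p : ℕ, p.Prime → HD (ZMod p) X k) : PV ℤ X (k + 2) := by
  intro A η hη ε hε z hz
  obtain ⟨N, hN, hd⟩ := exists_mul_dies (L := ℚ) (nonZeroDivisors ℤ) le_rfl (η := η / 2)
    (by positivity) hε hz (hQ.pv (by omega))
  have key : ∀ M : ℕ, M ≠ 0 → ∀ (z : Ch ℤ X →ₗ[ℤ] ℤ) (η1 η2 : ℝ), 0 < η1 → η1 < η2 →
      Dies A η1 (k + 2) ((M : ℤ) • z) → Dies A η2 (k + 2) z := by
    intro M
    induction M using Nat.recOnMul with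
    | zero => simp
    | one => intro _ z η1 η2 h1 h2 h3; simpa using h3.mono_eta h2.le
    | prime p hp => intro _ z η1 η2 h1 h2 h3; exact prime_step hp (hF p hp) h2 h1 hε h3
    | mul a b ha hb =>
      intro hab z η1 η2 h1 h2 h3
      have ha' : a ≠ 0 := left_ne_zero_of_mul hab
      have hb' : b ≠ 0 := right_ne_zero_of_mul hab
      refine hb hb' z ((η1 + η2) / 2) η2 (by linarith) (by linarith) ?_
      refine ha ha' _ η1 _ h1 (by linarith) ?_
      rw [smul_smul]
      exact_mod_cast h3
  have hN0 : N ≠ 0 := nonZeroDivisors.ne_zero hN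
  refine key N.natAbs (by simpa using hN0) z (η / 2) η (by positivity) (by linarith) ?_
  rcases Int.natAbs_eq N with h | h
  · rw [← h]; exact hd
  · have : ((N.natAbs : ℕ) : ℤ) = (-1) * N := by omega
    rw [this, mul_smul]
    exact hd.smul _

theorem pv_int_of_local [CompactSpace X] {j : ℕ}
    (h : ∀ (M : Ideal ℤ) (hM : M.IsMaximal), PV (Localization.AtPrime M) X j) : PV ℤ X j := by
  intro A η hη ε hε z hz
  let I : Ideal ℤ :=
    { carrier := {N | Dies A η j (N • z)}
      add_mem' := fun {a b} ha hb => by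
        simp only [mem_ofPred_eq, add_smul] at *
        exact ha.add hb
      zero_mem' := by
        simp only [mem_ofPred_eq, zero_smul]
        exact ⟨1, one_pos, 0, by simp, by simp⟩
      smul_mem' := fun c a ha => by
        simp only [mem_ofPred_eq, smul_eq_mul, mul_smul] at *
        exact ha.smul c }
  by_cases hI : I = ⊤
  · have : (1 : ℤ) ∈ I := by rw [hI]; trivial
    have : Dies A η j ((1 : ℤ) • z) := this
    simpa using this
  · obtain ⟨M, hM, hIM⟩ := Ideal.exists_le_maximal I hI
    obtain ⟨N, hN, hd⟩ := exists_mul_dies (L := Localization.AtPrime M) M.primeCompl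
      M.primeCompl_le_nonZeroDivisors hη hε hz (h M hM)
    exact absurd (hIM (show N ∈ I from hd)) hN

end int
end TD

open Filter Set
open scoped ENNReal
set_option linter.unusedSectionVars false
set_option linter.unusedVariables false

namespace TD
open Finsupp

section tor
variable {R : Type*} [CommRing R] [IsDomain R] {X Y : Type*} [MetricSpace X] [MetricSpace Y]

theorem tor_fac [IsPrincipalIdealRing R] {W U : Type*} [AddCommGroup W] [AddCommGroup U]
    [Module R W] [Module R U] [Module.Finite R U] (f : W →ₗ[R] U) (z : W →ₗ[R] R)
    (c : U →ₗ[R] R) (V : Submodule R U) {π : R} (hπ : π ≠ 0) (hc : ∀ w, π * z w = c (f w))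
    (hV : ∀ v ∈ V, c v = 0)
    (h : ∀ (w : W) (y : U) (N : R), N ≠ 0 → ∀ v ∈ V, f w = N • y + v → π ∣ c y) :
    ∃ g : U →ₗ[R] R, (∀ w, z w = g (f w)) ∧ ∀ v ∈ V, g v = 0 := by
  classical
  let S : Submodule R U :=
    { carrier := {y | ∃ N : R, N ≠ 0 ∧ ∃ w, ∃ v ∈ V, f w = N • y + v}
      zero_mem' := ⟨1, one_ne_zero, 0, 0, V.zero_mem, by simp⟩
      add_mem' := by
        rintro a b ⟨N, hN, w, v, hv, e⟩ ⟨N', hN', w', v', hv', e'⟩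
        refine ⟨N * N', mul_ne_zero hN hN', N' • w + N • w', N' • v + N • v',
          V.add_mem (V.smul_mem _ hv) (V.smul_mem _ hv'), ?_⟩
        rw [map_add, map_smul, map_smul, e, e']
        module
      smul_mem' := by
        rintro r a ⟨N, hN, w, v, hv, e⟩
        refine ⟨N, hN, r • w, r • v, V.smul_mem _ hv, ?_⟩
        rw [map_smul, e]
        module }
  have hS : ∀ y : S, ∃ t, c y = π * t := by
    rintro ⟨y, N, hN, w, v, hv, e⟩
    exact h w y N hN v hv e
  choose t ht using hS
  let cp : S →ₗ[R] R :=
    { toFun := t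
      map_add' := fun a b => by
        apply mul_left_cancel₀ hπ
        rw [← ht, mul_add, ← ht, ← ht]; simp
      map_smul' := fun r a => by
        apply mul_left_cancel₀ hπ
        rw [← ht]
        simp only [RingHom.id_apply, smul_eq_mul]
        rw [mul_left_comm, ← ht]; simp }
  have hcp : ∀ y : S, c y = π * cp y := ht
  have htf : Module.IsTorsionFree R (U ⧸ S) := by
    rw [Module.isTorsionFree_iff_smul_eq_zero]
    intro r x hx
    obtain ⟨y, rfl⟩ := S.mkQ_surjective x
    by_cases hr : r = 0
    · exact Or.inl hr
    · right
      rw [← map_smul, Submodule.mkQ_apply, Submodule.Quotient.mk_eq_zero] at hx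
      rw [Submodule.mkQ_apply, Submodule.Quotient.mk_eq_zero]
      obtain ⟨N, hN, w, v, hv, e⟩ := hx
      exact ⟨N * r, mul_ne_zero hN hr, w, v, hv, by rw [e, smul_smul]⟩
  have : Module.Free R (U ⧸ S) := Module.free_of_finite_type_torsion_free'
  obtain ⟨σ, hσ⟩ := Module.projective_lifting_property S.mkQ (LinearMap.id : (U ⧸ S) →ₗ[R] _)
    S.mkQ_surjective
  have hmem : ∀ y, (LinearMap.id - σ ∘ₗ S.mkQ : U →ₗ[R] U) y ∈ S := by
    intro y
    rw [← Submodule.Quotient.mk_eq_zero, ← Submodule.mkQ_apply]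
    have := LinearMap.congr_fun hσ (S.mkQ y)
    simp only [LinearMap.comp_apply, LinearMap.id_apply] at this
    rw [LinearMap.sub_apply, map_sub, LinearMap.id_apply, LinearMap.comp_apply, this, sub_self]
  have key : ∀ y (hy : y ∈ S), (cp ∘ₗ LinearMap.codRestrict S _ hmem) y = cp ⟨y, hy⟩ := by
    intro y hy
    rw [LinearMap.comp_apply]
    congr 1
    ext
    simp [(Submodule.Quotient.mk_eq_zero S).2 hy]
  refine ⟨cp ∘ₗ LinearMap.codRestrict S _ hmem, ?_, ?_⟩
  · intro w
    rw [key (f w) ⟨1, one_ne_zero, w, 0, V.zero_mem, by simp⟩]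
    apply mul_left_cancel₀ hπ
    rw [hc]
    exact hcp ⟨f w, _⟩
  · intro v hv
    have hvS : v ∈ S := ⟨1, one_ne_zero, 0, -v, V.neg_mem hv, by simp⟩
    rw [key v hvS]
    apply mul_left_cancel₀ hπ
    rw [mul_zero]
    exact (hcp ⟨v, hvS⟩).symm.trans (hV v hv)

def TorData (π : R) (X : Type*) [MetricSpace X] (a : ℕ) : Prop :=
  ∃ (A : Set X) (η ε : ℝ) (z c : Ch R X →ₗ[R] R), 0 < η ∧ 0 < ε ∧ Cyc A ε (a + 1) z ∧
    (∀ l, small ε l → l.length = a + 2 → π * z (single l 1) = c (bd l)) ∧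
    (∀ l, small ε l → l.length = a + 1 → (∀ x ∈ l, x ∈ A) → c (single l 1) = 0) ∧
    ∀ δ, 0 < δ → ∃ (w y v : Ch R X) (N : R), N ≠ 0 ∧
      w ∈ supported R R {l : List X | small δ l ∧ l.length = a + 2} ∧
      y ∈ supported R R {l : List X | small δ l ∧ l.length = a + 1} ∧
      v ∈ supported R R {l : List X | (small δ l ∧ l.length = a + 1) ∧ ∀ x ∈ l, Inn A η x} ∧
      dl w = N • y + v ∧ ¬ π ∣ c y

theorem pow_dies {A : Set X} {ε : ℝ} {j : ℕ} {π : R} {z : Ch R X →ₗ[R] R} (hz : Cyc A ε j z)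
    (k : ℕ) : ∀ θ θ', θ < θ' → Dies A θ j (π ^ k • z) → ¬ Dies A θ' j z →
      ∃ (z1 : Ch R X →ₗ[R] R) (θ1 θ1' : ℝ), Cyc A ε j z1 ∧ θ ≤ θ1 ∧ θ1 < θ1' ∧ ¬ Dies A θ1' j z1 ∧ Dies A θ1 j (π • z1) := by
  induction k with
  | zero =>
    intro θ θ' h1 h2 h3
    exact absurd ((by simpa using h2 : Dies A θ j z).mono_eta h1.le) h3
  | succ k ih =>
    intro θ θ' h1 h2 h3
    by_cases hd : Dies A ((θ + θ') / 2) j (π ^ k • z)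
    · obtain ⟨z1, t, t', a1, a2, a3, a4, a5⟩ := ih _ θ' (by linarith) hd h3
      exact ⟨z1, t, t', a1, by linarith, a3, a4, a5⟩
    · refine ⟨π ^ k • z, θ, _, hz.smul _, le_rfl, by linarith, hd, ?_⟩
      rw [smul_smul, ← pow_succ']
      exact h2

theorem HD.torData [IsDiscreteValuationRing R] {L : Type*} [CommRing L] [Algebra R L]
    [IsFractionRing R L] [CompactSpace X] {a : ℕ} {π : R} (hπ : Irreducible π)
    (h1 : HD R X (a + 1)) (h2 : ¬ HD R X a) (hL : HD L X a) : TorData π X a := by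
  classical
  have nX : ¬ PV R X (a + 1) := fun h => h2 (h1.descend h)
  unfold PV at nX
  push Not at nX
  obtain ⟨A0, η0, hη0, ε0, hε0, z0, hz0, hnd⟩ := nX
  obtain ⟨N, hN, hd⟩ := exists_mul_dies (L := L) (nonZeroDivisors R) le_rfl (η := η0 / 2)
    (by positivity) hε0 hz0 (hL.pv le_rfl)
  obtain ⟨k, u, hu⟩ := IsDiscreteValuationRing.associated_pow_irreducible
    (nonZeroDivisors.ne_zero hN) hπ
  have hd2 : Dies A0 (η0 / 2) (a + 1) (π ^ k • z0) := by
    rw [← hu, mul_comm, mul_smul]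
    exact hd.smul _
  obtain ⟨z, θ, θ', hz, t1, t2, t3, t4⟩ := pow_dies hz0 k _ η0 (by linarith) hd2 hnd
  obtain ⟨δ0, hδ0, c, hc1, hc2⟩ := t4
  have hθ : 0 < θ := by linarith
  set A : Set X := {x | Inn A0 θ x} with hA
  have hAA : A ⊆ A0 := fun x hx => hx x (by simp [hθ.le])
  set ε := min ε0 δ0 with hεd
  have hε : 0 < ε := by positivity
  have m1 : ε ≤ ε0 := min_le_left _ _
  have m2 : ε ≤ δ0 := min_le_right _ _
  have hzA : Cyc A ε (a + 1) z := ⟨fun l b1 b2 => hz.1 l (b1.mono m1 (List.Subset.refl _)) b2,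
    fun l b1 b2 b3 => hz.2 l (b1.mono m1 (List.Subset.refl _)) b2 fun x hx => hAA (b3 x hx)⟩
  set η := θ' - θ with hη
  have hη' : 0 < η := by linarith
  have hndA : ¬ Dies A η (a + 1) z := by
    intro h
    refine t3 (Dies.mono (fun x hx y hy => ?_) h)
    intro w hw
    have := dist_triangle x y w
    exact hx w (by linarith)
  have hcz : ∀ l, small ε l → l.length = a + 2 → π * z (single l 1) = c (bd l) :=
    fun l b1 b2 => by
      rw [← hc1 l (b1.mono m2 (List.Subset.refl _)) b2]; rfl
  have hcA : ∀ l, small ε l → l.length = a + 1 → (∀ x ∈ l, x ∈ A) → c (single l 1) = 0 :=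
    fun l b1 b2 b3 => hc2 l (b1.mono m2 (List.Subset.refl _)) b2 b3
  refine ⟨A, η / 2, ε, z, c, by positivity, hε, hzA, hcz, hcA, ?_⟩
  intro δ' hδ'
  by_contra hcon
  apply hndA
  set δ := min δ' ε with hδd
  have hδ : 0 < δ := by positivity
  have n1 : δ ≤ δ' := min_le_left _ _
  have n2 : δ ≤ ε := min_le_right _ _
  obtain ⟨S, hS, hnet⟩ := dies_of_net X (η := η) (η' := η / 2) (δ := δ) hε (by linarith) hδ n2
  refine hnet R A (a + 1) z hzA ?_ (by positivity)
  set SW : Set (List X) := {l | small δ l ∧ (∀ x ∈ l, x ∈ S) ∧ l.length = a + 2} with hSW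
  set SU : Set (List X) := {l | small δ l ∧ (∀ x ∈ l, x ∈ S) ∧ l.length = a + 1} with hSU
  have hfinU : SU.Finite := (finite_lists hS (a + 1)).subset fun l hl => ⟨hl.2.2, hl.2.1⟩
  have : Finite SU := hfinU.to_subtype
  have : Module.Finite R (supported R R SU) :=
    Module.Finite.equiv (supportedEquivFinsupp (R := R) (M := R) SU).symm
  have hdl : ∀ w ∈ supported R R SW, dl w ∈ supported R R SU := by
    intro w hw
    refine dl_RM.app ?_ hw
    rintro l ⟨l1, l2, l3⟩ k hk
    exact ⟨small_mem hk l1, fun x hx => l2 x (hk.2.subset hx), by have := hk.1; omega⟩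
  obtain ⟨g, hg1, hg2⟩ := tor_fac (W := supported R R SW) (U := supported R R SU)
    (dl.restrict hdl) (z ∘ₗ (supported R R SW).subtype) (c ∘ₗ (supported R R SU).subtype)
    ((supported R R {l | ∀ x ∈ l, Inn A (η / 2) x}).comap (supported R R SU).subtype)
    hπ.ne_zero (fun w => by
      have : (π • z) w.1 = (c ∘ₗ dl) w.1 := by
        refine eq_of_supp ?_ w.2
        rintro l ⟨l1, l2, l3⟩
        simp only [LinearMap.smul_apply, smul_eq_mul, LinearMap.comp_apply, dl_single]
        exact hcz l (l1.mono n2 (List.Subset.refl _)) l3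
      exact this) (fun v hv => by
      have := supp_inter v.2 hv
      refine zero_of_supp ?_ this
      rintro l ⟨⟨l1, l2, l3⟩, l4⟩
      refine hcA l (l1.mono n2 (List.Subset.refl _)) l3 fun x hx => l4 x hx x (by
        rw [dist_self]; positivity))
    (fun w y N hN v hv e => by
      by_contra hnd
      have e' := congrArg Subtype.val e
      refine hcon ⟨w.1, y.1, v.1, N, hN, sup_mono ?_ w.2, sup_mono ?_ y.2,
        sup_mono ?_ (supp_inter v.2 hv), e', hnd⟩
      · rintro l ⟨l1, l2, l3⟩
        exact ⟨l1.mono n1 (List.Subset.refl _), l3⟩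
      · rintro l ⟨l1, l2, l3⟩
        exact ⟨l1.mono n1 (List.Subset.refl _), l3⟩
      · rintro l ⟨⟨l1, l2, l3⟩, l4⟩
        exact ⟨⟨l1.mono n1 (List.Subset.refl _), l3⟩, l4⟩)
  refine ⟨g ∘ₗ restrictDom R R SU, ?_, ?_⟩
  · intro l l1 l2 l3
    have hl : (single l 1 : Ch R X) ∈ supported R R SW := sg_mem (show l ∈ SW from ⟨l1, l2, l3⟩)
    have := hg1 ⟨_, hl⟩
    rw [LinearMap.comp_apply] at this
    rw [LinearMap.comp_apply]
    refine this.trans (congrArg g ?_)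
    ext1
    have hb : (bd l : Ch R X) ∈ supported R R SU := by
      rw [← dl_single]; exact hdl _ hl
    rw [restrictDom_apply]
    simp only [LinearMap.coe_restrict_apply, dl_single]
    symm
    rw [filter_eq_self_iff]
    intro k hk
    exact (mem_supported _ _).1 hb (Finsupp.mem_support_iff.2 hk)
  · intro l l1 l2 l3 l4
    have hl : (single l 1 : Ch R X) ∈ supported R R SU := sg_mem (show l ∈ SU from ⟨l1, l2, l3⟩)
    rw [LinearMap.comp_apply]
    apply hg2
    rw [Submodule.mem_comap]
    have : (supported R R SU).subtype (restrictDom R R SU (single l 1)) = single l 1 := by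
      rw [Submodule.subtype_apply, restrictDom_apply]
      rw [filter_eq_self_iff]
      intro k hk
      exact (mem_supported _ _).1 hl (Finsupp.mem_support_iff.2 hk)
    rw [this]
    exact sg_mem l4

theorem TorData.lower {a b : ℕ} {π : R} (hπ : Prime π) (hX : TorData π X a)
    (hY : TorData π Y b) : ¬ HD R (X × Y) (a + b) := by
  intro hXY
  obtain ⟨A, η, ε, z, c, hη, hε, ⟨hz1, hz2⟩, hc1, hc2, hX⟩ := hX
  obtain ⟨A', η', ε', z', c', hη', hε', ⟨hz1', hz2'⟩, hc1', hc2', hY⟩ := hY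
  set T : Ch2 R X Y →ₗ[R] R := tz z c' (a + 2) (b + 1) + (-1 : R) ^ a • tz c z' (a + 1) (b + 2)
    with hTd
  have hTv : ∀ p : List X × List Y, small (min ε ε') p.1 → small (min ε ε') p.2 →
      ((∀ x ∈ p.1, x ∈ A) ∨ (∀ x ∈ p.2, x ∈ A')) → T (single p 1) = 0 := by
    intro p p1 p2 hp
    have q1 := p1.mono (min_le_left _ _) (List.Subset.refl _)
    have q2 := p2.mono (min_le_right _ _) (List.Subset.refl _)
    rw [hTd, LinearMap.add_apply, LinearMap.smul_apply, tz_single, tz_single]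
    · simp
    · intro s1 s2
      rcases hp with hp | hp
      · exact Or.inl (hc2 _ q1 s1 hp)
      · exact Or.inr (hz2' _ q2 s2 hp)
    · intro s1 s2
      rcases hp with hp | hp
      · exact Or.inl (hz2 _ q1 s1 hp)
      · exact Or.inr (hc2' _ q2 s2 hp)
  obtain ⟨δ0, hδ0, φ, h1, h2⟩ := hXY.hd2.eval T (ε := min ε ε')
    (η := min η η') (by positivity) (by positivity) (by
      rintro ⟨l, k⟩ ⟨hl, hk⟩ s1 s2 hln
      simp only [ln] at hln s1 s2 hl hk
      have q1 := s1.mono (min_le_left _ _) (List.Subset.refl _)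
      have q2 := s2.mono (min_le_right _ _) (List.Subset.refl _)
      have sl : (single l 1 : Ch R X) ∈ supported R R {k | k.length = l.length} := sg_mem rfl
      have sk : (single k 1 : Ch R Y) ∈ supported R R {l | l.length = k.length} := sg_mem rfl
      have hl1 := List.length_pos_iff.2 hl
      have hk1 := List.length_pos_iff.2 hk
      rw [sg2, DD_tm, io_eq sl, map_add, map_smul, LinearMap.smul_apply, map_smul, hTd]
      simp only [LinearMap.add_apply, LinearMap.smul_apply, smul_eq_mul]
      have dl' := dt_len (R := R) (n := l.length - 1) l (by omega)
      have dk' := dt_len (R := R) (n := k.length - 1) k (by omega)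
      by_cases hc : l.length = a + 3
      · have hk3 : k.length = b + 1 := by omega
        rw [hc] at sl dl'
        norm_num at dl'
        rw [hk3] at sk dk'
        norm_num at dk'
        rw [tz_eq _ _ _ _ dl' sk, tz_ne _ _ _ _ dl' sk (by omega),
          tz_ne _ _ _ _ sl dk' (by omega), tz_ne _ _ _ _ sl dk' (by omega), dt_gt l (by omega),
          hz1 l q1 (by omega)]
        ring
      by_cases hc2 : k.length = b + 3
      · have hl3 : l.length = a + 1 := by omega
        rw [hl3] at sl dl'
        norm_num at dl'
        rw [hc2] at sk dk'
        norm_num at dk'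
        rw [tz_ne _ _ _ _ dl' sk (by omega), tz_ne _ _ _ _ dl' sk (by omega),
          tz_ne _ _ _ _ sl dk' (by omega), tz_eq _ _ _ _ sl dk', dt_gt k (by omega),
          hz1' k q2 (by omega)]
        ring
      by_cases hc3 : l.length = a + 2
      · have hk3 : k.length = b + 2 := by omega
        rw [hc3] at sl dl'
        norm_num at dl'
        rw [hk3] at sk dk'
        norm_num at dk'
        rw [tz_ne _ _ _ _ dl' sk (by omega), tz_eq _ _ _ _ dl' sk,
          tz_eq _ _ _ _ sl dk', tz_ne _ _ _ _ sl dk' (by omega), dt_gt k (by omega),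
          dt_gt l (by omega), ← hc1 l q1 hc3, ← hc1' k q2 hk3, hc3]
        ring
      · rw [tz_ne _ _ _ _ dl' sk (by omega), tz_ne _ _ _ _ dl' sk (by omega),
          tz_ne _ _ _ _ sl dk' (by omega), tz_ne _ _ _ _ sl dk' (by omega)]
        ring)
  set δ := min δ0 (min ε ε') with hδd
  have hδ : 0 < δ := by positivity
  have n1 : δ ≤ δ0 := min_le_left _ _
  have n2 : δ ≤ ε := (min_le_right _ _).trans (min_le_left _ _)
  have n3 : δ ≤ ε' := (min_le_right _ _).trans (min_le_right _ _)
  obtain ⟨w, y, v, N, hN, hw, hy, hv, e, hnd⟩ := hX δ hδ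
  obtain ⟨w', y', v', N', hN', hw', hy', hv', e', hnd'⟩ := hY δ hδ
  have lw := sup_mono (fun l hl => hl.2) hw
  have lw' := sup_mono (fun l hl => hl.2) hw'
  have ly := sup_mono (fun l hl => hl.2) hy
  have ddy : dt y ∈ supported R R {l : List X | small δ l ∧ ∀ x ∈ l, Inn A η x} := by
    have e1 : N • dt y = - dt v := by
      have : dt (dl w) = 0 := by rw [← dt_eq_dl (by omega) lw, dt_dt]
      rw [e, map_add, map_smul] at this
      exact eq_neg_of_add_eq_zero_left this
    have e2 : - dt v ∈ supported R R {l : List X | small δ l ∧ ∀ x ∈ l, Inn A η x} := by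
      refine Submodule.neg_mem _ (dt_supp ?_ hv)
      rintro l ⟨⟨l1, l2⟩, l3⟩ k hk -
      exact ⟨small_mem hk l1, fun x hx => l3 x (hk.2.subset hx)⟩
    rw [← e1] at e2
    rw [mem_supported] at e2 ⊢
    rwa [Finsupp.support_smul_eq hN] at e2
  have hφ0 : ∀ q : List X × List Y, small δ q.1 → small δ q.2 → ((∀ x ∈ q.1, Inn A η x) ∨
      (∀ x ∈ q.2, Inn A' η' x)) → φ (single q 1) = 0 := by
    intro q q1 q2 q3
    refine h2 q (q1.mono n1 (List.Subset.refl _)) (q2.mono n1 (List.Subset.refl _))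
      fun p ⟨_, _, _, p4, p4'⟩ p5 p6 => hTv p p5 p6 ?_
    rcases q3 with q3 | q3
    · left
      intro x hx
      obtain ⟨y, hy, hxy⟩ := p4 x hx
      exact q3 y hy x (hxy.trans (min_le_left _ _))
    · right
      intro x hx
      obtain ⟨y, hy, hxy⟩ := p4' x hx
      exact q3 y hy x (hxy.trans (min_le_right _ _))
  have e1 : T (tm y w') = (-1) ^ a * (c y * z' w') := by
    rw [hTd, LinearMap.add_apply, LinearMap.smul_apply, tz_ne _ _ _ _ ly lw' (by omega),
      tz_eq _ _ _ _ ly lw']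
    simp
  have e2 : T (tm y w') = φ (DD (tm y w')) := by
    refine eq_of_supp (g := φ ∘ₗ DD) (S := {p | ne2 p ∧ small δ p.1 ∧ small δ p.2 ∧ ln p =
      (a + b) + 3}) ?_ (tm_mem ?_ hy hw')
    · rintro p ⟨p1, p2, p3, p4⟩
      exact h1 p p1 (p2.mono n1 (List.Subset.refl _)) (p3.mono n1 (List.Subset.refl _)) p4
    · rintro l ⟨l1, l2⟩ k ⟨k1, k2⟩
      refine ⟨⟨?_, ?_⟩, l1, k1, by simp only [ln]; omega⟩
      · rintro rfl; simp at l2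
      · rintro rfl; simp at k2
  have e3 : φ (DD (tm y w')) = (-1) ^ (a + 2) * (N' * φ (tm y y')) := by
    have g1 : φ (tm (dt y) w') = 0 := by
      refine zero_of_supp (f := φ) (S := {p | small δ p.1 ∧ small δ p.2 ∧ ∀ x ∈ p.1, Inn A η x})
        ?_ (tm_mem ?_ ddy hw')
      · rintro q ⟨q1, q2, q3⟩
        exact hφ0 q q1 q2 (Or.inl q3)
      · rintro l ⟨l1, l3⟩ k ⟨k1, k2⟩
        exact ⟨l1, k1, l3⟩
    have g2 : φ (tm y v') = 0 := by
      refine zero_of_supp (f := φ) (S := {p | small δ p.1 ∧ small δ p.2 ∧ ∀ x ∈ p.2, Inn A' η' x})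
        ?_ (tm_mem ?_ hy hv')
      · rintro q ⟨q1, q2, q3⟩
        exact hφ0 q q1 q2 (Or.inr q3)
      · rintro l ⟨l1, l2⟩ k ⟨⟨k1, k2⟩, k3⟩
        exact ⟨l1, k1, k3⟩
    rw [DD_tm, map_add, g1, io_eq ly, dt_eq_dl (by omega) lw', e', map_smul, LinearMap.smul_apply,
      map_smul, map_add, map_add, g2, map_smul, map_smul]
    simp only [smul_eq_mul]
    ring
  have e4 : π * z' w' = N' * c' y' := by
    have i1 : (π • z') w' = (c' ∘ₗ dl) w' := by
      refine eq_of_supp ?_ hw'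
      rintro l ⟨l1, l3⟩
      simp only [LinearMap.smul_apply, smul_eq_mul, LinearMap.comp_apply, dl_single]
      exact hc1' l (l1.mono n3 (List.Subset.refl _)) l3
    have i2 : c' v' = 0 := by
      refine zero_of_supp ?_ hv'
      rintro l ⟨⟨l1, l2⟩, l4⟩
      exact hc2' l (l1.mono n3 (List.Subset.refl _)) l2 fun x hx => l4 x hx x (by simp [hη'.le])
    rw [LinearMap.comp_apply, e', map_add, i2, map_smul] at i1
    simpa using i1
  have e5 : c y * c' y' = π * φ (tm y y') := by
    apply mul_left_cancel₀ hN'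
    have hu : ((-1 : R) ^ a) * (-1) ^ a = 1 := by rw [← mul_pow]; simp
    have i1 : (-1 : R) ^ a * (c y * z' w') = (-1) ^ a * (N' * φ (tm y y')) := by
      rw [← e1, e2, e3]; ring
    have i2 : c y * z' w' = N' * φ (tm y y') := by
      have := congrArg (fun t => (-1 : R) ^ a * t) i1
      simpa only [← mul_assoc, hu, one_mul] using this
    calc N' * (c y * c' y') = c y * (N' * c' y') := by ring
      _ = π * (c y * z' w') := by rw [← e4]; ring
      _ = _ := by rw [i2]; ring
  rcases hπ.dvd_or_dvd (⟨_, e5⟩ : π ∣ c y * c' y') with h | h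
  · exact hnd h
  · exact hnd' h

theorem HD.tor_lower [IsDiscreteValuationRing R] {L : Type*} [CommRing L] [Algebra R L]
    [IsFractionRing R L] [CompactSpace X] [CompactSpace Y] {a b : ℕ}
    (h1 : HD R X (a + 1)) (h2 : ¬ HD R X a) (hL : HD L X a)
    (h1' : HD R Y (b + 1)) (h2' : ¬ HD R Y b) (hL' : HD L Y b) : ¬ HD R (X × Y) (a + b) := by
  obtain ⟨π, hπ⟩ := IsDiscreteValuationRing.exists_irreducible R
  exact TorData.lower hπ.prime (h1.torData hπ h2 hL) (h1'.torData hπ h2' hL')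

end tor
end TD

open Filter Set
open scoped ENNReal
set_option linter.unusedSectionVars false
set_option linter.unusedVariables false

namespace TD
open Finsupp

section alt
variable {R : Type*} [CommRing R] {A : Type*} {M : Type*} [AddCommGroup M] [Module R M]

/-- antisymmetry under adjacent swaps, on lists of length `k+2` -/
def Alt (k : ℕ) (G : Ch R A →ₗ[R] M) : Prop :=
  ∀ (a : List A) (x y : A) (b : List A), a.length + b.length = k →
    G (single (a ++ x :: y :: b) 1) + G (single (a ++ y :: x :: b) 1) = 0

theorem Alt.bd {k : ℕ} (u : List A) : ∀ {k : ℕ} {G : Ch R A →ₗ[R] M}, Alt k G → ∀ (x y : A)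
    (w : List A), u.length + w.length = k + 1 →
    G (bd (u ++ x :: y :: w)) + G (bd (u ++ y :: x :: w)) = 0 := by
  induction u with
  | nil =>
    intro k G hG x y w hw
    simp only [List.nil_append, bd_cons, map_sub, cns_single]
    have : (G ∘ₗ cns x ∘ₗ cns y + G ∘ₗ cns y ∘ₗ cns x : Ch R A →ₗ[R] M) (TD.bd w) = 0 := by
      refine zero_of_supp ?_ (bd_mem w)
      rintro m ⟨m1, m2⟩
      simp only [LinearMap.add_apply, LinearMap.comp_apply, cns_single]
      exact hG [] x y m (by simp only [List.length_nil] at *; omega)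
    simp only [LinearMap.add_apply, LinearMap.comp_apply] at this
    rw [← this]; abel
  | cons z u ih =>
    intro k G hG x y w hw
    simp only [List.cons_append, bd_cons, map_sub]
    simp only [List.length_cons] at hw
    have h1 := hG u x y w (by omega)
    rcases k with _ | k
    · have hu : u = [] := List.eq_nil_of_length_eq_zero (by omega)
      have hw' : w = [] := List.eq_nil_of_length_eq_zero (by omega)
      subst hu hw'
      simp only [List.nil_append, bd_cons, bd_nil, map_sub, cns_single, map_zero] at h1 ⊢
      refine Eq.trans ?_ h1
      abel
    · have h2 := ih (k := k) (G := G ∘ₗ cns z) (by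
        intro a x y b hab
        have := hG (z :: a) x y b (by simp only [List.length_cons]; omega)
        simpa using this) x y w (by omega)
      simp only [LinearMap.comp_apply] at h2
      have : ∀ a b c d : M, a + b = 0 → c + d = 0 → a - c + (b - d) = 0 := by
        intro a b c d h1 h2
        have : a - c + (b - d) = (a + b) - (c + d) := by abel
        rw [this, h1, h2, sub_zero]
      exact this _ _ _ _ h1 h2

theorem Alt.dup {k : ℕ} {G : Ch R A →ₗ[R] M} (hG : Alt k G) (h2 : ∀ m : M, m + m = 0 → m = 0)
    {l : List A} (hl : ¬ l.Nodup) (hk : l.length = k + 2) : G (single l 1) = 0 := by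
  classical
  have key : ∀ b a c : List A, ∀ x, (a ++ x :: b ++ x :: c).length = k + 2 →
      G (single (a ++ x :: b ++ x :: c) 1) = 0 := by
    intro b
    induction b with
    | nil =>
      intro a c x hlen
      apply h2
      have := hG a x x c (by simp at hlen; omega)
      simpa using this
    | cons y b ih =>
      intro a c x hlen
      have h1 := hG a x y (b ++ x :: c) (by simp at hlen ⊢; omega)
      have h3 := ih (a ++ [y]) c x (by simp at hlen ⊢; omega)
      have e : a ++ [y] ++ x :: b ++ x :: c = a ++ y :: x :: (b ++ x :: c) := by simp
      rw [e] at h3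
      rw [h3, add_zero] at h1
      simpa using h1
  obtain ⟨x, hx⟩ := List.exists_duplicate_iff_not_nodup.2 hl
  rw [List.duplicate_iff_sublist, List.cons_sublist_iff] at hx
  obtain ⟨r1, r2, rfl, h3, h4⟩ := hx
  rw [List.singleton_sublist] at h4
  obtain ⟨a, b, rfl⟩ := List.append_of_mem h3
  obtain ⟨b', c, rfl⟩ := List.append_of_mem h4
  have := key (b ++ b') a c x (by simpa [add_assoc] using hk)
  simpa using this

end alt

section CD
variable {X Y : Type*} [MetricSpace X] [MetricSpace Y]

/-- an open cover of mesh `≤ ε` and order `≤ m` -/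
structure Cov {ι : Type*} (X : Type*) [MetricSpace X] (m : ℕ) (ε : ℝ) (U : ι → Set X) : Prop where
  op : ∀ i, IsOpen (U i)
  cov : ∀ x, ∃ i, x ∈ U i
  mesh : ∀ i, ∀ x ∈ U i, ∀ y ∈ U i, dist x y ≤ ε
  ord : ∀ x, ∀ s : Finset ι, (∀ i ∈ s, x ∈ U i) → s.card ≤ m + 1

def CD (X : Type*) [MetricSpace X] (m : ℕ) : Prop :=
  ∀ ε > 0, ∃ (N : ℕ) (U : Fin N → Set X), Cov X m ε U

theorem Cov.fin [CompactSpace X] {ι : Type*} {m : ℕ} {ε : ℝ} {U : ι → Set X} (h : Cov X m ε U) :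
    ∃ (N : ℕ) (U : Fin N → Set X), Cov X m ε U := by
  classical
  obtain ⟨t, ht⟩ := isCompact_univ.elim_finite_subcover U h.op (fun x _ => by
    obtain ⟨i, hi⟩ := h.cov x
    exact mem_iUnion.2 ⟨i, hi⟩)
  refine ⟨t.card, fun i => U (t.equivFin.symm i), fun i => h.op _, fun x => ?_,
    fun i => h.mesh _, fun x s hs => ?_⟩
  · have := ht (mem_univ x)
    simp only [mem_iUnion] at this
    obtain ⟨i, hi, hx⟩ := this
    exact ⟨t.equivFin ⟨i, hi⟩, by simpa using hx⟩
  · have := h.ord x (s.image fun i => (t.equivFin.symm i : ι)) (by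
      intro i hi
      obtain ⟨j, hj, rfl⟩ := Finset.mem_image.1 hi
      exact hs j hj)
    rwa [Finset.card_image_of_injective] at this
    intro i j hij
    exact t.equivFin.symm.injective (Subtype.ext hij)

/-- Lebesgue labels -/
theorem Cov.label [CompactSpace X] {ι : Type*} {m : ℕ} {ε : ℝ} {U : ι → Set X} (h : Cov X m ε U) :
    ∃ δ > 0, ∃ lam : X → ι, ∀ x y, dist x y ≤ δ → y ∈ U (lam x) := by
  obtain ⟨δ, hδ, H⟩ := lebesgue_number_lemma_of_metric isCompact_univ h.op (fun x _ => by
    obtain ⟨i, hi⟩ := h.cov x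
    exact mem_iUnion.2 ⟨i, hi⟩)
  choose lam hlam using fun x => H x (mem_univ x)
  refine ⟨δ / 2, by positivity, lam, fun x y hxy => hlam x ?_⟩
  rw [Metric.mem_ball, dist_comm]; linarith

theorem CD.hd [CompactSpace X] {m : ℕ} (h : CD X m) : HD ℤ X m := by
  classical
  intro ε hε
  by_cases hX : Nonempty X
  swap
  · refine ⟨1, one_pos, 0, fun l => by simp, fun l _ hl => ?_⟩
    rcases l with _ | ⟨x, l⟩
    · simp at hl
    · exact absurd ⟨x⟩ hX
  obtain ⟨x0⟩ := hX
  obtain ⟨N, U, hU⟩ := h ε hε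
  obtain ⟨δ, hδ, lam, hlam⟩ := hU.label
  have hp : ∀ a, ∃ p, ∀ x, lam x = a → dist x p ≤ ε := by
    intro a
    by_cases ha : ∃ y, lam y = a
    · obtain ⟨y, rfl⟩ := ha
      refine ⟨y, fun x hx => hU.mesh (lam y) _ ?_ _ (hlam y y (by simp [hδ.le]))⟩
      rw [← hx]
      exact hlam x x (by simp [hδ.le])
    · exact ⟨x0, fun x hx => absurd ⟨x, hx⟩ ha⟩
  choose p hp using hp
  have hq : ∀ S : Finset (Fin N), ∃ a, S.Nonempty → a ∈ S := by
    intro S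
    by_cases hS : S.Nonempty
    · obtain ⟨a, ha⟩ := hS; exact ⟨a, fun _ => ha⟩
    · exact ⟨lam x0, fun h => absurd h hS⟩
  choose q hq using hq
  obtain ⟨Φ, hΦ⟩ := list_rec (R := ℤ) (X := Fin N) (fun L u =>
    if L = [] then (single [] 1 : Ch ℤ X) else cns (p (q L.toFinset)) u)
  have hdl : ∀ c, dl (Φ c) = Φ (dl c) := by
    have : dl ∘ₗ Φ = Φ ∘ₗ dl := by
      refine lin_ind fun L hL => ?_
      simp only [LinearMap.comp_apply, dl_single, dl_bd, map_zero] at hL ⊢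
      rw [hΦ]
      split_ifs with h0
      · subst h0; simp
      · rw [dl_cns, hL]; simp
    exact fun c => LinearMap.congr_fun this c
  have hPM : PM (fun L y => ∃ a ∈ L, y = p a) 0 Φ := by
    have key : ∀ n, ∀ L : List (Fin N), L.length = n → Φ (single L 1) ∈ supported ℤ ℤ
        {k | k.length = L.length + 0 ∧ ∀ y ∈ k, ∃ a ∈ L, y = p a} := by
      intro n
      induction n with
      | zero =>
        intro L hL
        have := List.eq_nil_of_length_eq_zero hL
        subst this
        rw [hΦ, if_pos rfl]
        exact sg_mem (by simp)
      | succ n ih =>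
        intro L hL
        have hL0 : L ≠ [] := by rintro rfl; simp at hL
        rw [hΦ, if_neg hL0]
        have : Φ (bd L) ∈ supported ℤ ℤ {k | k.length + 1 = L.length ∧ ∀ y ∈ k, ∃ a ∈ L, y = p a} := by
          refine mem_of_supp ?_ (bd_mem L)
          rintro m ⟨m1, m2⟩
          refine sup_mono ?_ (ih m (by omega))
          rintro k ⟨k1, k2⟩
          refine ⟨by omega, fun y hy => ?_⟩
          obtain ⟨a, ha, rfl⟩ := k2 y hy
          exact ⟨a, m2.subset ha, rfl⟩
        refine cns_mem ?_ this
        rintro k ⟨k1, k2⟩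
        refine ⟨by simpa using k1, fun y hy => ?_⟩
        rcases List.mem_cons.1 hy with rfl | hy
        · exact ⟨_, List.mem_toFinset.1 (hq L.toFinset (by simpa using hL0)), rfl⟩
        · exact k2 y hy
    exact fun L => key _ L rfl
  have hAlt : ∀ k, Alt k Φ := by
    intro k
    induction k using Nat.strong_induction_on with
    | _ k ih =>
    intro a x y b hab
    have hs : (a ++ y :: x :: b).toFinset = (a ++ x :: y :: b).toFinset := by
      ext t; simp; tauto
    rw [hΦ, hΦ, if_neg (by simp), if_neg (by simp), hs, ← map_add]
    have : Φ (bd (a ++ x :: y :: b)) + Φ (bd (a ++ y :: x :: b)) = 0 := by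
      rcases k with _ | k
      · have hu : a = [] := List.eq_nil_of_length_eq_zero (by omega)
        have hw' : b = [] := List.eq_nil_of_length_eq_zero (by omega)
        subst hu hw'
        simp [bd_cons]
      · exact Alt.bd (k := k) a (ih k (by omega)) x y b hab
    rw [this, map_zero]
  obtain ⟨s, s1, s2, s3⟩ := cone_homotopy (Φ ∘ₗ mp lam) LinearMap.id
    (fun c => by simp [hdl, dl_mp]) (fun c => rfl) (by simp [hΦ]) (fun l => l.headD x0) (nr ε)
    (fun l k y h => nr.mono le_rfl h.subset)
    (by
      rintro (_ | ⟨x, l⟩) h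
      · exact absurd rfl h
      · exact ⟨x, by simp, by simp [hε.le]⟩)
    (by
      intro l
      rw [LinearMap.comp_apply, mp_single]
      refine sup_mono ?_ (hPM _)
      rintro k ⟨k1, k2⟩
      refine ⟨by simpa using k1, fun y hy => ?_⟩
      obtain ⟨a, ha, rfl⟩ := k2 y hy
      obtain ⟨x, hx, rfl⟩ := List.mem_map.1 ha
      exact ⟨x, hx, hp _ x rfl⟩)
    (by
      exact RM.id fun l => ⟨rfl, fun y hy => ⟨y, hy, by simp [hε.le]⟩⟩)
  refine ⟨δ, hδ, s, s3, fun l hl hlen => ?_⟩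
  have := s1 (single l 1)
  rw [dl_single] at this
  rw [this, LinearMap.comp_apply, mp_single, Alt.dup (hAlt (l.length - 2)), sub_zero]; rfl
  · intro c hc
    ext t
    have := DFunLike.congr_fun hc t
    simp only [coe_add, Pi.add_apply, coe_zero, Pi.zero_apply] at this ⊢
    omega
  · intro hnd
    rcases l with _ | ⟨x, l⟩
    · simp at hlen
    have := hU.ord x ((x :: l).map lam).toFinset (by
      intro i hi
      rw [List.mem_toFinset, List.mem_map] at hi
      obtain ⟨y, hy, rfl⟩ := hi
      exact hlam y x (hl y hy x (by simp)))
    rw [List.toFinset_card_of_nodup hnd] at this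
    simp only [List.length_map] at this
    omega
  · simp only [List.length_map]; omega

/-- zero-dimensionality from homological dimension -/
theorem HD.cd_zero {R : Type*} [CommRing R] [Nontrivial R] [CompactSpace X] (h : HD R X 0) :
    CD X 0 := by
  classical
  intro ε hε
  obtain ⟨δ, hδ, s, hs, hs'⟩ := h (ε / 4) (by positivity)
  let r : X → X → Prop := fun x y => dist x y ≤ δ
  have hinv : ∀ (χ : Ch R X →ₗ[R] R) (x y : X), Relation.EqvGen r x y →
      χ (single [x] 1) - χ (dl (s (single [x] 1))) =
        χ (single [y] 1) - χ (dl (s (single [y] 1))) := by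
    intro χ x y hxy
    induction hxy with
    | rel x y hxy =>
      have h1 := hs' [x, y] (by
        intro a ha b hb
        have : dist y x ≤ δ := by rw [dist_comm]; exact hxy
        simp only [List.mem_cons, List.not_mem_nil, or_false] at ha hb
        rcases ha with rfl | rfl <;> rcases hb with rfl | rfl <;>
          first | assumption | simp [hδ.le]) (by simp)
      have h2 := congrArg (fun c => χ (dl c)) h1
      simp only [map_add, dl_dl, map_zero, zero_add, dl_single, bd_cons, bd_nil, map_sub,
        cns_single, sub_zero] at h2
      linear_combination h2
    | refl x => rfl
    | symm x y _ ih => exact ih.symm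
    | trans x y z _ _ h1 h2 => exact h1.trans h2
  have hdist : ∀ x y, Relation.EqvGen r x y → dist x y ≤ ε / 2 := by
    intro x y hxy
    by_contra hlt
    push Not at hlt
    let χ : Ch R X →ₗ[R] R := linearCombination R fun l =>
      if ∃ y ∈ l, dist x y ≤ ε / 4 then 1 else 0
    have hχ : ∀ l, χ (single l 1) = if ∃ y ∈ l, dist x y ≤ ε / 4 then 1 else 0 := by
      intro l; simp [χ]
    have e := hinv χ x y hxy
    have h1 : χ (dl (s (single [x] 1))) = 0 := by
      refine zero_of_supp (f := χ ∘ₗ dl) ?_ (hs [x])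
      rintro k ⟨k1, k2⟩
      simp only [List.length_cons, List.length_nil] at k1
      match k, k1 with
      | [a, b], _ =>
        have ha : dist x a ≤ ε / 4 := by simpa [nr] using k2 a (by simp)
        have hb : dist x b ≤ ε / 4 := by simpa [nr] using k2 b (by simp)
        simp [bd_cons, hχ, ha, hb]
    have h2 : χ (dl (s (single [y] 1))) = 0 := by
      refine zero_of_supp (f := χ ∘ₗ dl) ?_ (hs [y])
      rintro k ⟨k1, k2⟩
      simp only [List.length_cons, List.length_nil] at k1
      match k, k1 with
      | [a, b], _ =>
        have ha : dist y a ≤ ε / 4 := by simpa [nr] using k2 a (by simp)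
        have hb : dist y b ≤ ε / 4 := by simpa [nr] using k2 b (by simp)
        have ha' : ¬ dist x a ≤ ε / 4 := fun h => by
          have := dist_triangle x a y; rw [dist_comm a y] at this; linarith
        have hb' : ¬ dist x b ≤ ε / 4 := fun h => by
          have := dist_triangle x b y; rw [dist_comm b y] at this; linarith
        simp [bd_cons, hχ, ha', hb']
    rw [h1, h2, hχ, hχ, if_pos ⟨x, by simp, by rw [dist_self]; positivity⟩,
      if_neg (by simp; linarith)] at e
    simp at e
  let S : Setoid X := Relation.EqvGen.setoid r
  refine Cov.fin (ι := Quotient S) (U := fun q => {x | Quotient.mk S x = q}) ⟨?_, ?_, ?_, ?_⟩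
  · intro q
    rw [Metric.isOpen_iff]
    rintro x rfl
    refine ⟨δ, hδ, fun y hy => ?_⟩
    exact Quotient.sound (Relation.EqvGen.rel _ _ (le_of_lt hy))
  · exact fun x => ⟨Quotient.mk S x, rfl⟩
  · rintro q x rfl y hy
    have := hdist _ _ (Quotient.exact hy)
    rw [dist_comm]; linarith
  · intro x s hs
    rw [zero_add, Finset.card_le_one]
    intro a ha b hb
    exact (hs a ha).symm.trans (hs b hb)

theorem CD.mono {m m' : ℕ} (h : m ≤ m') (hX : CD X m) : CD X m' := by
  intro ε hε
  obtain ⟨N, U, h1, h2, h3, h4⟩ := hX ε hε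
  exact ⟨N, U, h1, h2, h3, fun x s hs => (h4 x s hs).trans (by omega)⟩

theorem CD.prod [CompactSpace X] [CompactSpace Y] {a b : ℕ} (hX : CD X a) (hY : CD Y b) :
    CD (X × Y) ((a + 1) * (b + 1) - 1) := by
  classical
  intro ε hε
  obtain ⟨N, U, hU⟩ := hX ε hε
  obtain ⟨M, V, hV⟩ := hY ε hε
  refine Cov.fin (ι := Fin N × Fin M) (U := fun i => U i.1 ×ˢ V i.2) ⟨?_, ?_, ?_, ?_⟩
  · exact fun i => (hU.op _).prod (hV.op _)
  · rintro ⟨x, y⟩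
    obtain ⟨i, hi⟩ := hU.cov x
    obtain ⟨j, hj⟩ := hV.cov y
    exact ⟨(i, j), hi, hj⟩
  · rintro ⟨i, j⟩ x ⟨hx1, hx2⟩ y ⟨hy1, hy2⟩
    rw [Prod.dist_eq]
    exact max_le (hU.mesh i _ hx1 _ hy1) (hV.mesh j _ hx2 _ hy2)
  · rintro ⟨x, y⟩ s hs
    have h1 := hU.ord x (s.image Prod.fst) (by
      intro i hi
      obtain ⟨j, hj, rfl⟩ := Finset.mem_image.1 hi
      exact (hs j hj).1)
    have h2 := hV.ord y (s.image Prod.snd) (by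
      intro i hi
      obtain ⟨j, hj, rfl⟩ := Finset.mem_image.1 hi
      exact (hs j hj).2)
    have h3 : s ⊆ s.image Prod.fst ×ˢ s.image Prod.snd := by
      intro i hi
      rw [Finset.mem_product]
      exact ⟨Finset.mem_image_of_mem _ hi, Finset.mem_image_of_mem _ hi⟩
    have h4 := Finset.card_le_card h3
    rw [Finset.card_product] at h4
    have h5 := Nat.mul_le_mul h1 h2
    have : 0 < (a + 1) * (b + 1) := by positivity
    omega

theorem CD.congr {m : ℕ} (hX : CD X m) (e : Y ≃ᵢ X) : CD Y m := by
  intro ε hε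
  obtain ⟨N, U, h1, h2, h3, h4⟩ := hX ε hε
  refine ⟨N, fun i => e ⁻¹' U i, fun i => (h1 i).preimage e.continuous, fun x => h2 (e x), ?_,
    fun x s hs => h4 (e x) s hs⟩
  intro i x hx y hy
  rw [← e.dist_eq]
  exact h3 i _ hx _ hy

theorem HD.congr {R : Type*} [CommRing R] {m : ℕ} (hX : HD R X m) (e : Y ≃ᵢ X) : HD R Y m := by
  intro ε hε
  obtain ⟨δ, hδ, s, h1, h2⟩ := hX ε hε
  refine ⟨δ, hδ, mp e.symm ∘ₗ s ∘ₗ mp e, ?_, ?_⟩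
  · intro l
    rw [LinearMap.comp_apply, LinearMap.comp_apply, mp_single]
    refine mem_of_supp (f := mp e.symm) ?_ (h1 _)
    rintro k ⟨k1, k2⟩
    rw [mp_single]
    refine sg_mem ⟨by simpa using k1, ?_⟩
    intro y hy
    obtain ⟨x, hx, rfl⟩ := List.mem_map.1 hy
    obtain ⟨w, hw, hwx⟩ := k2 x hx
    obtain ⟨v, hv, rfl⟩ := List.mem_map.1 hw
    refine ⟨v, hv, ?_⟩
    rw [← e.dist_eq]; simpa using hwx
  · intro l hl hlen
    have := h2 (l.map e) (by
      intro x hx y hy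
      obtain ⟨x, hx', rfl⟩ := List.mem_map.1 hx
      obtain ⟨y, hy', rfl⟩ := List.mem_map.1 hy
      rw [e.dist_eq]
      exact hl x hx' y hy') (by simpa using hlen)
    have := congrArg (mp e.symm) this
    rw [map_add, mp_single, bd_map, ← dl_mp] at this
    simp only [LinearMap.comp_apply, mp_single]
    rw [this, List.map_map]
    have : (e.symm ∘ e : Y → Y) = id := by ext y; simp
    rw [this, List.map_id]

end CD

section bridge
open MeanDimPaper
variable {X : Type*} [MetricSpace X] [CompactSpace X]

theorem topDim_le_iff (m : ℕ) : topDim X ≤ m ↔ CD X m := by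
  classical
  constructor
  · intro h ε hε
    let α : Set (Set X) := range fun x : X => Metric.ball x (ε / 2)
    have hα : IsOpenCover α := by
      refine ⟨?_, ?_⟩
      · rintro U ⟨x, rfl⟩; exact Metric.isOpen_ball
      · refine eq_univ_of_forall fun x => ⟨_, ⟨x, rfl⟩, Metric.mem_ball_self (by positivity)⟩
    have h1 : covD α ≤ m := (le_iSup₂ (f := fun α (_ : α ∈ {α : Set (Set X) | IsOpenCover α}) =>
      covD α) α hα).trans h
    have h2 : covD α < (m + 1 : ℕ) := lt_of_le_of_lt h1 (by exact_mod_cast Nat.lt_succ_self m)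
    unfold covD at h2
    simp only [iInf_lt_iff] at h2
    obtain ⟨β, ⟨hβ1, hβ2⟩, hβ3⟩ := h2
    refine Cov.fin (ι := β) (U := fun i => i.1) ⟨fun i => hβ1.1 _ i.2, fun x => ?_, ?_, ?_⟩
    · have : x ∈ ⋃₀ β := by rw [hβ1.2]; trivial
      obtain ⟨U, hU, hx⟩ := this
      exact ⟨⟨U, hU⟩, hx⟩
    · rintro ⟨V, hV⟩ x hx y hy
      obtain ⟨_, ⟨w, rfl⟩, hw⟩ := hβ2 V hV
      have := hw hx
      have := hw hy
      simp only [Metric.mem_ball] at *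
      have := dist_triangle_right x y w
      linarith
    · intro x s hs
      by_contra hlt
      push Not at hlt
      have : ((s.card - 1 : ℕ) : ℕ∞) ≤ MeanDimPaper.ord β := by
        refine le_iSup₂ (f := fun (n : ℕ) (_ : n ∈ {n : ℕ | ∃ f : Fin (n + 1) → Set X,
          Function.Injective f ∧ (∀ i, f i ∈ β) ∧ (⋂ i, f i).Nonempty}) => (n : ℕ∞)) _ ?_
        refine ⟨fun i => (s.equivFin.symm ⟨i.1, by omega⟩).1.1, ?_, ?_, x, ?_⟩
        · intro i j hij
          have := s.equivFin.symm.injective (Subtype.ext (Subtype.ext hij))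
          simpa [Fin.ext_iff] using this
        · intro i; exact (s.equivFin.symm ⟨i.1, by omega⟩).1.2
        · rw [mem_iInter]
          intro i
          exact hs _ (s.equivFin.symm ⟨i.1, by omega⟩).2
      have h3 := this.trans_lt hβ3
      have : s.card - 1 < m + 1 := by exact_mod_cast h3
      omega
  · intro h
    refine iSup₂_le fun α hα => ?_
    have hα : IsOpenCover α := hα
    obtain ⟨δ, hδ, H⟩ := lebesgue_number_lemma_of_metric_sUnion (isCompact_univ (X := X)) hα.1
      (by rw [hα.2])
    obtain ⟨N, U, hU⟩ := h (δ / 2) (by positivity)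
    refine (iInf₂_le (f := fun β (_ : β ∈ {β : Set (Set X) | IsOpenCover β ∧ Refines β α}) =>
      MeanDimPaper.ord β) {V | ∃ i, V = U i ∧ (U i).Nonempty} ⟨⟨?_, ?_⟩, ?_⟩).trans ?_
    · rintro V ⟨i, rfl, -⟩; exact hU.op i
    · refine eq_univ_of_forall fun x => ?_
      obtain ⟨i, hi⟩ := hU.cov x
      exact ⟨U i, ⟨i, rfl, x, hi⟩, hi⟩
    · rintro V ⟨i, rfl, x, hx⟩
      obtain ⟨W, hW, hxW⟩ := H x (mem_univ x)
      refine ⟨W, hW, fun y hy => hxW ?_⟩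
      have := hU.mesh i y hy x hx
      rw [Metric.mem_ball]; linarith
    · refine iSup₂_le fun n hn => ?_
      obtain ⟨f, hf1, hf2, x, hx⟩ := hn
      choose g hg hg' using hf2
      have hgi : Function.Injective g := by
        intro i j hij
        apply hf1
        rw [hg, hg, hij]
      have := hU.ord x (Finset.univ.image g) (by
        intro i hi
        obtain ⟨j, -, rfl⟩ := Finset.mem_image.1 hi
        rw [← hg]
        exact mem_iInter.1 hx j)
      rw [Finset.card_image_of_injective _ hgi, Finset.card_univ, Fintype.card_fin] at this
      exact_mod_cast Nat.le_of_succ_le_succ this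

end bridge
end TD

open Filter Set
open scoped ENNReal
set_option linter.unusedSectionVars false
set_option linter.unusedVariables false

namespace TD

section comb

def sa (j p : ℕ) : ℕ := if p < j then p else p + 1

def t3 (x y z : ℤ) (p : ℕ) : ℤ := if p = 0 then x else if p = 1 then y else if p = 2 then z else 0

def dg (x : ℤ) (p q : ℕ) : ℤ := if q = p ∨ q = p + 1 then x else 0

def sy (A : ℕ → ℕ → ℤ) (i j : ℕ) : ℤ := A (min i j) (max i j)

theorem sy_comm (A : ℕ → ℕ → ℤ) (i j : ℕ) : sy A i j = sy A j i := by
  unfold sy; rw [min_comm, max_comm]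

theorem sy_sa (A : ℕ → ℕ → ℤ) (j i : ℕ) :
    sy A j (sa j i) = if i < j then A i j else A j (i + 1) := by
  unfold sy sa
  split_ifs with h
  · rw [min_eq_right h.le, max_eq_left h.le]
  · rw [min_eq_left (by omega), max_eq_right (by omega)]

/-- axioms for fillable tuples of integers -/
structure FillAx (d : ℕ) (Z : (ℕ → ℤ) → Prop) : Prop where
  hd : 2 ≤ d
  ext : ∀ t t' : ℕ → ℤ, (∀ p, p < d + 1 → t p = t' p) → Z t → Z t'
  kan : ∀ A : ℕ → ℕ → ℤ, ∀ k < d + 2, (∀ j < d + 2, j ≠ k → Z fun p => sy A j (sa j p)) →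
    Z fun p => sy A k (sa k p)
  deg : ∀ x, ∀ p < d, Z (dg x p)
  one : ∀ n, Z (t3 1 (n + 1) n)

variable {d : ℕ} {Z : (ℕ → ℤ) → Prop}

def blk (p q r : ℤ) (u v : ℕ) : ℤ :=
  if u = 0 ∧ v = 1 then p else if u = 0 ∧ v = 2 then p + q else if u = 0 ∧ v = 3 then q else
  if u = 1 ∧ v = 2 then p + q + r else if u = 1 ∧ v = 3 then q + r else if u = 2 ∧ v = 3 then r
  else 0

theorem blk0 (p q r : ℤ) : (fun i => sy (blk p q r) 0 (sa 0 i)) = t3 p (p + q) q := by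
  ext i; rw [sy_sa]; unfold blk t3; grind (splits := 30)
theorem blk1 (p q r : ℤ) : (fun i => sy (blk p q r) 1 (sa 1 i)) = t3 p (p + q + r) (q + r) := by
  ext i; rw [sy_sa]; unfold blk t3; grind (splits := 30)
theorem blk2 (p q r : ℤ) : (fun i => sy (blk p q r) 2 (sa 2 i)) = t3 (p + q) (p + q + r) r := by
  ext i; rw [sy_sa]; unfold blk t3; grind (splits := 30)
theorem blk3 (p q r : ℤ) : (fun i => sy (blk p q r) 3 (sa 3 i)) = t3 q (q + r) r := by
  ext i; rw [sy_sa]; unfold blk t3; grind (splits := 30)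
theorem blk4 (p q r : ℤ) (j : ℕ) (hj : 4 ≤ j) : (fun i => sy (blk p q r) j (sa j i)) = dg 0 0 := by
  ext i; rw [sy_sa]; unfold blk dg; grind (splits := 30)

theorem FillAx.three (h : FillAx d Z) (a n : ℤ) : Z (t3 a (a + n) n) := by
  have hd := h.hd
  have z0 : Z (dg 0 0) := h.deg 0 0 (by omega)
  have up : ∀ q r : ℤ, Z (t3 q (q + r) r) → Z (t3 (1 + q) (1 + q + r) r) := by
    intro q r hq
    rw [← blk2]
    refine h.kan _ 2 (by omega) fun j hj hj2 => ?_
    rcases lt_or_ge j 4 with h4 | h4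
    · interval_cases j
      · rw [blk0, add_comm 1 q]; exact h.one q
      · rw [blk1]; convert h.one (q + r) using 2; ring
      · exact absurd rfl hj2
      · rw [blk3]; exact hq
    · rw [blk4 _ _ _ _ h4]; exact z0
  have dn : ∀ q r : ℤ, Z (t3 (1 + q) (1 + q + r) r) → Z (t3 q (q + r) r) := by
    intro q r hq
    rcases Nat.lt_or_ge 2 d with hd3 | hd3
    all_goals
      rw [← blk3 1 q r]
      refine h.kan _ 3 (by omega) fun j hj hj2 => ?_
      rcases lt_or_ge j 4 with h4 | h4
      · interval_cases j
        · rw [blk0, add_comm 1 q]; exact h.one q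
        · rw [blk1]; convert h.one (q + r) using 2; ring
        · rw [blk2]; exact hq
        · exact absurd rfl hj2
      · rw [blk4 _ _ _ _ h4]; exact z0
  induction a using Int.induction_on with
  | zero =>
    refine h.ext (dg n 1) _ (fun p _ => ?_) (h.deg n 1 (by omega))
    unfold dg t3; grind
  | succ a ih => rw [add_comm (a : ℤ) 1]; exact up _ _ ih
  | pred a ih =>
    refine dn _ _ ?_
    convert ih using 2 <;> ring

def ar1 (t : ℕ → ℤ) (u v : ℕ) : ℤ :=
  if u = 0 ∧ v = 1 then - t 1 else if u = 0 ∧ v = 2 then t 0 - t 1 else if u = 0 ∧ v = 3 then t 0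
  else if u = 1 ∧ v = 2 then 0 else if u = 1 ∧ v = 3 then t 1 else
  if u = 2 ∧ v = 3 then t 2 else if (u = 2 ∨ u = 3) ∧ 4 ≤ v then t (v - 1) else 0

def red1 (t : ℕ → ℤ) (p : ℕ) : ℤ := if p = 0 then t 0 - t 1 else if p = 1 then 0 else t p

theorem FillAx.step1 (h : FillAx d Z) (hd3 : 3 ≤ d) (t : ℕ → ℤ) (ht : Z (red1 t)) : Z t := by
  have hd := h.hd
  have e3 : (fun i => sy (ar1 t) 3 (sa 3 i)) = t := by
    ext i; unfold sy sa ar1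
    rcases lt_or_ge i 3 with h | h
    · interval_cases i <;> simp
    · have : ¬ i < 3 := by omega
      simp only [this, if_false, min_eq_left (show 3 ≤ i + 1 by omega),
        max_eq_right (show 3 ≤ i + 1 by omega)]
      simp [show 4 ≤ i + 1 by omega]
  rw [← e3]
  refine h.kan _ 3 (by omega) fun j hj hj3 => ?_
  rcases lt_or_ge j 4 with h4 | h4
  · interval_cases j
    · convert h.three (-t 1) (t 0) using 1
      ext i; rw [sy_sa]; unfold ar1 t3; grind (splits := 30)
    · convert h.three (-t 1) (t 1) using 1
      ext i; rw [sy_sa]; unfold ar1 t3; grind (splits := 30)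
    · convert ht using 1
      ext i; unfold sy sa ar1 red1
      rcases lt_or_ge i 3 with h | h
      · interval_cases i <;> simp
      · have : ¬ i < 2 := by omega
        simp only [this, if_false, min_eq_left (show 2 ≤ i + 1 by omega),
          max_eq_right (show 2 ≤ i + 1 by omega)]
        simp [show 4 ≤ i + 1 by omega, show i ≠ 0 by omega, show i ≠ 1 by omega,
          show i ≠ 2 by omega]
    · exact absurd rfl hj3
  · convert h.deg (t (j - 1)) 2 (by omega) using 1
    ext i; rw [sy_sa]; unfold ar1 dg
    grind (splits := 30)

def ar2 (t : ℕ → ℤ) (q : ℕ) (u v : ℕ) : ℤ :=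
  if u = 0 ∧ v = 1 then t 0 else if u = 0 then
    (if v = q + 1 then 0 else if v = q then t (q - 1) - t q else t (v - 1)) else
  if u = 1 then t (v - 1) else if u = 2 ∧ (v = q ∨ v = q + 1) then t q else 0

def red2 (t : ℕ → ℤ) (q : ℕ) (p : ℕ) : ℤ :=
  if p = q then 0 else if p + 1 = q then t p - t q else t p

theorem FillAx.step2 (h : FillAx d Z) (t : ℕ → ℤ) {q : ℕ} (hq : 3 ≤ q) (hqd : q ≤ d)
    (h1 : t 1 = 0) (ht : Z (red2 t q)) : Z t := by
  have hd := h.hd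
  have e3 : (fun i => sy (ar2 t q) 1 (sa 1 i)) = t := by
    ext i; unfold sy sa ar2
    rcases lt_or_ge i 1 with h | h
    · interval_cases i; simp
    · have : ¬ i < 1 := by omega
      simp only [this, if_false, min_eq_left (show 1 ≤ i + 1 by omega),
        max_eq_right (show 1 ≤ i + 1 by omega)]
      simp
  rw [← e3]
  refine h.kan _ 1 (by omega) fun j hj hj3 => ?_
  rcases lt_or_ge j 3 with h4 | h4
  · interval_cases j
    · convert ht using 1
      ext i; unfold sy sa ar2 red2
      rcases lt_or_ge i 1 with h | h
      · interval_cases i; simp [show 0 ≠ q by omega, show 1 ≠ q by omega]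
      · simp only [Nat.not_lt_zero, if_false, min_eq_left (Nat.zero_le _),
          max_eq_right (Nat.zero_le _)]
        by_cases c1 : i = q
        · subst c1; simp [show i ≠ 0 by omega]
        · by_cases c2 : i + 1 = q
          · subst c2; simp [show i ≠ 0 by omega]
          · simp [c1, c2, show i ≠ 0 by omega]
    · exact absurd rfl hj3
    · convert h.deg (t q) (q - 1) (by omega) using 1
      ext i; rw [sy_sa]; unfold ar2 dg
      grind (splits := 30)
  · by_cases c1 : j = q + 1
    · subst c1
      convert h.deg (t q) 1 (by omega) using 1
      ext i; rw [sy_sa]; unfold ar2 dg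
      grind (splits := 30)
    · by_cases c2 : j = q
      · subst c2
        convert h.three (t (j - 1) - t j) (t j) using 1
        ext i; rw [sy_sa]; unfold ar2 t3
        grind (splits := 30)
      · convert h.deg (t (j - 1)) 0 (by omega) using 1
        ext i; rw [sy_sa]; unfold ar2 dg
        grind (splits := 30)

def als (d : ℕ) (t : ℕ → ℤ) : ℤ := ∑ p ∈ Finset.range (d + 1), (-1) ^ p * t p

theorem als_eq (d : ℕ) (t s : ℕ → ℤ) (q : ℕ) (x : ℤ) (hq : q + 1 < d + 1)
    (h : ∀ p, t p = s p + (if p = q then x else 0) + (if p = q + 1 then x else 0)) :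
    als d t = als d s := by
  unfold als
  have : ∀ p, (-1 : ℤ) ^ p * t p = (-1) ^ p * s p + (if p = q then (-1) ^ q * x else 0) +
      (if p = q + 1 then (-1) ^ (q + 1) * x else 0) := by
    intro p; rw [h]
    split_ifs with h1 h2 h2
    · omega
    · subst h1; ring
    · subst h2; ring
    · ring
  simp only [this, Finset.sum_add_distrib, Finset.sum_ite_eq', Finset.mem_range]
  rw [if_pos (by omega), if_pos hq]
  ring

theorem FillAx.all (h : FillAx d Z) (t : ℕ → ℤ) (ht : als d t = 0) : Z t := by
  have hd := h.hd
  have key : ∀ q, q ≤ d → ∀ t : ℕ → ℤ, t 1 = 0 → (∀ p, q < p → p < d + 1 → t p = 0) → als d t = 0 →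
      Z t := by
    intro q
    induction q with
    | zero =>
      intro _ t h1 h2 h3
      have h0 : t 0 = 0 := by
        unfold als at h3
        rw [Finset.sum_range_succ', Finset.sum_eq_zero] at h3
        · simpa using h3
        · intro i hi; rw [h2 _ (by omega) (by simp at hi; omega)]; simp
      refine h.ext (dg 0 0) _ (fun p hp => ?_) (h.deg 0 0 (by omega))
      unfold dg
      rcases p with _ | p
      · simp [h0]
      · rw [h2 _ (by omega) hp]; simp
    | succ q ih =>
      intro hqd t h1 h2 h3
      by_cases hq : 2 ≤ q
      · refine h.step2 t (q := q + 1) (by omega) hqd h1 (ih (by omega) _ ?_ ?_ ?_)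
        · unfold red2; grind
        · intro p hp hp'; unfold red2; grind
        · rw [← h3]; symm
          refine als_eq d _ _ q (t (q + 1)) (by omega) fun p => ?_
          unfold red2; grind
      · have hs : t 0 + t 2 = 0 := by
          have : als d t = ∑ p ∈ Finset.range 3, (-1) ^ p * t p := by
            unfold als
            symm
            refine Finset.sum_subset (by intro x; simp; omega) ?_
            intro p hp hp'
            simp only [Finset.mem_range] at hp hp'
            rw [h2 p (by omega) hp]; simp
          rw [h3] at this
          simp [Finset.sum_range_succ, h1] at this
          exact this.symm
        refine h.ext (t3 (t 0) (t 0 + t 2) (t 2)) _ (fun p hp => ?_) (h.three _ _)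
        unfold t3; rw [hs]
        rcases p with _ | _ | _ | p
        · simp
        · simp [h1]
        · simp
        · rw [h2 _ (by omega) hp]; simp
  rcases Nat.lt_or_ge 2 d with h3 | h3
  · refine h.step1 h3 t (key d le_rfl _ ?_ ?_ ?_)
    · simp [red1]
    · intro p hp hp'; omega
    · rw [← ht]; symm
      refine als_eq d _ _ 0 (t 1) (by omega) fun p => ?_
      unfold red1; grind
  · have : d = 2 := by omega
    subst this
    simp [als, Finset.sum_range_succ] at ht
    refine h.ext (t3 (t 0) (t 0 + t 2) (t 2)) _ (fun p hp => ?_) (h.three _ _)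
    unfold t3
    interval_cases p
    · simp
    · simp; linarith
    · simp

end comb
end TD

open Filter Set
open scoped ENNReal
set_option linter.unusedSectionVars false
set_option linter.unusedVariables false

namespace TD

section kan

theorem glue {Y E ι : Type*} [TopologicalSpace Y] [TopologicalSpace E] [Finite ι] (b : E)
    (C : ι → Set Y) (f : ι → Y → E) (hC : ∀ i, IsClosed (C i))
    (hf : ∀ i, ContinuousOn (f i) (C i))
    (agree : ∀ i j x, x ∈ C i → x ∈ C j → f i x = f j x) :
    ∃ H : Y → E, (∀ i, ∀ x ∈ C i, H x = f i x) ∧ ContinuousOn H (⋃ i, C i) := by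
  classical
  have : ∀ x, ∃ y, ∀ i, x ∈ C i → y = f i x := by
    intro x
    by_cases h : ∃ i, x ∈ C i
    · obtain ⟨i, hi⟩ := h
      exact ⟨f i x, fun j hj => agree i j x hi hj⟩
    · exact ⟨b, fun i hi => absurd ⟨i, hi⟩ h⟩
  choose H hH using this
  refine ⟨H, fun i x hx => hH x i hx, ?_⟩
  refine LocallyFinite.continuousOn_iUnion (locallyFinite_of_finite _) hC fun i => ?_
  exact (hf i).congr fun x hx => hH x i hx

abbrev Dl (n : ℕ) : Set (Fin n → ℝ) := stdSimplex ℝ (Fin n)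

variable {E : Type*} [TopologicalSpace E] (S : Set E) (b : E)

def Good {Y : Type*} [TopologicalSpace Y] (G : Y → E) (D : Set Y) : Prop :=
  ContinuousOn G D ∧ MapsTo G D S

def Loop (d : ℕ) (f : (Fin d → ℝ) → E) : Prop :=
  Good S f (Dl d) ∧ ∀ x ∈ Dl d, ∀ p, x p = 0 → f x = b

def Fill (d : ℕ) (x : Fin (d + 1) → (Fin d → ℝ) → E) : Prop :=
  ∃ G, Good S G (Dl (d + 1)) ∧ ∀ y ∈ Dl (d + 1), ∀ p, y p = 0 → G y = x p (y ∘ p.succAbove)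

theorem face_mem {n : ℕ} {y : Fin (n + 1) → ℝ} (hy : y ∈ Dl (n + 1)) {p : Fin (n + 1)}
    (hp : y p = 0) : y ∘ p.succAbove ∈ Dl n := by
  refine ⟨fun i => hy.1 _, ?_⟩
  have := hy.2
  rw [Fin.sum_univ_succAbove _ p, hp, zero_add] at this
  exact this

theorem ins_mem {n : ℕ} {y : Fin n → ℝ} (hy : y ∈ Dl n) (p : Fin (n + 1)) :
    (p.insertNth (0 : ℝ) y : Fin (n + 1) → ℝ) ∈ Dl (n + 1) := by
  refine ⟨fun i => ?_, ?_⟩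
  · rcases Fin.eq_self_or_eq_succAbove p i with rfl | ⟨j, rfl⟩
    · simp
    · simpa using hy.1 j
  · rw [Fin.sum_univ_succAbove _ p]; simpa using hy.2

theorem ins_comp {n : ℕ} {y : Fin (n + 1) → ℝ} {p : Fin (n + 1)} (hp : y p = 0) :
    (p.insertNth (0 : ℝ) (y ∘ p.succAbove) : Fin (n + 1) → ℝ) = y := by
  ext i
  rcases Fin.eq_self_or_eq_succAbove p i with rfl | ⟨j, rfl⟩
  · simp [hp]
  · simp

theorem comp_ins {n : ℕ} (y : Fin n → ℝ) (p : Fin (n + 1)) :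
    (p.insertNth (0 : ℝ) y : Fin (n + 1) → ℝ) ∘ p.succAbove = y := by
  ext i; simp

theorem cont_ins {n : ℕ} (p : Fin (n + 1)) :
    Continuous fun y : Fin n → ℝ => (p.insertNth (0 : ℝ) y : Fin (n + 1) → ℝ) := by
  refine continuous_pi fun i => ?_
  rcases Fin.eq_self_or_eq_succAbove p i with rfl | ⟨j, rfl⟩
  · simp; fun_prop
  · simp; fun_prop

theorem cont_face {n : ℕ} (p : Fin (n + 1)) :
    Continuous fun y : Fin (n + 1) → ℝ => y ∘ p.succAbove := by
  refine continuous_pi fun i => ?_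
  simp only [Function.comp]; fun_prop

theorem isClosed_Dl (n : ℕ) : IsClosed (Dl n) := isClosed_stdSimplex ℝ (Fin n)

variable {S b}

theorem horn {n : ℕ} (k : Fin (n + 2)) (G : Fin (n + 2) → (Fin (n + 1) → ℝ) → E)
    (hG : ∀ j, j ≠ k → Good S (G j) (Dl (n + 1)))
    (hc : ∀ j l, j ≠ k → l ≠ k → ∀ y ∈ Dl (n + 2), y j = 0 → y l = 0 →
      G j (y ∘ j.succAbove) = G l (y ∘ l.succAbove)) :
    ∃ H, Good S H (Dl (n + 2)) ∧ ∀ y ∈ Dl (n + 2), ∀ j, j ≠ k → y j = 0 →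
      H y = G j (y ∘ j.succAbove) := by
  classical
  obtain ⟨b⟩ : Nonempty E := ⟨G k fun _ => 0⟩
  obtain ⟨H, hH, hHc⟩ := glue (ι := {j // j ≠ k}) b (fun j => Dl (n + 2) ∩ {y | y j.1 = 0})
    (fun j y => G j.1 (y ∘ j.1.succAbove))
    (fun j => (isClosed_Dl _).inter (isClosed_eq (continuous_apply _) continuous_const))
    (fun j => (hG j.1 j.2).1.comp (cont_face _).continuousOn fun y hy => face_mem hy.1 hy.2)
    (fun i j y hi hj => hc i.1 j.1 i.2 j.2 y hi.1 hi.2 hj.2)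
  let μ : (Fin (n + 2) → ℝ) → ℝ := fun y => Finset.univ.inf' Finset.univ_nonempty
    fun i : Fin (n + 1) => y (k.succAbove i)
  have hμc : Continuous μ := by
    refine Continuous.finset_inf'_apply _ fun i _ => ?_
    fun_prop
  have hμle : ∀ y i, μ y ≤ y (k.succAbove i) := fun y i =>
    Finset.inf'_le (f := fun i : Fin (n + 1) => y (k.succAbove i)) (Finset.mem_univ i)
  have hμ0 : ∀ y ∈ Dl (n + 2), 0 ≤ μ y := fun y hy => Finset.le_inf' _ _ fun i _ => hy.1 _
  have hμe : ∀ y, ∃ i, μ y = y (k.succAbove i) := fun y => by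
    obtain ⟨i, _, hi⟩ := Finset.exists_mem_eq_inf' Finset.univ_nonempty
      (fun i : Fin (n + 1) => y (k.succAbove i))
    exact ⟨i, hi⟩
  let r : (Fin (n + 2) → ℝ) → Fin (n + 2) → ℝ := fun y =>
    k.insertNth (y k + (n + 1) * μ y) fun i => y (k.succAbove i) - μ y
  have hrc : Continuous r := by
    refine continuous_pi fun i => ?_
    rcases Fin.eq_self_or_eq_succAbove k i with rfl | ⟨j, rfl⟩
    · simp only [r, Fin.insertNth_apply_same]; fun_prop
    · simp only [r, Fin.insertNth_apply_succAbove]; fun_prop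
  have hr : ∀ y ∈ Dl (n + 2), r y ∈ ⋃ j : {j // j ≠ k}, Dl (n + 2) ∩ {y | y j.1 = 0} := by
    intro y hy
    obtain ⟨i, hi⟩ := hμe y
    refine mem_iUnion.2 ⟨⟨k.succAbove i, Fin.succAbove_ne _ _⟩, ⟨fun j => ?_, ?_⟩, ?_⟩
    · rcases Fin.eq_self_or_eq_succAbove k j with rfl | ⟨j, rfl⟩
      · simp only [r, Fin.insertNth_apply_same]
        have := hμ0 y hy; have := hy.1 j; positivity
      · simp only [r, Fin.insertNth_apply_succAbove]; linarith [hμle y j]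
    · rw [Fin.sum_univ_succAbove _ k]
      have := hy.2
      rw [Fin.sum_univ_succAbove _ k] at this
      simp only [r, Fin.insertNth_apply_same, Fin.insertNth_apply_succAbove,
        Finset.sum_sub_distrib]
      simp
      linarith
    · show r y (k.succAbove i) = 0
      simp only [r, Fin.insertNth_apply_succAbove]; linarith
  refine ⟨H ∘ r, ⟨hHc.comp hrc.continuousOn hr, fun y hy => ?_⟩, fun y hy j hj h0 => ?_⟩
  · obtain ⟨j, hj⟩ := mem_iUnion.1 (hr y hy)
    show H (r y) ∈ S
    rw [hH j _ hj]
    exact (hG j.1 j.2).2 (face_mem hj.1 hj.2)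
  · have hm : μ y = 0 := by
      obtain ⟨i, rfl⟩ := Fin.exists_succAbove_eq hj
      have := hμle y i
      linarith [hμ0 y hy]
    have : r y = y := by
      ext i
      rcases Fin.eq_self_or_eq_succAbove k i with rfl | ⟨j, rfl⟩
      · simp only [r, Fin.insertNth_apply_same, hm]; ring
      · simp only [r, Fin.insertNth_apply_succAbove, hm]; ring
    show H (r y) = _
    rw [this]
    exact hH ⟨j, hj⟩ y ⟨hy, h0⟩

theorem succAbove_comm_comp {n : ℕ} {j l : Fin (n + 2)} {p q : Fin (n + 1)} (hl : j.succAbove p = l)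
    (hj : l.succAbove q = j) (y : Fin (n + 2) → ℝ) :
    (y ∘ j.succAbove) ∘ p.succAbove = (y ∘ l.succAbove) ∘ q.succAbove := by
  have : j.succAbove ∘ p.succAbove = l.succAbove ∘ q.succAbove := by
    refine (StrictMono.range_inj
      ((Fin.strictMono_succAbove j).comp (Fin.strictMono_succAbove p))
      ((Fin.strictMono_succAbove l).comp (Fin.strictMono_succAbove q))).1 ?_
    have key : ∀ (j l : Fin (n + 2)) (p : Fin (n + 1)), j.succAbove p = l →
        range (j.succAbove ∘ p.succAbove) = {j, l}ᶜ := by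
      intro j l p hl
      ext x
      simp only [mem_range, Function.comp, mem_compl_iff, mem_insert_iff, mem_singleton_iff, not_or]
      constructor
      · rintro ⟨i, rfl⟩
        refine ⟨Fin.succAbove_ne _ _, ?_⟩
        rw [← hl]
        intro h
        exact Fin.succAbove_ne _ _ (Fin.succAbove_right_injective h)
      · rintro ⟨h1, h2⟩
        obtain ⟨u, rfl⟩ := Fin.exists_succAbove_eq h1
        have : u ≠ p := fun h => h2 (by rw [h, hl])
        obtain ⟨w, rfl⟩ := Fin.exists_succAbove_eq this
        exact ⟨w, rfl⟩
    rw [key j l p hl, key l j q hj, pair_comm]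
  rw [Function.comp_assoc, this, ← Function.comp_assoc]

theorem kan_row {d : ℕ} (a : Fin (d + 2) → Fin (d + 2) → (Fin d → ℝ) → E)
    (hs : ∀ i j, a i j = a j i) (k : Fin (d + 2))
    (h : ∀ j, j ≠ k → Fill S d fun p => a j (j.succAbove p)) :
    Fill S d fun p => a k (k.succAbove p) := by
  classical
  have : ∀ j, ∃ G, j ≠ k → Good S G (Dl (d + 1)) ∧ ∀ y ∈ Dl (d + 1), ∀ p, y p = 0 →
      G y = a j (j.succAbove p) (y ∘ p.succAbove) := by
    intro j
    by_cases hj : j = k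
    · exact ⟨fun y => a j j (y ∘ Fin.succ), fun h => absurd hj h⟩
    · obtain ⟨G, hG⟩ := h j hj
      exact ⟨G, fun _ => hG⟩
  choose G hG using this
  obtain ⟨H, hH, hH'⟩ := horn k G (fun j hj => (hG j hj).1) (fun j l hj hl y hy h1 h2 => by
    by_cases hjl : j = l
    · subst hjl; rfl
    obtain ⟨p, hp⟩ := Fin.exists_succAbove_eq (Ne.symm hjl)
    obtain ⟨q, hq⟩ := Fin.exists_succAbove_eq hjl
    rw [(hG j hj).2 _ (face_mem hy h1) p (by simpa [hp] using h2),
      (hG l hl).2 _ (face_mem hy h2) q (by simpa [hq] using h1), hp, hq,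
      succAbove_comm_comp hp hq, hs])
  refine ⟨fun z => H (k.insertNth (0 : ℝ) z : Fin (d + 2) → ℝ),
    ⟨hH.1.comp (cont_ins k).continuousOn fun z hz => ins_mem hz k,
      fun z hz => hH.2 (ins_mem hz k)⟩, fun z hz p hp => ?_⟩
  set j := k.succAbove p with hj
  have hjk : j ≠ k := Fin.succAbove_ne _ _
  obtain ⟨q, hq⟩ := Fin.exists_succAbove_eq hjk.symm
  set y : Fin (d + 2) → ℝ := k.insertNth (0 : ℝ) z with hy
  have hyj : y j = 0 := by rw [hy, hj]; simpa using hp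
  have hyk : y k = 0 := by rw [hy]; simp
  have hym : y ∈ Dl (d + 2) := ins_mem hz k
  show H y = _
  rw [hH' y hym j hjk hyj, (hG j hjk).2 _ (face_mem hym hyj) q (by simpa [hq] using hyk), hq,
    succAbove_comm_comp hq hj.symm, hs, hy, comp_ins]

theorem face_create {d : ℕ} (x : Fin (d + 2) → (Fin (d + 1) → ℝ) → E) (k : Fin (d + 2))
    (hx : ∀ j, j ≠ k → Loop S b (d + 1) (x j)) :
    ∃ z, Loop S b (d + 1) z ∧ Fill S (d + 1) (Function.update x k z) := by
  classical
  have hb : ∀ j l, j ≠ k → l ≠ j → ∀ y ∈ Dl (d + 2), y j = 0 → y l = 0 →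
      x j (y ∘ j.succAbove) = b := by
    intro j l hj hl y hy h1 h2
    obtain ⟨p, hp⟩ := Fin.exists_succAbove_eq hl
    exact (hx j hj).2 _ (face_mem hy h1) p (by simpa [hp] using h2)
  obtain ⟨H, hH, hH'⟩ := horn k x (fun j hj => (hx j hj).1) (fun j l hj hl y hy h1 h2 => by
    by_cases hjl : j = l
    · subst hjl; rfl
    rw [hb j l hj (Ne.symm hjl) y hy h1 h2, hb l j hl hjl y hy h2 h1])
  refine ⟨fun z => H (k.insertNth (0 : ℝ) z : Fin (d + 2) → ℝ),
    ⟨⟨hH.1.comp (cont_ins k).continuousOn fun z hz => ins_mem hz k,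
      fun z hz => hH.2 (ins_mem hz k)⟩, fun z hz p hp => ?_⟩, H, hH, fun y hy p hp => ?_⟩
  · set y : Fin (d + 2) → ℝ := k.insertNth (0 : ℝ) z with hy
    show H y = b
    have h1 : y (k.succAbove p) = 0 := by rw [hy]; simpa using hp
    have hym : y ∈ Dl (d + 2) := ins_mem hz k
    rw [hH' y hym _ (Fin.succAbove_ne _ _) h1]
    exact hb _ k (Fin.succAbove_ne _ _) (Fin.succAbove_ne _ _).symm y hym h1 (by rw [hy]; simp)
  · by_cases hpk : p = k
    · subst hpk
      rw [Function.update_self, ins_comp hp]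
    · rw [Function.update_of_ne hpk]
      exact hH' y hy p hpk hp

theorem predAbove_fiber {d : ℕ} (p : Fin d) (q j : Fin (d + 1)) (hq : q ≠ p.castSucc ∧ q ≠ p.succ)
    (h : p.predAbove j = p.predAbove q) : j = q := by
  have key : ∀ j : Fin (d + 1), ((p.predAbove j : Fin d) : ℕ) =
      if (p : ℕ) < j then (j : ℕ) - 1 else j := by
    intro j
    unfold Fin.predAbove
    simp only [Fin.lt_def, Fin.val_castSucc]
    split_ifs <;> simp
  have h' := congrArg Fin.val h
  rw [key, key] at h'
  simp only [ne_eq, Fin.ext_iff, Fin.val_castSucc, Fin.val_succ] at hq ⊢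
  split_ifs at h' <;> omega

theorem predAbove_sect {d : ℕ} (p : Fin d) (q : Fin (d + 1)) (hq : q = p.castSucc ∨ q = p.succ)
    (i : Fin d) : p.predAbove (q.succAbove i) = i := by
  rw [Fin.ext_iff]
  have key : ∀ j : Fin (d + 1), ((p.predAbove j : Fin d) : ℕ) =
      if (p : ℕ) < j then (j : ℕ) - 1 else j := by
    intro j
    unfold Fin.predAbove
    simp only [Fin.lt_def, Fin.val_castSucc]
    split_ifs <;> simp
  have key2 : ((q.succAbove i : Fin _) : ℕ) = if (i : ℕ) < q then (i : ℕ) else i + 1 := by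
    unfold Fin.succAbove
    simp only [Fin.lt_def, Fin.val_castSucc]
    split_ifs <;> simp
  rw [key, key2]
  simp only [Fin.ext_iff, Fin.val_castSucc, Fin.val_succ] at hq
  split_ifs <;> omega

theorem degen {d : ℕ} (x : (Fin d → ℝ) → E) (hx : Loop S b d x) (p : Fin d) :
    Fill S d fun q => if q = p.castSucc ∨ q = p.succ then x else fun _ => b := by
  classical
  let σ : (Fin (d + 1) → ℝ) → Fin d → ℝ := fun y i =>
    ∑ j, if p.predAbove j = i then y j else 0
  have hσc : Continuous σ := by
    refine continuous_pi fun i => continuous_finsetSum _ fun j _ => ?_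
    split_ifs <;> fun_prop
  have hσ : ∀ y ∈ Dl (d + 1), σ y ∈ Dl d := by
    intro y hy
    refine ⟨fun i => Finset.sum_nonneg fun j _ => ?_, ?_⟩
    · split_ifs
      · exact hy.1 j
      · exact le_rfl
    · simp only [σ]
      rw [Finset.sum_comm]
      simpa using hy.2
  refine ⟨x ∘ σ, ⟨hx.1.1.comp hσc.continuousOn hσ, fun y hy => hx.1.2 (hσ y hy)⟩,
    fun y hy q hq => ?_⟩
  by_cases h : q = p.castSucc ∨ q = p.succ
  · simp only [if_pos h]
    show x (σ y) = _
    congr 1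
    ext i
    simp only [σ]
    rw [Fin.sum_univ_succAbove _ q]
    simp only [predAbove_sect p q h, hq]
    simp
  · simp only [if_neg h]
    push Not at h
    show x (σ y) = b
    refine hx.2 _ (hσ y hy) (p.predAbove q) ?_
    simp only [σ]
    refine Finset.sum_eq_zero fun j _ => ?_
    split_ifs with h'
    · rw [predAbove_fiber p q j h h', hq]
    · rfl

theorem loop_const (hb : b ∈ S) (d : ℕ) : Loop S b d fun _ => b :=
  ⟨⟨continuousOn_const, fun _ _ => hb⟩, fun _ _ _ _ => rfl⟩

theorem fill_all (hb : b ∈ S) {d : ℕ} (hd : 2 ≤ d) (g : (Fin d → ℝ) → E) (hg : Loop S b d g) :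
    ∃ L : ℤ → (Fin d → ℝ) → E, L 0 = (fun _ => b) ∧ L 1 = g ∧ (∀ n, Loop S b d (L n)) ∧
      ∀ t : ℕ → ℤ, als d t = 0 → Fill S d fun p => L (t p) := by
  classical
  obtain ⟨d, rfl⟩ : ∃ d', d = d' + 2 := ⟨d - 2, by omega⟩
  let P := {f : (Fin (d + 2) → ℝ) → E // Loop S b (d + 2) f}
  let c : P := ⟨fun _ => b, loop_const hb _⟩
  let T : P → P → P → Fin (d + 3) → (Fin (d + 2) → ℝ) → E := fun u v w p =>
    if p.val = 0 then u.1 else if p.val = 1 then v.1 else if p.val = 2 then w.1 else fun _ => b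
  have hT : ∀ u v w p, Loop S b (d + 2) (T u v w p) := by
    intro u v w p
    simp only [T]
    split_ifs
    exacts [u.2, v.2, w.2, c.2]
  let g' : P := ⟨g, hg⟩
  have up : ∀ w : P, ∃ v : P, Fill S (d + 2) (T g' v w) := by
    intro w
    obtain ⟨z, hz, hF⟩ := face_create (b := b) (T g' c w) 1 fun j _ => hT _ _ _ _
    refine ⟨⟨z, hz⟩, ?_⟩
    convert hF using 1
    ext1 p
    by_cases hp : p = 1
    · subst hp; simp [T]
    · rw [Function.update_of_ne hp]
      have : p.val ≠ 1 := fun h => hp (Fin.ext (by simpa using h))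
      simp [T, this]
  have dn : ∀ v : P, ∃ w : P, Fill S (d + 2) (T g' v w) := by
    intro v
    obtain ⟨z, hz, hF⟩ := face_create (b := b) (T g' v c) 2 fun j _ => hT _ _ _ _
    refine ⟨⟨z, hz⟩, ?_⟩
    have h2 : ((2 : Fin (d + 3)) : ℕ) = 2 := by
      rw [Fin.val_two]
    convert hF using 1
    ext1 p
    by_cases hp : p = 2
    · subst hp; simp only [T, h2, Function.update_self]; simp
    · rw [Function.update_of_ne hp]
      have : p.val ≠ 2 := fun h => hp (Fin.ext (by rw [h, h2]))
      simp [T, this]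
  choose u hu using up
  choose w hw using dn
  let L : ℤ → P := fun n => match n with
    | Int.ofNat 0 => c
    | Int.ofNat (k + 1) => u^[k] g'
    | Int.negSucc k => w^[k + 1] c
  have h0 : L 0 = c := rfl
  have h1 : L 1 = g' := rfl
  have hone : ∀ n, Fill S (d + 2) (T g' (L (n + 1)) (L n)) := by
    intro n
    rcases n with (_ | k) | k
    · show Fill S (d + 2) (T g' (L (0 + 1)) (L 0))
      rw [zero_add, h0, h1]
      convert degen (S := S) (b := b) g hg 0 using 1
      ext1 p
      simp only [T, Fin.ext_iff]
      simp
      rcases p with ⟨_ | _ | _ | p, hp⟩ <;> simp [g', c]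
    · have : L (Int.ofNat (k + 1) + 1) = u (L (Int.ofNat (k + 1))) := by
        show u^[k + 1] g' = u (u^[k] g')
        rw [Function.iterate_succ_apply']
      rw [this]; exact hu _
    · have : L (Int.negSucc k) = w (L (Int.negSucc k + 1)) := by
        rcases k with _ | k
        · rfl
        · show w^[k + 2] c = w (w^[k + 1] c)
          rw [Function.iterate_succ_apply']
      rw [this]; exact hw _
  have ax : FillAx (d + 2) fun t => Fill S (d + 2) fun p => (L (t p)).1 := by
    refine ⟨by omega, ?_, ?_, ?_, ?_⟩
    · intro t t' h hF
      convert hF using 2 with p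
      rw [h p p.2]
    · intro A k hk h
      have key : ∀ (j : Fin (d + 2 + 2)) (p : Fin (d + 2 + 1)),
          ((j.succAbove p : Fin _) : ℕ) = sa j p := by
        intro j p
        unfold Fin.succAbove sa
        simp only [Fin.lt_def, Fin.val_castSucc]
        split_ifs <;> simp
      have := kan_row (S := S) (d := d + 2) (fun i j => (L (sy A i j)).1)
        (fun i j => by rw [sy_comm]) ⟨k, hk⟩ (fun j hj => by
          have := h j j.2 (fun h => hj (Fin.ext h))
          simpa only [key] using this)
      simpa only [key] using this
    · intro x p hp
      convert degen (S := S) (b := b) (L x).1 (L x).2 ⟨p, hp⟩ using 1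
      ext1 q
      unfold dg
      simp only [Fin.ext_iff, Fin.val_castSucc, Fin.val_succ]
      split_ifs
      · rfl
      · rw [h0]
    · intro n
      convert hone n using 1
      ext1 p
      simp only [t3, T]
      split_ifs
      · rw [h1]
      · rfl
      · rfl
      · rw [h0]
  exact ⟨fun n => (L n).1, congrArg Subtype.val h0, congrArg Subtype.val h1, fun n => (L n).2, fun t ht => ax.all t ht⟩

end kan
end TD

open Filter Set
open scoped ENNReal
set_option linter.unusedSectionVars false
set_option linter.unusedVariables false

namespace TD
open Finsupp

section hopfalg

theorem bd_ofFn {R : Type*} [CommRing R] {A : Type*} : ∀ (n : ℕ) (f : Fin (n + 1) → A),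
    (bd (List.ofFn f) : Ch R A) =
      ∑ p : Fin (n + 1), (-1 : R) ^ (p : ℕ) • single (List.ofFn (f ∘ p.succAbove)) 1 := by
  intro n
  induction n with
  | zero => intro f; simp [List.ofFn_succ, bd_cons]
  | succ n ih =>
    intro f
    rw [List.ofFn_succ, bd_cons, ih, sub_eq_add_neg, map_sum, ← Finset.sum_neg_distrib]
    refine Eq.trans ?_ (Fin.sum_univ_succ _).symm
    congr 1
    · simp [Function.comp_def]
    · refine Finset.sum_congr rfl fun p _ => ?_
      rw [map_smul, cns_single]
      have : List.ofFn (f ∘ p.succ.succAbove) =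
          f 0 :: List.ofFn ((fun i => f (Fin.succ i)) ∘ p.succAbove) := by
        rw [List.ofFn_succ]
        simp [Function.comp_def]
      rw [this, Fin.val_succ, pow_succ]
      simp

variable {A : Type*} [DecidableEq A]

def EL {n : ℕ} (e : Fin n → A) (l : List A) : ℤ :=
  Matrix.det (Matrix.of fun i j : Fin n => if l[i.1]? = some (e j) then (1 : ℤ) else 0)

theorem EL_zero {n : ℕ} (e : Fin n → A) (l : List A) (j : Fin n) (h : e j ∉ l) : EL e l = 0 := by
  unfold EL
  refine Matrix.det_eq_zero_of_column_eq_zero j fun i => ?_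
  simp only [Matrix.of_apply]
  rw [if_neg]
  intro h'
  exact h (List.mem_of_getElem? h')

theorem EL_ofFn {n : ℕ} (e f : Fin n → A) : EL e (List.ofFn f) =
    Matrix.det (Matrix.of fun i j : Fin n => if f i = e j then (1 : ℤ) else 0) := by
  unfold EL
  congr 1
  ext i j
  simp

theorem EL_swap {k : ℕ} (e : Fin (k + 2) → A) (a : List A) (x y : A) (b : List A)
    (h : a.length + b.length = k) :
    EL e (a ++ x :: y :: b) + EL e (a ++ y :: x :: b) = 0 := by
  unfold EL
  let i1 : Fin (k + 2) := ⟨a.length, by omega⟩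
  let i2 : Fin (k + 2) := ⟨a.length + 1, by omega⟩
  have hne : i1 ≠ i2 := by simp [i1, i2, Fin.ext_iff]
  have key : (Matrix.of fun i j : Fin (k + 2) =>
      if (a ++ y :: x :: b)[i.1]? = some (e j) then (1 : ℤ) else 0) =
      (Matrix.of fun i j : Fin (k + 2) =>
      if (a ++ x :: y :: b)[i.1]? = some (e j) then (1 : ℤ) else 0).submatrix
        (Equiv.swap i1 i2) id := by
    ext i j
    simp only [Matrix.of_apply, Matrix.submatrix_apply, id]
    have : (a ++ y :: x :: b)[i.1]? = (a ++ x :: y :: b)[(Equiv.swap i1 i2 i).1]? := by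
      by_cases h1 : i = i1
      · subst h1
        rw [Equiv.swap_apply_left]
        simp [i1, i2, List.getElem?_append_right]
      · by_cases h2 : i = i2
        · subst h2
          rw [Equiv.swap_apply_right]
          simp [i1, i2, List.getElem?_append_right]
        · rw [Equiv.swap_apply_of_ne_of_ne h1 h2]
          simp only [i1, i2, Fin.ext_iff] at h1 h2
          rcases lt_or_ge i.1 a.length with h3 | h3
          · rw [List.getElem?_append_left h3, List.getElem?_append_left h3]
          · rw [List.getElem?_append_right h3, List.getElem?_append_right h3]
            obtain ⟨t, ht⟩ : ∃ t, i.1 - a.length = t + 2 := ⟨i.1 - a.length - 2, by omega⟩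
            rw [ht]; simp
    rw [this]
  rw [key, Matrix.det_permute, Equiv.Perm.sign_swap hne]
  simp

variable {X : Type*} [MetricSpace X] [CompactSpace X]

theorem hopf_alg [Nonempty X] {k N : ℕ} {ε₀ : ℝ} {U : Fin N → Set X} (hU : Cov X (k + 1) ε₀ U)
    (hcd : CD X (k + 1)) (hhd : HD ℤ X k) (e : Fin (k + 2) → Fin N) :
    ∃ (M : ℕ) (V : Fin M → Set X) (r : Fin M → Fin N) (c : (Fin (k + 1) → Fin M) → ℤ)
      (Far : Set (Fin M) → Prop),
      (∀ v, IsOpen (V v)) ∧ (∀ x, ∃ v, x ∈ V v) ∧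
      (∀ x, ∀ s : Finset (Fin M), (∀ i ∈ s, x ∈ V i) → s.card ≤ k + 2) ∧
      (∀ v, V v ⊆ U (r v)) ∧ Monotone r ∧
      (∀ T T', T ⊆ T' → Far T' → Far T) ∧
      (∀ T, ¬ Far T → ∀ x, (∀ v ∈ T, x ∈ closure (V v)) → ∀ j, x ∈ U (e j)) ∧
      (∀ T, Far T → ∃ j, ∀ v ∈ T, r v ≠ e j) ∧
      (∀ t, Far (range t) → c t = 0) ∧
      (∀ f : Fin (k + 2) → Fin M, (∃ x, ∀ i, x ∈ V (f i)) →
        ∑ p : Fin (k + 2), (-1) ^ (p : ℕ) * c (f ∘ p.succAbove) =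
        Matrix.det (Matrix.of fun i j : Fin (k + 2) => if r (f i) = e j then (1 : ℤ) else 0)) := by
  classical
  obtain ⟨η, hη, lam, hlam⟩ := hU.label
  obtain ⟨δ', hδ', s, hs1, hs2⟩ := hhd (η / 4) (by positivity)
  set δ := min δ' (η / 2) with hδ
  have hδ0 : 0 < δ := by positivity
  have hδ1 : δ ≤ δ' := min_le_left _ _
  have hδ2 : δ ≤ η / 2 := min_le_right _ _
  obtain ⟨M, V₀, hV₀⟩ := hcd (δ / 2) (by positivity)
  obtain ⟨x0⟩ := ‹Nonempty X›
  have : ∀ v, ∃ p, ∀ x ∈ V₀ v, dist x p ≤ δ / 2 := by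
    intro v
    by_cases h : (V₀ v).Nonempty
    · obtain ⟨p, hp⟩ := h
      exact ⟨p, fun x hx => hV₀.mesh v x hx p hp⟩
    · exact ⟨x0, fun x hx => absurd ⟨x, hx⟩ h⟩
  choose P₀ hP₀ using this
  let so := Tuple.sort (fun v => lam (P₀ v))
  let V := V₀ ∘ so
  let P := P₀ ∘ so
  have hP : ∀ v, ∀ x ∈ V v, dist x (P v) ≤ δ / 2 := fun v => hP₀ (so v)
  have hPc : ∀ v, ∀ x ∈ closure (V v), dist x (P v) ≤ δ / 2 := by
    intro v x hx
    have : closure (V v) ⊆ Metric.closedBall (P v) (δ / 2) :=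
      closure_minimal (fun x hx => hP v x hx) Metric.isClosed_closedBall
    exact this hx
  let r := fun v => lam (P v)
  let Far : Set (Fin M) → Prop := fun T => ∃ j, ∀ v ∈ T, ∀ y, dist (P v) y ≤ η / 4 → lam y ≠ e j
  let z : Ch ℤ X →ₗ[ℤ] ℤ := linearCombination ℤ (EL e) ∘ₗ mp lam
  have hz : ∀ l, z (single l 1) = EL e (l.map lam) := by
    intro l; simp [z]
  have hAlt : Alt k (linearCombination ℤ (EL e) : Ch ℤ (Fin N) →ₗ[ℤ] ℤ) := by
    intro a x y b hab
    simpa using EL_swap e a x y b hab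
  have hAlt2 : Alt (k + 1) ((linearCombination ℤ (EL e) : Ch ℤ (Fin N) →ₗ[ℤ] ℤ) ∘ₗ dl) := by
    intro a x y b hab
    have := Alt.bd (k := k) a hAlt x y b hab
    simpa only [LinearMap.comp_apply, dl_single] using this
  have hzb : ∀ l : List X, small η l → l.length = k + 3 → z (bd l) = 0 := by
    intro l hl hk
    have hnd : ¬ (l.map lam).Nodup := by
      intro hnd
      obtain ⟨x, hx⟩ : ∃ x, x ∈ l := by
        rcases l with _ | ⟨x, l⟩
        · simp at hk
        · exact ⟨x, by simp⟩
      have := hU.ord x (l.map lam).toFinset (by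
        intro i hi
        simp only [List.mem_toFinset, List.mem_map] at hi
        obtain ⟨y, hy, rfl⟩ := hi
        exact hlam y x (hl y hy x hx))
      rw [List.toFinset_card_of_nodup hnd] at this
      simp at this
      omega
    have := hAlt2.dup (fun m hm => by omega) hnd (by simpa using hk)
    rw [LinearMap.comp_apply, dl_single, bd_map] at this
    exact this
  have hzs : ∀ l, small δ l → l.length = k + 2 → z (single l 1) = z (s (bd l)) := by
    intro l hl hk
    have h1 := hs2 l (hl.mono hδ1 (List.Subset.refl _)) (by omega)
    have h2 : z (dl (s (single l 1))) = 0 := by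
      refine zero_of_supp (f := z ∘ₗ dl) ?_ (hs1 l)
      rintro K ⟨K1, K2⟩
      simp only [LinearMap.comp_apply, dl_single]
      refine hzb K ?_ (by omega)
      intro x hx y hy
      obtain ⟨x', hx', h1⟩ := K2 x hx
      obtain ⟨y', hy', h2⟩ := K2 y hy
      have h3 := hl x' hx' y' hy'
      rw [dist_comm] at h1
      linarith [dist_triangle4 x x' y' y]
    rw [← h1, map_add, h2, zero_add]
  refine ⟨M, V, r, fun t => z (s (single ((List.ofFn t).map P) 1)), Far, fun v => hV₀.op _, ?_, ?_,
    ?_, Tuple.monotone_sort (fun v => lam (P₀ v)), ?_, ?_, ?_, ?_, ?_⟩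
  · intro x
    obtain ⟨v, hv⟩ := hV₀.cov x
    exact ⟨so.symm v, by simpa [V] using hv⟩
  · intro x t ht
    have := hV₀.ord x (t.map so.toEmbedding) (by
      intro i hi
      simp only [Finset.mem_map] at hi
      obtain ⟨v, hv, rfl⟩ := hi
      exact ht v hv)
    rw [Finset.card_map] at this
    omega
  · intro v x hx
    refine hlam _ _ ?_
    rw [dist_comm]
    linarith [hP v x hx]
  · rintro T T' h ⟨j, hj⟩
    exact ⟨j, fun v hv => hj v (h hv)⟩
  · intro T hT x hx j
    simp only [Far] at hT
    push Not at hT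
    obtain ⟨v, hv, y, hy, h1⟩ := hT j
    rw [← h1]
    refine hlam y x ?_
    have := hPc v x (hx v hv)
    rw [dist_comm] at hy this
    linarith [dist_triangle y (P v) x]
  · rintro T ⟨j, hj⟩
    exact ⟨j, fun v hv => hj v hv (P v) (by simp; positivity)⟩
  · rintro t ⟨j, hj⟩
    refine zero_of_supp (f := z) ?_ (hs1 _)
    rintro K ⟨K1, K2⟩
    rw [hz]
    refine EL_zero e _ j ?_
    intro hm
    obtain ⟨y, hy, h1⟩ := List.mem_map.1 hm
    obtain ⟨x, hx, h2⟩ := K2 y hy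
    obtain ⟨v, hv, rfl⟩ := List.mem_map.1 hx
    refine hj v ?_ y h2 h1
    exact List.mem_ofFn.1 hv
  · rintro f ⟨x, hx⟩
    have h1 := hzs ((List.ofFn f).map P) (by
      intro a ha b hb
      simp only [List.mem_map, List.mem_ofFn] at ha hb
      obtain ⟨_, ⟨i, rfl⟩, rfl⟩ := ha
      obtain ⟨_, ⟨j, rfl⟩, rfl⟩ := hb
      have h1 := hP _ x (hx i)
      have h2 := hP _ x (hx j)
      rw [dist_comm] at h1
      linarith [dist_triangle (P (f i)) x (P (f j))]) (by simp)
    rw [hz, bd_map, bd_ofFn] at h1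
    have h2 : List.map lam (List.map P (List.ofFn f)) = List.ofFn (fun i => r (f i)) := by
      rw [List.map_ofFn, List.map_ofFn]; rfl
    rw [h2, EL_ofFn] at h1
    rw [h1]
    simp only [map_sum, map_smul, mp_single, smul_eq_mul]

end hopfalg

/-- the minor cochain -/
theorem minor_sum {m : ℕ} (L : Fin (m + 1) → Fin (m + 1)) :
    ∑ p : Fin (m + 1), (-1) ^ (p : ℕ) *
      Matrix.det (Matrix.of fun i j : Fin m => if L (p.succAbove i) = j.succ then (1 : ℤ) else 0) =
    Matrix.det (Matrix.of fun i j : Fin (m + 1) => if L i = j then (1 : ℤ) else 0) := by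
  set B : Matrix (Fin (m + 1)) (Fin (m + 1)) ℤ := Matrix.of fun i j => if L i = j then (1 : ℤ) else 0
    with hB
  set P : Matrix (Fin (m + 1)) (Fin (m + 1)) ℤ := Matrix.of fun k j =>
    if j = 0 then 1 else if k = j then 1 else 0 with hP
  have hdP : P.det = 1 := by
    rw [Matrix.det_of_lowerTriangular]
    · simp [hP]
    · intro i j hij
      have hij : i < j := hij
      have h0 : j ≠ 0 := by rintro rfl; exact absurd hij (by simp)
      simp [hP, h0, hij.ne]
  have hBP : B * P = Matrix.of fun i j => if j = 0 then 1 else if L i = j then (1 : ℤ) else 0 := by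
    ext i j
    simp [Matrix.mul_apply, hB, hP]
  have : B.det = (B * P).det := by rw [Matrix.det_mul, hdP, mul_one]
  rw [this, hBP, Matrix.det_succ_column_zero]
  refine Finset.sum_congr rfl fun p _ => ?_
  simp [Matrix.submatrix]

theorem minor_mono {m : ℕ} (L : Fin m → Fin (m + 1)) (hL : Monotone L) :
    Matrix.det (Matrix.of fun i j : Fin m => if L i = j.succ then (1 : ℤ) else 0) =
      if L = Fin.succ then 1 else 0 := by
  split_ifs with h
  · subst h
    have : (Matrix.of fun i j : Fin m => if Fin.succ i = j.succ then (1 : ℤ) else 0) = 1 := by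
      ext i j
      simp [Matrix.one_apply, Fin.succ_inj]
    rw [this, Matrix.det_one]
  · by_cases hi : Function.Injective L
    · by_cases h0 : ∃ i, L i = 0
      · obtain ⟨i, hi⟩ := h0
        refine Matrix.det_eq_zero_of_row_eq_zero i fun j => ?_
        simp [hi, (Fin.succ_ne_zero j).symm]
      · exfalso
        push Not at h0
        apply h
        refine (StrictMono.range_inj (hL.strictMono_of_injective hi) (Fin.strictMono_succ)).1 ?_
        have hsub : range L ⊆ range (Fin.succ : Fin m → Fin (m + 1)) := by
          rintro _ ⟨i, rfl⟩
          exact ⟨(L i).pred (h0 i), by simp⟩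
        refine Set.eq_of_subset_of_ncard_le hsub ?_
        rw [← image_univ, ← image_univ, ncard_image_of_injective _ hi,
          ncard_image_of_injective _ (Fin.succ_injective _)]
    · simp only [Function.Injective] at hi
      push Not at hi
      obtain ⟨i, j, h1, h2⟩ := hi
      refine Matrix.det_zero_of_row_eq h2 ?_
      ext k
      simp [h1]

end TD

open Filter Set
open scoped ENNReal
set_option linter.unusedSectionVars false
set_option linter.unusedVariables false

namespace TD

section model

def SS (k : ℕ) : Set (Fin (k + 2) → ℝ) := {y | ∃ i j, y i ≠ y j}
noncomputable def bs (k : ℕ) : Fin (k + 2) → ℝ := Pi.single 0 1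
noncomputable def om {k : ℕ} (t : Fin (k + 2) → ℝ) : ℝ :=
  Finset.univ.inf' Finset.univ_nonempty fun i : Fin (k + 1) => t i.succ
noncomputable def kap {k : ℕ} (t : Fin (k + 2) → ℝ) : Fin (k + 2) → ℝ :=
  om t • t + (1 - (k + 1) * om t) • bs k
noncomputable def hom {k : ℕ} (s : ℝ) (t : Fin (k + 2) → ℝ) : Fin (k + 2) → ℝ :=
  (1 - s) • t + s • kap t

theorem bs_mem (k : ℕ) : bs k ∈ SS k := by
  refine ⟨0, 1, ?_⟩
  simp [bs]

theorem om_cont {k : ℕ} : Continuous (om (k := k)) := by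
  refine Continuous.finset_inf'_apply _ fun i _ => ?_
  fun_prop

theorem kap_cont {k : ℕ} : Continuous (kap (k := k)) := by
  unfold kap
  have := om_cont (k := k)
  fun_prop

theorem om_le {k : ℕ} (t : Fin (k + 2) → ℝ) (i : Fin (k + 1)) : om t ≤ t i.succ :=
  Finset.inf'_le (f := fun i : Fin (k + 1) => t i.succ) (Finset.mem_univ i)

theorem om_nonneg {k : ℕ} {t : Fin (k + 2) → ℝ} (ht : t ∈ Dl (k + 2)) : 0 ≤ om t :=
  Finset.le_inf' _ _ fun i _ => ht.1 _

theorem om_ex {k : ℕ} (t : Fin (k + 2) → ℝ) : ∃ i : Fin (k + 1), om t = t i.succ := by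
  obtain ⟨i, _, hi⟩ := Finset.exists_mem_eq_inf' Finset.univ_nonempty
    (fun i : Fin (k + 1) => t i.succ)
  exact ⟨i, hi⟩

theorem kap_of_zero {k : ℕ} {t : Fin (k + 2) → ℝ} (ht : t ∈ Dl (k + 2)) {i : Fin (k + 1)}
    (hi : t i.succ = 0) : kap t = bs k := by
  have : om t = 0 := le_antisymm (hi ▸ om_le t i) (om_nonneg ht)
  simp [kap, this]

theorem hom_zero {k : ℕ} (t : Fin (k + 2) → ℝ) : hom 0 t = t := by simp [hom]
theorem hom_one {k : ℕ} (t : Fin (k + 2) → ℝ) : hom 1 t = kap t := by simp [hom]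

theorem hom_mem {k : ℕ} {t : Fin (k + 2) → ℝ} (ht : t ∈ Dl (k + 2)) (hz : ∃ i, t i = 0) {s : ℝ}
    (h0 : 0 ≤ s) (h1 : s ≤ 1) : hom s t ∈ SS k := by
  by_contra hcon
  have hc : ∀ i j, hom s t i = hom s t j := by
    intro i j
    by_contra h
    exact hcon ⟨i, j, h⟩
  have e0 : hom s t 0 = (1 - s) * t 0 + s * (om t * t 0 + (1 - (k + 1) * om t)) := by
    simp [hom, kap, bs]; ring
  have es : ∀ i : Fin (k + 1), hom s t i.succ = (1 - s + s * om t) * t i.succ := by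
    intro i
    simp [hom, kap, bs]; ring
  have hw := om_nonneg ht
  rcases hw.eq_or_lt with hw0 | hw0
  · obtain ⟨i, hi⟩ := om_ex t
    have h2 : hom s t i.succ = 0 := by rw [es, ← hi, ← hw0]; ring
    have h3 := hc 0 i.succ
    rw [h2, e0, ← hw0] at h3
    have h4 := ht.1 0
    have h5 : s = 0 := by nlinarith
    subst h5
    have : ∑ j, t j = 0 := Finset.sum_eq_zero fun j _ => by
      have := hc j i.succ
      rw [h2, hom_zero] at this
      exact this
    rw [ht.2] at this
    exact one_ne_zero this
  · have h2 : t 0 = 0 := by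
      obtain ⟨i, hi⟩ := hz
      rcases Fin.eq_zero_or_eq_succ i with rfl | ⟨j, rfl⟩
      · exact hi
      · have := om_le t j; rw [hi] at this; linarith
    have hq : 0 < 1 - s + s * om t := by
      rcases h1.lt_or_eq with h1 | h1
      · nlinarith
      · subst h1; linarith
    obtain ⟨i, hi⟩ := om_ex t
    have h3 : ∀ j : Fin (k + 1), t j.succ = om t := by
      intro j
      have := hc j.succ i.succ
      rw [es, es, ← hi] at this
      exact mul_left_cancel₀ hq.ne' this
    have h4 := ht.2
    rw [Fin.sum_univ_succ, h2] at h4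
    simp only [h3] at h4
    simp at h4
    have h5 := hc 0 i.succ
    rw [e0, es, h2, ← hi, h4] at h5
    have : 0 < (1 - s + s * om t) * om t := mul_pos hq hw0
    nlinarith

theorem loop_one (k : ℕ) : Loop (SS k) (bs k) (k + 1) fun y => kap (Fin.cons 0 y) := by
  have hm : ∀ y ∈ Dl (k + 1), (Fin.cons 0 y : Fin (k + 2) → ℝ) ∈ Dl (k + 2) := by
    intro y hy
    refine ⟨fun i => ?_, ?_⟩
    · rcases Fin.eq_zero_or_eq_succ i with rfl | ⟨j, rfl⟩
      · simp
      · simpa using hy.1 j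
    · rw [Fin.sum_univ_succ]; simpa using hy.2
  refine ⟨⟨?_, fun y hy => ?_⟩, fun y hy p hp => ?_⟩
  · refine (kap_cont.comp ?_).continuousOn
    refine continuous_pi fun i => ?_
    rcases Fin.eq_zero_or_eq_succ i with rfl | ⟨j, rfl⟩
    · simp; fun_prop
    · simp; fun_prop
  · have := hom_mem (hm y hy) ⟨0, by simp⟩ zero_le_one le_rfl
    rwa [hom_one] at this
  · exact kap_of_zero (hm y hy) (i := p) (by simpa using hp)

theorem pou {X : Type*} [MetricSpace X] {M : ℕ} {V : Fin M → Set X} (hV : ∀ v, IsOpen (V v))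
    (hc : ∀ x, ∃ v, x ∈ V v) : ∃ ψ : X → Fin M → ℝ, Continuous ψ ∧ (∀ x, ψ x ∈ Dl M) ∧
      ∀ x v, ψ x v = 0 ↔ x ∉ V v := by
  classical
  have : ∀ v, ∃ f : X → ℝ, Continuous f ∧ (∀ x, 0 ≤ f x) ∧ ∀ x, f x = 0 ↔ x ∉ V v := by
    intro v
    by_cases h : (V v)ᶜ.Nonempty
    · refine ⟨fun x => Metric.infDist x (V v)ᶜ, Metric.continuous_infDist_pt _,
        fun x => Metric.infDist_nonneg, fun x => ?_⟩
      rw [← (hV v).isClosed_compl.mem_iff_infDist_zero h]; rfl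
    · refine ⟨fun _ => 1, continuous_const, fun _ => zero_le_one, fun x => ?_⟩
      have : x ∈ V v := by
        by_contra hx
        exact h ⟨x, hx⟩
      simp [this]
  choose f hf1 hf2 hf3 using this
  have hs : ∀ x, 0 < ∑ v, f v x := by
    intro x
    obtain ⟨v, hv⟩ := hc x
    refine Finset.sum_pos' (fun v _ => hf2 v x) ⟨v, Finset.mem_univ v, ?_⟩
    refine (hf2 v x).lt_of_ne fun h => ?_
    exact (hf3 v x).1 h.symm hv
  refine ⟨fun x v => f v x / ∑ w, f w x, ?_, fun x => ⟨fun v => ?_, ?_⟩, fun x v => ?_⟩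
  · refine continuous_pi fun v => (hf1 v).div ?_ fun x => (hs x).ne'
    exact continuous_finsetSum _ fun w _ => hf1 w
  · exact div_nonneg (hf2 v x) (hs x).le
  · rw [← Finset.sum_div, div_self (hs x).ne']
  · rw [div_eq_zero_iff, ← hf3]
    simp [(hs x).ne']

theorem mono_eq {m : ℕ} {A : Type*} [LinearOrder A] {g h : Fin m → A} (hg : Monotone g)
    (hh : StrictMono h) (hr : range h ⊆ range g) : g = h := by
  have hfin : (range g).Finite := finite_range g
  have h1 : (range h).ncard = m := by
    rw [← image_univ, ncard_image_of_injective _ hh.injective]; simp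
  have h2 : (range g).ncard ≤ m := by
    rw [← image_univ]
    refine (ncard_image_le (finite_univ)).trans ?_
    simp
  have h3 : range h = range g := Set.eq_of_subset_of_ncard_le hr (by omega) hfin
  have h4 : InjOn g univ := by
    refine injOn_of_ncard_image_eq ?_ finite_univ
    rw [image_univ, ← h3, h1]; simp
  have h5 : StrictMono g := hg.strictMono_of_injective (injOn_univ.1 h4)
  exact (StrictMono.range_inj h5 hh).1 h3.symm

end model
end TD

open Filter Set
open scoped ENNReal
set_option linter.unusedSectionVars false
set_option linter.unusedVariables false

namespace TD

section shrink
variable {X : Type*} [MetricSpace X] [CompactSpace X]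

/-- the piecewise map built from fillings -/
theorem gamma {k M : ℕ} {E : Type*} [TopologicalSpace E] {S : Set E} {b : E} (hb : b ∈ S)
    {V : Fin M → Set X} (hVo : ∀ v, IsOpen (V v))
    (ho : ∀ x, ∀ s : Finset (Fin M), (∀ i ∈ s, x ∈ V i) → s.card ≤ k + 2)
    (ψ : X → Fin M → ℝ) (hψc : Continuous ψ) (hψ : ∀ x, ψ x ∈ Dl M)
    (hψ0 : ∀ x v, ψ x v = 0 ↔ x ∉ V v) (X2 : Set X) (hX2 : IsClosed X2)
    (B : (Fin (k + 1) → Fin M) → (Fin (k + 1) → ℝ) → E) (hB : ∀ t, Loop S b (k + 1) (B t))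
    (hF : ∀ f : Fin (k + 2) → Fin M, StrictMono f → (∃ x ∈ X2, ∀ i, x ∈ V (f i)) →
      Fill S (k + 1) fun p => B (f ∘ p.succAbove)) :
    ∃ Γ : X → E, Good S Γ X2 ∧
      (∀ x ∈ X2, ∀ t : Fin (k + 1) → Fin M, StrictMono t → {v | x ∈ V v} ⊆ range t →
        Γ x = B t (ψ x ∘ t)) ∧
      (∀ x ∈ X2, {v | x ∈ V v}.ncard < k + 1 → Γ x = b) := by
  classical
  have : ∀ f : Fin (k + 2) → Fin M, ∃ G : (Fin (k + 2) → ℝ) → E,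
      StrictMono f → (∃ x ∈ X2, ∀ i, x ∈ V (f i)) → Good S G (Dl (k + 2)) ∧
      ∀ y ∈ Dl (k + 2), ∀ p, y p = 0 → G y = B (f ∘ p.succAbove) (y ∘ p.succAbove) := by
    intro f
    by_cases h : StrictMono f ∧ (∃ x ∈ X2, ∀ i, x ∈ V (f i))
    · obtain ⟨G, hG⟩ := hF f h.1 h.2
      exact ⟨G, fun _ _ => hG⟩
    · exact ⟨fun _ => b, fun h1 h2 => absurd ⟨h1, h2⟩ h⟩
  choose G hG using this
  have nc : ∀ {m : ℕ} {f : Fin m → Fin M}, StrictMono f → (range f).ncard = m := by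
    intro m f hf
    rw [← image_univ, ncard_image_of_injective _ hf.injective]; simp
  have : ∀ x, ∃ y, (∀ f : Fin (k + 2) → Fin M, StrictMono f → {v | x ∈ V v} = range f →
      y = G f (ψ x ∘ f)) ∧ (∀ f : Fin (k + 1) → Fin M, StrictMono f → {v | x ∈ V v} = range f →
      y = B f (ψ x ∘ f)) ∧ ({v | x ∈ V v}.ncard < k + 1 → y = b) := by
    intro x
    by_cases h1 : ∃ f : Fin (k + 2) → Fin M, StrictMono f ∧ {v | x ∈ V v} = range f
    · obtain ⟨f, hf, hr⟩ := h1
      refine ⟨G f (ψ x ∘ f), fun f' hf' hr' => ?_, fun f' hf' hr' => ?_, fun h => ?_⟩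
      · rw [(StrictMono.range_inj hf hf').1 (hr.symm.trans hr')]
      · have := nc hf; rw [← hr, hr', nc hf'] at this; omega
      · rw [hr, nc hf] at h; omega
    · by_cases h2 : ∃ f : Fin (k + 1) → Fin M, StrictMono f ∧ {v | x ∈ V v} = range f
      · obtain ⟨f, hf, hr⟩ := h2
        refine ⟨B f (ψ x ∘ f), fun f' hf' hr' => absurd ⟨f', hf', hr'⟩ h1, fun f' hf' hr' => ?_,
          fun h => ?_⟩
        · rw [(StrictMono.range_inj hf hf').1 (hr.symm.trans hr')]
        · rw [hr, nc hf] at h; omega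
      · exact ⟨b, fun f' hf' hr' => absurd ⟨f', hf', hr'⟩ h1,
          fun f' hf' hr' => absurd ⟨f', hf', hr'⟩ h2, fun _ => rfl⟩
  choose Γ g1 g2 g3 using this
  -- restriction of barycentric coordinates
  have hres : ∀ {m : ℕ} {f : Fin m → Fin M}, StrictMono f → ∀ x, {v | x ∈ V v} ⊆ range f →
      ψ x ∘ f ∈ Dl m := by
    intro m f hf x hx
    refine ⟨fun i => (hψ x).1 _, ?_⟩
    rw [← (hψ x).2]
    show ∑ i, ψ x (f i) = _
    rw [← Finset.sum_image (f := ψ x) (s := Finset.univ) (g := f) (by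
      intro a _ b _ h; exact hf.injective h)]
    refine Finset.sum_subset (Finset.subset_univ _) fun v _ hv => ?_
    rw [hψ0]
    intro hxv
    obtain ⟨i, hi⟩ := hx hxv
    exact hv (Finset.mem_image.2 ⟨i, Finset.mem_univ i, hi⟩)
  have hne : ∀ {m : ℕ} {f : Fin m → Fin M} (x : X), {v | x ∈ V v} ⊆ range f →
      {v | x ∈ V v} ≠ range f → ∃ p, x ∉ V (f p) := by
    intro m f x hx hn
    by_contra hcon
    push Not at hcon
    exact hn (hx.antisymm (by rintro _ ⟨i, rfl⟩; exact hcon i))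
  have hii : ∀ x, ∀ t : Fin (k + 1) → Fin M, StrictMono t → {v | x ∈ V v} ⊆ range t →
      Γ x = B t (ψ x ∘ t) := by
    intro x t ht hx
    by_cases h : {v | x ∈ V v} = range t
    · exact g2 x t ht h
    · obtain ⟨p, hp⟩ := hne x hx h
      rw [(hB t).2 _ (hres ht x hx) p ((hψ0 _ _).2 hp)]
      refine g3 x ?_
      rw [← nc ht]
      exact ncard_lt_ncard (hx.ssubset_of_ne h) (toFinite _)
  have hi : ∀ x, ∀ f : Fin (k + 2) → Fin M, StrictMono f → (∃ x ∈ X2, ∀ i, x ∈ V (f i)) →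
      {v | x ∈ V v} ⊆ range f → Γ x = G f (ψ x ∘ f) := by
    intro x f hf hn hx
    by_cases h : {v | x ∈ V v} = range f
    · exact g1 x f hf h
    · obtain ⟨p, hp⟩ := hne x hx h
      rw [(hG f hf hn).2 _ (hres hf x hx) p ((hψ0 _ _).2 hp)]
      refine hii x _ (hf.comp (Fin.strictMono_succAbove p)) ?_
      intro v hv
      obtain ⟨i, rfl⟩ := hx hv
      have : i ≠ p := by rintro rfl; exact hp hv
      obtain ⟨j, rfl⟩ := Fin.exists_succAbove_eq this
      exact ⟨j, rfl⟩
  have enum : ∀ (T : Set (Fin M)) (m : ℕ), T.ncard = m → ∃ f : Fin m → Fin M, StrictMono f ∧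
      T = range f := by
    intro T m hT
    have hc : T.toFinset.card = m := by rw [← hT, ncard_eq_toFinset_card']
    refine ⟨T.toFinset.orderEmbOfFin hc, (T.toFinset.orderEmbOfFin hc).strictMono, ?_⟩
    rw [Finset.range_orderEmbOfFin]; simp
  have hcard : ∀ x, {v | x ∈ V v}.ncard ≤ k + 2 := by
    intro x
    have := ho x {v | x ∈ V v}.toFinset (by simp)
    rwa [ncard_eq_toFinset_card']
  -- continuity
  have hpiece : ∀ y ∈ X2, Good S Γ (X2 ∩ {x | ∀ v, x ∈ V v → y ∈ V v}) := by
    intro y hy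
    rcases lt_trichotomy {v | y ∈ V v}.ncard (k + 1) with h | h | h
    · have : ∀ x ∈ X2 ∩ {x | ∀ v, x ∈ V v → y ∈ V v}, Γ x = b := by
        intro x hx
        refine g3 x ((ncard_le_ncard ?_ (toFinite _)).trans_lt h)
        exact fun v hv => hx.2 v hv
      exact ⟨continuousOn_const.congr this, fun x hx => by rw [this x hx]; exact hb⟩
    · obtain ⟨f, hf, hr⟩ := enum _ _ h
      have hsub : ∀ x ∈ X2 ∩ {x | ∀ v, x ∈ V v → y ∈ V v}, {v | x ∈ V v} ⊆ range f := by
        intro x hx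
        rw [← hr]
        exact fun v hv => hx.2 v hv
      have hcf : Continuous fun x => ψ x ∘ f := by
        refine continuous_pi fun i => ?_
        exact (continuous_apply _).comp hψc
      refine ⟨((hB f).1.1.comp hcf.continuousOn fun x hx => hres hf x (hsub x hx)).congr
        fun x hx => hii x f hf (hsub x hx), fun x hx => ?_⟩
      rw [hii x f hf (hsub x hx)]
      exact (hB f).1.2 (hres hf x (hsub x hx))
    · obtain ⟨f, hf, hr⟩ := enum {v | y ∈ V v} (k + 2) (by have := hcard y; omega)
      have hsub : ∀ x ∈ X2 ∩ {x | ∀ v, x ∈ V v → y ∈ V v}, {v | x ∈ V v} ⊆ range f := by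
        intro x hx
        rw [← hr]
        exact fun v hv => hx.2 v hv
      have hn : ∃ x ∈ X2, ∀ i, x ∈ V (f i) := ⟨y, hy, fun i => by
        have : f i ∈ {v | y ∈ V v} := by rw [hr]; exact ⟨i, rfl⟩
        exact this⟩
      have hcf : Continuous fun x => ψ x ∘ f := by
        refine continuous_pi fun i => ?_
        exact (continuous_apply _).comp hψc
      refine ⟨((hG f hf hn).1.1.comp hcf.continuousOn fun x hx => hres hf x (hsub x hx)).congr
        fun x hx => hi x f hf hn (hsub x hx), fun x hx => ?_⟩
      rw [hi x f hf hn (hsub x hx)]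
      exact (hG f hf hn).1.2 (hres hf x (hsub x hx))
  refine ⟨Γ, ⟨?_, fun x hx => (hpiece x hx).2 ⟨hx, fun v hv => hv⟩⟩, fun x _ => hii x,
    fun x _ => g3 x⟩
  let ι := {T : Set (Fin M) // ∃ y ∈ X2, {v | y ∈ V v} = T}
  have hun : X2 ⊆ ⋃ T : ι, X2 ∩ {x | ∀ v, x ∈ V v → v ∈ T.1} := by
    intro x hx
    exact mem_iUnion.2 ⟨⟨_, x, hx, rfl⟩, hx, fun v hv => hv⟩
  refine ContinuousOn.mono ?_ hun
  refine LocallyFinite.continuousOn_iUnion (locallyFinite_of_finite _) ?_ ?_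
  · rintro ⟨T, hT⟩
    refine hX2.inter ?_
    have : {x | ∀ v, x ∈ V v → v ∈ T} = ⋂ v, {x | x ∈ V v → v ∈ T} := by
      ext x; simp
    rw [this]
    refine isClosed_iInter fun v => ?_
    by_cases hv : v ∈ T
    · simp [hv]
    · simp only [hv, imp_false]
      exact (hVo v).isClosed_compl
  · rintro ⟨T, y, hy, rfl⟩
    exact (hpiece y hy).1

end shrink
end TD

open Filter Set
open scoped ENNReal
set_option linter.unusedSectionVars false
set_option linter.unusedVariables false

namespace TD

section shrink
variable {X : Type*} [MetricSpace X] [CompactSpace X]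

theorem hopf_shrink [Nonempty X] {k N : ℕ} (hk : 1 ≤ k) {ε₀ : ℝ} {U : Fin N → Set X}
    (hU : Cov X (k + 1) ε₀ U) (hcd : CD X (k + 1)) (hhd : HD ℤ X k) (e : Fin (k + 2) → Fin N)
    (he : StrictMono e) :
    ∃ U' : Fin N → Set X, Cov X (k + 1) ε₀ U' ∧ (∀ i, U' i ⊆ U i) ∧ ∀ x, ∃ j, x ∉ U' (e j) := by
  classical
  obtain ⟨M, V, r, c, Far, hVo, hVc, ho, hVU, hr, far_mono, nonfar_W, far_r, far_c, hsum⟩ :=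
    hopf_alg hU hcd hhd e
  obtain ⟨ψ, hψc, hψ, hψ0⟩ := pou hVo hVc
  let X2 : Set X := {x | ∀ v, x ∈ V v → r v ∈ range e}
  have hX2 : IsClosed X2 := by
    have : X2 = ⋂ v, {x | x ∈ V v → r v ∈ range e} := by
      ext x; simp [X2]
    rw [this]
    refine isClosed_iInter fun v => ?_
    by_cases hv : r v ∈ range e
    · simp only [hv, imp_true_iff]; exact isClosed_univ
    · simp only [hv, imp_false]
      exact (hVo v).isClosed_compl
  let W : Set X := ⋂ j, U (e j)
  have hWo : IsOpen W := isOpen_iInter_of_finite fun j => hU.op _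
  have hWX : W ⊆ X2 := by
    intro x hx v hv
    by_contra hcon
    have hx' : ∀ j, x ∈ U (e j) := fun j => mem_iInter.1 hx j
    have := hU.ord x (insert (r v) (Finset.univ.image e)) (by
      intro i hi
      rcases Finset.mem_insert.1 hi with rfl | hi
      · exact hVU v hv
      · obtain ⟨j, _, rfl⟩ := Finset.mem_image.1 hi
        exact hx' j)
    rw [Finset.card_insert_of_notMem (by
      intro h
      obtain ⟨j, _, h⟩ := Finset.mem_image.1 h
      exact hcon ⟨j, h⟩), Finset.card_image_of_injective _ he.injective] at this
    simp at this
  -- loops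
  obtain ⟨L, L0, L1, hL, hfill⟩ := fill_all (bs_mem k) (d := k + 1) (by omega) _ (loop_one k)
  let o : (Fin (k + 1) → Fin M) → ℤ := fun t => if r ∘ t = e ∘ Fin.succ then 1 else 0
  let n : (Fin (k + 1) → Fin M) → ℤ := fun t => o t - c t
  have hn : ∀ f : Fin (k + 2) → Fin M, StrictMono f → (∃ x ∈ X2, ∀ i, x ∈ V (f i)) →
      ∑ p : Fin (k + 2), (-1) ^ (p : ℕ) * n (f ∘ p.succAbove) = 0 := by
    rintro f hf ⟨x, hx, hxf⟩
    have : ∀ i, ∃ j, e j = r (f i) := fun i => hx _ (hxf i)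
    choose Λ hΛ using this
    have hΛm : Monotone Λ := by
      intro i j hij
      rw [← he.le_iff_le, hΛ, hΛ]
      exact hr (hf.monotone hij)
    have h1 := hsum f ⟨x, hxf⟩
    have h2 : ∀ p : Fin (k + 2), o (f ∘ p.succAbove) = Matrix.det (Matrix.of
        fun i j : Fin (k + 1) => if Λ (p.succAbove i) = j.succ then (1 : ℤ) else 0) := by
      intro p
      refine Eq.trans ?_ (minor_mono (Λ ∘ p.succAbove) (hΛm.comp (Fin.strictMono_succAbove p).monotone)).symm
      simp only [o]
      have : r ∘ f ∘ p.succAbove = e ∘ (Λ ∘ p.succAbove) := by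
        ext i; simp [hΛ]
      rw [this]
      congr 1
      rw [eq_iff_iff]
      exact (he.injective.comp_left).eq_iff
    have h3 := minor_sum Λ
    simp only [n, mul_sub, Finset.sum_sub_distrib]
    rw [h1]
    simp only [h2]
    rw [h3, sub_eq_zero]
    congr 1
    ext i j
    simp only [Matrix.of_apply, ← hΛ, he.injective.eq_iff]
  obtain ⟨Γ, hΓ, hΓm, hΓs⟩ := gamma (bs_mem k) hVo ho ψ hψc hψ hψ0 X2 hX2 (fun t => L (n t))
    (fun t => hL _) (by
      intro f hf hx
      have := hfill (fun p => if h : p < k + 2 then n (f ∘ (⟨p, h⟩ : Fin (k + 2)).succAbove) else 0)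
        (by
          unfold als
          rw [Finset.sum_range]
          rw [← hn f hf hx]
          refine Finset.sum_congr rfl fun p _ => ?_
          simp)
      simpa using this)
  -- the pushed coordinates
  let rr : X → Fin (k + 2) → ℝ := fun x j => ∑ v, if r v = e j then ψ x v else 0
  have hrrc : Continuous rr := by
    refine continuous_pi fun j => continuous_finsetSum _ fun v _ => ?_
    split_ifs
    · exact (continuous_apply v).comp hψc
    · exact continuous_const
  have hrr0 : ∀ x j, 0 ≤ rr x j := fun x j => Finset.sum_nonneg fun v _ => by
    split_ifs
    · exact (hψ x).1 v
    · exact le_rfl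
  have hrr : ∀ x ∈ X2, rr x ∈ Dl (k + 2) := by
    intro x hx
    refine ⟨hrr0 x, ?_⟩
    rw [← (hψ x).2]
    simp only [rr]
    rw [Finset.sum_comm]
    refine Finset.sum_congr rfl fun v _ => ?_
    by_cases hv : x ∈ V v
    · obtain ⟨j, hj⟩ := hx v hv
      rw [Finset.sum_eq_single j]
      · simp [hj]
      · intro i _ hij
        rw [if_neg]
        rw [← hj]
        exact fun h => hij (he.injective h.symm)
      · simp
    · rw [(hψ0 x v).2 hv]; simp
  have hrrz : ∀ x j, (∀ v, x ∈ V v → r v ≠ e j) → rr x j = 0 := by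
    intro x j h
    refine Finset.sum_eq_zero fun v _ => ?_
    split_ifs with hv
    · rw [hψ0]; exact fun hx => h v hx hv
    · rfl
  have hrrU : ∀ x j, rr x j ≠ 0 → x ∈ U (e j) := by
    intro x j h
    by_contra hx
    refine h (hrrz x j fun v hv hr => hx ?_)
    rw [← hr]; exact hVU v hv
  let NF : Set X := {x | ¬ Far {v | x ∈ V v}}
  have hNFo : IsOpen NF := by
    rw [isOpen_iff_mem_nhds]
    intro x hx
    have : (⋂ v ∈ {v | x ∈ V v}, V v) ∈ nhds x := by
      exact ((Set.toFinite {v | x ∈ V v}).isOpen_biInter (fun v _ => hVo v)).mem_nhds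
        (mem_iInter₂.2 fun v hv => hv)
    filter_upwards [this] with y hy
    intro hf
    exact hx (far_mono _ _ (fun v hv => mem_iInter₂.1 hy v hv) hf)
  have hNFW : closure NF ⊆ W := by
    let Q : Set X := ⋃ T : {T : Set (Fin M) // ¬ Far T}, ⋂ v ∈ T.1, closure (V v)
    have hQ : IsClosed Q := isClosed_iUnion_of_finite fun T =>
      isClosed_biInter fun v _ => isClosed_closure
    have h1 : NF ⊆ Q := fun x hx => mem_iUnion.2 ⟨⟨_, hx⟩, mem_iInter₂.2 fun v hv =>
      subset_closure hv⟩
    refine (closure_minimal h1 hQ).trans ?_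
    intro x hx
    obtain ⟨T, hT⟩ := mem_iUnion.1 hx
    exact mem_iInter.2 (nonfar_W T.1 T.2 x fun v hv => mem_iInter₂.1 hT v hv)
  obtain ⟨θ, hθ0, hθ1, hθ⟩ := exists_continuous_zero_one_of_isClosed hWo.isClosed_compl
    (isClosed_closure (s := NF)) (by
      rw [Set.disjoint_left]
      exact fun x hx hx' => hx (hNFW hx'))
  have hagree : ∀ x ∈ closure NF, x ∉ NF → kap (rr x) = Γ x := by
    intro x hx hfar
    simp only [NF, mem_setOf_eq, not_not] at hfar
    have hxX : x ∈ X2 := hWX (hNFW hx)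
    have hcard : {v | x ∈ V v}.ncard < k + 2 := by
      by_contra hcon
      have : (⋂ v ∈ {v | x ∈ V v}, V v) ∈ nhds x := by
        exact ((Set.toFinite {v | x ∈ V v}).isOpen_biInter (fun v _ => hVo v)).mem_nhds
          (mem_iInter₂.2 fun v hv => hv)
      obtain ⟨y, hy, hyN⟩ := mem_closure_iff_nhds.1 hx _ this
      apply hyN
      have hsub : {v | x ∈ V v} ⊆ {v | y ∈ V v} := fun v hv => mem_iInter₂.1 hy v hv
      have hc : {v | y ∈ V v}.ncard ≤ k + 2 := by
        have := ho y {v | y ∈ V v}.toFinset (by simp)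
        rwa [ncard_eq_toFinset_card']
      rw [← Set.eq_of_subset_of_ncard_le hsub (by omega)]
      exact hfar
    rcases Nat.lt_or_ge {v | x ∈ V v}.ncard (k + 1) with h | h
    · rw [hΓs x hxX h]
      obtain ⟨i, hi⟩ : ∃ i : Fin (k + 1), e i.succ ∉ r '' {v | x ∈ V v} := by
        by_contra hcon
        push Not at hcon
        have h1 : range (e ∘ Fin.succ) ⊆ r '' {v | x ∈ V v} := by
          rintro _ ⟨i, rfl⟩; exact hcon i
        have h2 := ncard_le_ncard h1 (toFinite _)
        rw [← image_univ, ncard_image_of_injective _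
          (he.injective.comp (Fin.succ_injective _))] at h2
        have h3 := ncard_image_le (f := r) (toFinite {v | x ∈ V v})
        simp at h2
        omega
      refine kap_of_zero (hrr x hxX) (i := i) (hrrz x _ fun v hv hrv => hi ⟨v, hv, hrv⟩)
    · have hc : {v | x ∈ V v}.toFinset.card = k + 1 := by
        rw [← ncard_eq_toFinset_card']; omega
      obtain ⟨t, ht, htr⟩ : ∃ t : Fin (k + 1) → Fin M, StrictMono t ∧ range t = {v | x ∈ V v} := by
        refine ⟨_, ({v | x ∈ V v}.toFinset.orderEmbOfFin hc).strictMono, ?_⟩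
        rw [Finset.range_orderEmbOfFin]; simp
      rw [hΓm x hxX t ht htr.ge]
      have hct : c t = 0 := far_c t (by rw [htr]; exact hfar)
      by_cases hot : r ∘ t = e ∘ Fin.succ
      · have : n t = 1 := by simp [n, o, hot, hct]
        rw [this, L1]
        congr 1
        have hcoord : ∀ j, rr x j = ∑ i, if r (t i) = e j then ψ x (t i) else 0 := by
          intro j
          simp only [rr]
          rw [← Finset.sum_image (f := fun v => if r v = e j then ψ x v else 0)
            (s := Finset.univ) (g := t) (by intro a _ b _ h; exact ht.injective h)]
          symm
          refine Finset.sum_subset (Finset.subset_univ _) fun v _ hv => ?_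
          have : ψ x v = 0 := by
            rw [hψ0]
            intro hxv
            have : v ∈ range t := by rw [htr]; exact hxv
            obtain ⟨i, hi⟩ := this
            exact hv (Finset.mem_image.2 ⟨i, Finset.mem_univ i, hi⟩)
          simp [this]
        ext j
        rw [hcoord]
        have hti : ∀ i, r (t i) = e i.succ := fun i => congrFun hot i
        simp only [hti, he.injective.eq_iff]
        rcases Fin.eq_zero_or_eq_succ j with rfl | ⟨j, rfl⟩
        · simp [Fin.succ_ne_zero]
        · simp [Fin.succ_inj]
      · have : n t = 0 := by simp [n, o, hot, hct]
        rw [this, L0]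
        obtain ⟨i, hi⟩ : ∃ i : Fin (k + 1), e i.succ ∉ range (r ∘ t) := by
          by_contra hcon
          push Not at hcon
          exact hot (mono_eq (hr.comp ht.monotone) (he.comp Fin.strictMono_succ) (by
            rintro _ ⟨i, rfl⟩; exact hcon i))
        refine kap_of_zero (hrr x hxX) (i := i) (hrrz x _ fun v hv hrv => hi ?_)
        have : v ∈ range t := by rw [htr]; exact hv
        obtain ⟨a, rfl⟩ := this
        exact ⟨a, hrv⟩
  let F : X → Fin (k + 2) → ℝ := fun x => if x ∈ NF then Γ x else hom (θ x) (rr x)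
  have hFc : ContinuousOn F X2 := by
    have hcov : X2 ⊆ (X2 ∩ closure NF) ∪ NFᶜ := by
      intro x hx
      by_cases h : x ∈ NF
      · exact Or.inl ⟨hx, subset_closure h⟩
      · exact Or.inr h
    refine ContinuousOn.mono (ContinuousOn.union_of_isClosed ?_ ?_ (hX2.inter isClosed_closure)
      hNFo.isClosed_compl) hcov
    · refine (hΓ.1.mono inter_subset_left).congr fun x hx => ?_
      simp only [F]
      split_ifs with h
      · rfl
      · have : θ x = 1 := hθ1 hx.2
        rw [this, hom_one]
        exact hagree x hx.2 h
    · have : Continuous fun x => hom (θ x) (rr x) := by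
        unfold hom
        have h1 := θ.continuous
        have h2 : Continuous fun x => kap (rr x) := kap_cont.comp hrrc
        fun_prop
      refine this.continuousOn.congr fun x hx => ?_
      simp only [F]
      rw [if_neg hx]
  have hFS : ∀ x ∈ X2, F x ∈ SS k := by
    intro x hx
    simp only [F]
    split_ifs with h
    · exact hΓ.2 hx
    · simp only [NF, mem_setOf_eq, not_not] at h
      obtain ⟨j, hj⟩ := far_r _ h
      exact hom_mem (hrr x hx) ⟨j, hrrz x j hj⟩ (hθ x).1 (hθ x).2
  let Kc : Fin N → Set X := fun i => {x | x ∈ X2 ∧ ∃ j, e j = i ∧ ∀ l, F x j ≤ F x l}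
  have hKc : ∀ i, IsClosed (Kc i) := by
    intro i
    have : Kc i = ⋃ j : {j // e j = i}, ⋂ l, {x | x ∈ X2 ∧ F x j.1 ≤ F x l} := by
      ext x
      simp only [Kc, mem_iUnion, mem_iInter, mem_setOf_eq]
      constructor
      · rintro ⟨h1, j, h2, h3⟩; exact ⟨⟨j, h2⟩, fun l => ⟨h1, h3 l⟩⟩
      · rintro ⟨⟨j, h2⟩, h⟩; exact ⟨(h 0).1, j, h2, fun l => (h l).2⟩
    rw [this]
    refine isClosed_iUnion_of_finite fun j => isClosed_iInter fun l => ?_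
    have hc : ∀ j, ContinuousOn (fun x => F x j) X2 := fun j =>
      (continuous_apply j).comp_continuousOn hFc
    exact hX2.isClosed_le (hc _) (hc _)
  refine ⟨fun i => U i \ Kc i, ⟨fun i => (hU.op i).sdiff (hKc i), fun x => ?_,
    fun i x hx y hy => hU.mesh i x hx.1 y hy.1, fun x s hs => hU.ord x s fun i hi => (hs i hi).1⟩,
    fun i => diff_subset, fun x => ?_⟩
  · by_cases h : ∃ i, x ∈ U i ∧ i ∉ range e
    · obtain ⟨i, h1, h2⟩ := h
      exact ⟨i, h1, fun ⟨_, j, hj, _⟩ => h2 ⟨j, hj⟩⟩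
    · push Not at h
      have hx : x ∈ X2 := fun v hv => h _ (hVU v hv)
      obtain ⟨j, l, hjl⟩ : ∃ j l, F x l < F x j := by
        obtain ⟨a, b, hab⟩ := hFS x hx
        rcases hab.lt_or_gt with h | h
        · exact ⟨b, a, h⟩
        · exact ⟨a, b, h⟩
      refine ⟨e j, ?_, ?_⟩
      · by_cases hxW : x ∈ W
        · exact mem_iInter.1 hxW j
        · have h1 : x ∉ NF := fun h => hxW (hNFW (subset_closure h))
          have h2 : θ x = 0 := hθ0 hxW
          simp only [F, if_neg h1, h2, hom_zero] at hjl
          exact hrrU x j (by have := hrr0 x l; linarith)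
      · rintro ⟨_, j', hj', hm⟩
        rw [he.injective hj'] at hm
        exact absurd (hm l) (not_le.2 hjl)
  · by_contra hcon
    push Not at hcon
    have hxW : x ∈ W := mem_iInter.2 fun j => (hcon j).1
    obtain ⟨j, hj⟩ := Finite.exists_min (F x)
    exact (hcon j).2 ⟨hWX hxW, j, rfl, hj⟩

end shrink
end TD

open Filter Set
open scoped ENNReal
set_option linter.unusedSectionVars false
set_option linter.unusedVariables false

namespace TD

section hopf
variable {X : Type*} [MetricSpace X] [CompactSpace X]

theorem hopf_iter [Nonempty X] {k N : ℕ} (hk : 1 ≤ k) {ε₀ : ℝ} {U : Fin N → Set X}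
    (hU : Cov X (k + 1) ε₀ U) (hcd : CD X (k + 1)) (hhd : HD ℤ X k)
    (T : Finset (Fin (k + 2) → Fin N)) (hT : ∀ e ∈ T, StrictMono e) :
    ∃ U' : Fin N → Set X, Cov X (k + 1) ε₀ U' ∧ ∀ e ∈ T, ∀ x, ∃ j, x ∉ U' (e j) := by
  classical
  induction T using Finset.induction_on with
  | empty => exact ⟨U, hU, by simp⟩
  | insert e T _ ih =>
    obtain ⟨U1, h1, h2⟩ := ih fun e he => hT e (Finset.mem_insert_of_mem he)
    obtain ⟨U2, h3, h4, h5⟩ := hopf_shrink hk h1 hcd hhd e (hT e (Finset.mem_insert_self _ _))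
    refine ⟨U2, h3, fun e' he' x => ?_⟩
    rcases Finset.mem_insert.1 he' with rfl | he'
    · exact h5 x
    · obtain ⟨j, hj⟩ := h2 e' he' x
      exact ⟨j, fun h => hj (h4 _ h)⟩

theorem hopf_step {k : ℕ} (hk : 1 ≤ k) (hcd : CD X (k + 1)) (hhd : HD ℤ X k) : CD X k := by
  classical
  intro ε hε
  by_cases hX : Nonempty X
  swap
  · have : IsEmpty X := not_nonempty_iff.1 hX
    obtain ⟨N, U, h1, h2, h3, h4⟩ := hcd ε hε
    exact ⟨N, U, h1, h2, h3, fun x => (IsEmpty.false x).elim⟩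
  obtain ⟨N, U, hU⟩ := hcd ε hε
  obtain ⟨U', h, h'⟩ := hopf_iter hk hU hcd hhd (Finset.univ.filter fun e => StrictMono e)
    (fun e he => (Finset.mem_filter.1 he).2)
  refine ⟨N, U', h.1, h.2, h.3, fun x s hs => ?_⟩
  by_contra hc
  obtain ⟨t, ht, htc⟩ := Finset.exists_subset_card_eq (s := s) (n := k + 2) (by omega)
  obtain ⟨j, hj⟩ := h' (t.orderEmbOfFin htc) (by simp [(t.orderEmbOfFin htc).strictMono]) x
  exact hj (hs _ (ht (Finset.orderEmbOfFin_mem t htc j)))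

theorem hopf {k m : ℕ} (hk : 1 ≤ k) (hcd : CD X m) (hhd : HD ℤ X k) : CD X k := by
  induction m with
  | zero => exact hcd.mono (by omega)
  | succ m ih =>
    by_cases h : m + 1 ≤ k
    · exact hcd.mono h
    · exact ih (hopf_step (by omega) hcd (hhd.mono (by omega)))

end hopf
end TD

open Filter Set
open scoped ENNReal
set_option linter.unusedSectionVars false
set_option linter.unusedVariables false

namespace TD

section assembly
variable {K : Type*} [MetricSpace K]

/-- Splitting off the first coordinate, as an isometry. -/
def powIso (K : Type*) [MetricSpace K] (n : ℕ) : (Fin (n + 1) → K) ≃ᵢ K × (Fin n → K) where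
  toEquiv := (Fin.consEquiv fun _ => K).symm
  isometry_toFun := by
    apply Isometry.of_dist_eq
    intro x y
    apply le_antisymm
    · rw [Prod.dist_eq]
      refine max_le (dist_le_pi_dist x y 0) ?_
      rw [dist_pi_le_iff dist_nonneg]
      exact fun i => dist_le_pi_dist x y i.succ
    · rw [dist_pi_le_iff dist_nonneg]
      intro i
      rw [Prod.dist_eq]
      refine Fin.cases ?_ (fun i => ?_) i
      · exact le_max_left _ _
      · refine le_trans ?_ (le_max_right _ _)
        exact dist_le_pi_dist (fun j : Fin n => x j.succ) (fun j : Fin n => y j.succ) i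

def powOne (K : Type*) [MetricSpace K] : (Fin 1 → K) ≃ᵢ K := IsometryEquiv.funUnique (Fin 1) K

def powTwo (K : Type*) [MetricSpace K] : (Fin 2 → K) ≃ᵢ K × K :=
  IsometryEquiv.piFinTwo fun _ => K

variable [CompactSpace K]

theorem CD.pow_zero (h : CD K 0) (n : ℕ) : CD (Fin (n + 1) → K) 0 := by
  induction n with
  | zero => exact h.congr (powOne K)
  | succ n ih => exact (h.prod ih).congr (powIso K (n + 1))

theorem CD.pow_fin {m : ℕ} (h : CD K m) (n : ℕ) : ∃ M, CD (Fin (n + 1) → K) M := by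
  induction n with
  | zero => exact ⟨m, h.congr (powOne K)⟩
  | succ n ih =>
    obtain ⟨M, hM⟩ := ih
    exact ⟨_, (h.prod hM).congr (powIso K (n + 1))⟩

theorem HD.pow_upper {R : Type*} [CommRing R] {a : ℕ} (h : HD R K a) (n : ℕ) :
    HD R (Fin (n + 1) → K) ((n + 1) * a) := by
  induction n with
  | zero => simpa using h.congr (powOne K)
  | succ n ih =>
    have := (h.prod_upper ih).congr (powIso K (n + 1))
    convert this using 1
    ring

theorem HD.pow_field {F : Type*} [Field F] {a : ℕ} (h : HD F K (a + 1)) (h' : ¬ HD F K a) (n : ℕ) :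
    ¬ HD F (Fin (n + 1) → K) ((n + 1) * a + n) := by
  induction n with
  | zero =>
    intro hh
    apply h'
    simpa using hh.congr (powOne K).symm
  | succ n ih =>
    intro hh
    have h2 := h.pow_upper n
    have h3 := h.field_lower h' (b := (n + 1) * a + n) (by convert h2 using 1; ring) ih
    apply h3
    have := hh.congr (powIso K (n + 1)).symm
    convert this using 1
    ring

theorem HD.pow_tor {R : Type*} [CommRing R] [IsDomain R] [IsDiscreteValuationRing R] {L : Type*}
    [CommRing L] [Algebra R L] [IsFractionRing R L] {a : ℕ} (h' : ¬ HD R K a) (hL : HD L K a)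
    (hR : ∀ n, HD R (Fin (n + 1) → K) ((n + 1) * a + 1)) (n : ℕ) :
    ¬ HD R (Fin (n + 1) → K) ((n + 1) * a) := by
  have h1 : HD R K (a + 1) := by simpa using (hR 0).congr (powOne K).symm
  induction n with
  | zero =>
    intro hh
    apply h'
    simpa using hh.congr (powOne K).symm
  | succ n ih =>
    intro hh
    have h3 := HD.tor_lower (L := L) h1 h' hL (hR n) ih (hL.pow_upper n)
    apply h3
    have := hh.congr (powIso K (n + 1)).symm
    convert this using 1
    ring

theorem HD.pow_tor' {R : Type*} [CommRing R] [IsDomain R] [IsDiscreteValuationRing R] [CharZero R]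
    {a : ℕ} (h' : ¬ HD R K a) (hQ : HD ℚ K a)
    (hR : ∀ n, HD R (Fin (n + 1) → K) ((n + 1) * a + 1)) (n : ℕ) :
    ¬ HD R (Fin (n + 1) → K) ((n + 1) * a) := by
  have : CharZero (FractionRing R) :=
    charZero_of_injective_algebraMap (IsFractionRing.injective R (FractionRing R))
  exact HD.pow_tor (L := FractionRing R) h' (hQ.base (Rat.castHom (FractionRing R))) hR n

theorem HD.descend_many {R : Type*} [CommRing R] {e m : ℕ} (h : HD R K m)
    (hp : ∀ j, e < j → PV R K j) : HD R K e := by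
  induction m with
  | zero => exact h.mono (by omega)
  | succ m ih =>
    by_cases hm : m + 1 ≤ e
    · exact h.mono hm
    · exact ih (h.descend (hp _ (by omega)))

theorem topDim_eq_iff (a : ℕ) : MeanDimPaper.topDim K = ((a + 1 : ℕ) : ℕ∞) ↔
    CD K (a + 1) ∧ ¬ CD K a := by
  rw [← topDim_le_iff, ← topDim_le_iff, not_le]
  constructor
  · intro h
    rw [h]
    exact ⟨le_rfl, by exact_mod_cast Nat.lt_succ_self a⟩
  · rintro ⟨h1, h2⟩
    apply le_antisymm h1
    push_cast
    exact Order.add_one_le_of_lt h2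

theorem case_one {F : Type*} [Field F] {a : ℕ} (hcd : CD K (a + 1)) (h : ¬ HD F K a) (n : ℕ) :
    MeanDimPaper.topDim (Fin (n + 1) → K) = (((n + 1) * (a + 1) : ℕ) : ℕ∞) := by
  have e : (n + 1) * (a + 1) = ((n + 1) * a + n) + 1 := by ring
  rw [e, topDim_eq_iff]
  constructor
  · obtain ⟨M, hM⟩ := hcd.pow_fin n
    refine hopf (by omega) hM ?_
    rw [← e]
    exact hcd.hd.pow_upper n
  · intro hc
    exact (hcd.hd.base (Int.castRingHom F)).pow_field h n (hc.hd.base (Int.castRingHom F))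

theorem case_two {a : ℕ} (ha : 1 ≤ a) (hcd : CD K (a + 1)) (hcd' : ¬ CD K a)
    (hQ : HD ℚ K a) (hF : ∀ p : ℕ, p.Prime → HD (ZMod p) K a) (n : ℕ) :
    MeanDimPaper.topDim (Fin (n + 1) → K) = (((n + 1) * a + 1 : ℕ) : ℕ∞) := by
  have hZ : ∀ n, HD ℤ (Fin (n + 1) → K) ((n + 1) * a + 1) := by
    intro n
    refine (hcd.hd.pow_upper n).descend_many fun j hj => ?_
    obtain ⟨k, rfl⟩ : ∃ k, j = k + 2 := ⟨j - 2, by omega⟩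
    exact pv_int ((hQ.pow_upper n).mono (by omega))
      fun p hp => ((hF p hp).pow_upper n).mono (by omega)
  rw [topDim_eq_iff]
  constructor
  · obtain ⟨M, hM⟩ := hcd.pow_fin n
    exact hopf (by omega) hM (hZ n)
  · intro hc
    have h1 : ¬ HD ℤ K a := fun h => hcd' (hopf ha hcd h)
    have h2 : ¬ PV ℤ K (a + 1) := fun h => h1 (hcd.hd.descend h)
    have h3 : ∃ (M : Ideal ℤ) (hM : M.IsMaximal), ¬ PV (Localization.AtPrime M) K (a + 1) := by
      by_contra hcon
      push Not at hcon
      exact h2 (pv_int_of_local hcon)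
    obtain ⟨M, hM, h4⟩ := h3
    have h5 : ¬ HD (Localization.AtPrime M) K a := fun h => h4 (h.pv le_rfl)
    have hM0 : M ≠ ⊥ := Ring.ne_bot_of_isMaximal_of_not_isField hM Int.not_isField
    have : IsDomain (Localization.AtPrime M) :=
      IsLocalization.isDomain_localization M.primeCompl_le_nonZeroDivisors
    have : IsDiscreteValuationRing (Localization.AtPrime M) :=
      IsLocalization.AtPrime.isDiscreteValuationRing_of_dedekind_domain ℤ hM0 _
    have hinj : Function.Injective (algebraMap ℤ (Localization.AtPrime M)) :=
      IsLocalization.injective _ M.primeCompl_le_nonZeroDivisors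
    have : CharZero (Localization.AtPrime M) := ⟨fun x y h => by
      have : algebraMap ℤ (Localization.AtPrime M) x = algebraMap ℤ (Localization.AtPrime M) y := by
        simpa using h
      exact_mod_cast hinj this⟩
    exact HD.pow_tor' h5 hQ (fun n => (hZ n).base (algebraMap ℤ _)) n
      (hc.hd.base (algebraMap ℤ _))

theorem topDim_congr_le {X Y : Type*} [MetricSpace X] [CompactSpace X] [MetricSpace Y]
    [CompactSpace Y] (e : X ≃ᵢ Y) : MeanDimPaper.topDim X ≤ MeanDimPaper.topDim Y := by
  cases h : MeanDimPaper.topDim Y with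
  | top => exact le_top
  | coe m => exact (topDim_le_iff m).2 (((topDim_le_iff m).1 h.le).congr e)

theorem topDim_congr {X Y : Type*} [MetricSpace X] [CompactSpace X] [MetricSpace Y]
    [CompactSpace Y] (e : X ≃ᵢ Y) : MeanDimPaper.topDim X = MeanDimPaper.topDim Y :=
  le_antisymm (topDim_congr_le e) (topDim_congr_le e.symm)

theorem final {K : Type*} [MetricSpace K] [CompactSpace K] (hfin : MeanDimPaper.topDim K ≠ ⊤)
    (n : ℕ) (hn : 1 ≤ n) :
    (MeanDimPaper.topDim (K × K) = 2 * MeanDimPaper.topDim K →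
      MeanDimPaper.topDim (Fin n → K) = (n : ℕ∞) * MeanDimPaper.topDim K) ∧
    (MeanDimPaper.topDim (K × K) + 1 = 2 * MeanDimPaper.topDim K →
      MeanDimPaper.topDim (Fin n → K) + (n : ℕ∞) = (n : ℕ∞) * MeanDimPaper.topDim K + 1) := by
  obtain ⟨n, rfl⟩ : ∃ m, n = m + 1 := ⟨n - 1, by omega⟩
  obtain ⟨d, hd⟩ := ENat.ne_top_iff_exists.1 hfin
  rw [← topDim_congr (powTwo K)]
  cases d with
  | zero =>
    have h0 : CD K 0 := (topDim_le_iff 0).1 hd.symm.le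
    have h1 : MeanDimPaper.topDim (Fin (n + 1) → K) = 0 := by
      have := (topDim_le_iff 0).2 (h0.pow_zero n)
      simpa using this
    rw [← hd, h1]
    simp
  | succ a =>
    obtain ⟨hcd, hcd'⟩ := (topDim_eq_iff a).1 hd.symm
    rw [← hd]
    by_cases hQ : HD ℚ K a
    · by_cases hF : ∀ p : ℕ, p.Prime → HD (ZMod p) K a
      · have ha : 1 ≤ a := by
          rcases Nat.eq_zero_or_pos a with rfl | h
          · exact (hcd' hQ.cd_zero).elim
          · exact h
        rw [case_two ha hcd hcd' hQ hF n, case_two ha hcd hcd' hQ hF 1]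
        constructor
        · intro h
          have h' : (1 + 1) * a + 1 = 2 * (a + 1) := by exact_mod_cast h
          omega
        · intro _
          have : (n + 1) * a + 1 + (n + 1) = (n + 1) * (a + 1) + 1 := by ring
          exact_mod_cast this
      · push Not at hF
        obtain ⟨p, hp, hF⟩ := hF
        have : Fact p.Prime := ⟨hp⟩
        rw [case_one hcd hF n, case_one hcd hF 1]
        constructor
        · intro _
          push_cast
          rfl
        · intro h
          have h' : (1 + 1) * (a + 1) + 1 = 2 * (a + 1) := by exact_mod_cast h
          omega
    · rw [case_one hcd hQ n, case_one hcd hQ 1]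
      constructor
      · intro _
        push_cast
        rfl
      · intro h
        have h' : (1 + 1) * (a + 1) + 1 = 2 * (a + 1) := by exact_mod_cast h
        omega

end assembly
end TD

namespace MeanDimPaper

variable {X : Type*} [TopologicalSpace X]

/-- for a finite dimensional compact metric space `K` and every `n ≥ 1`:
if `K` is of basic type (`dim K² = 2 dim K`) then `dim Kⁿ = n dim K`, and if `K` is of
exceptional type (`dim K² = 2 dim K - 1`, stated additively as `dim K² + 1 = 2 dim K`)
then `dim Kⁿ = n dim K - n + 1` (stated additively as `dim Kⁿ + n = n dim K + 1`). -/
theorem topDim_pow {K : Type*} [MetricSpace K] [CompactSpace K]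
    (hfin : topDim K ≠ ⊤) (n : ℕ) (hn : 1 ≤ n) :
    (topDim (K × K) = 2 * topDim K → topDim (Fin n → K) = (n : ℕ∞) * topDim K) ∧
    (topDim (K × K) + 1 = 2 * topDim K →
      topDim (Fin n → K) + (n : ℕ∞) = (n : ℕ∞) * topDim K + 1) := TD.final hfin n hn

end MeanDimPaper
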